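/- Assume condition (A), and let f be a linear functional on D(Ω) such that sup{ f(u) : u ∈ D(Ω), Q_V(u) = 1 } < ∞. Then there exists a locally integrable function u on Ω with weak gradient v such that: ∫_Ω (|u|^q + |v|^q)W dx < ∞; there exist test functions φ_j ∈ D(Ω) with ∫_Ω (|u−φ_j|^q + |v−∇φ_j|^q)W dx → 0 (that is, u belongs to the weighted Sobolev space W^{1,q}_0(Ω, W dx)); and for every ζ ∈ D(Ω) the integrals below are finite and ∫_Ω |v|^{p−2}v·∇ζ dx − ∫_Ω V|u|^{p−2}u ζ dx = f(ζ), i.e., u is a distributional solution of −Δ_p u − V|u|^{p−2}u = f on Ω. -/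

import Mathlib

open MeasureTheory Real Filter Topology RealInnerProductSpace

noncomputable section

abbrev Euc (d : ℕ) : Type := EuclideanSpace ℝ (Fin d)

/-- `u` is a test function on `U`: smooth with compact support contained in `U`. -/
def IsTestFun {d : ℕ} (U : Set (Euc d)) (u : Euc d → ℝ) : Prop :=
  ContDiff ℝ (⊤ : ℕ∞) u ∧ HasCompactSupport u ∧ tsupport u ⊆ U

/-- `v` is the weak gradient of `u` on `U`. -/
def HasWeakGradOn {d : ℕ} (U : Set (Euc d)) (u : Euc d → ℝ) (v : Euc d → Euc d) : Prop :=
  ∀ ζ : Euc d → ℝ, IsTestFun U ζ → ∀ i : Fin d,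
    (∫ x in U, u x * fderiv ℝ ζ x (EuclideanSpace.single i 1))
      = - ∫ x in U, v x i * ζ x

/-- The vector field `|s|^{p-2} s` (equal to `0` at `s = 0`). -/
def pvec {d : ℕ} (p : ℝ) (s : Euc d) : Euc d := ‖s‖ ^ (p - 2) • s

/-- The scalar function `|s|^{p-2} s` (equal to `0` at `s = 0`). -/
def psc (p : ℝ) (s : ℝ) : ℝ := |s| ^ (p - 2) * s

/-- The form `Q_V(u) = ∫_Ω |∇u|^p - ∫_Ω V |u|^p` (for smooth `u`). -/
def QV {d : ℕ} (p : ℝ) (U : Set (Euc d)) (V : Euc d → ℝ) (u : Euc d → ℝ) : ℝ :=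
  (∫ x in U, ‖gradient u x‖ ^ p) - ∫ x in U, V x * |u x| ^ p

/-! ### Pointwise inequalities -/

/-- The map `s ↦ |s|^{p-2} s` on a real inner product space. -/
def pPow {H : Type*} [NormedAddCommGroup H] [InnerProductSpace ℝ H] (p : ℝ) (s : H) : H :=
  ‖s‖ ^ (p - 2) • s

section Pointwise

variable {H : Type*} [NormedAddCommGroup H] [InnerProductSpace ℝ H] {p q : ℝ}

lemma norm_pPow (hp : 1 < p) (s : H) : ‖pPow p s‖ = ‖s‖ ^ (p - 1) := by
  rcases eq_or_ne s 0 with rfl | hs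
  · simp [pPow, Real.zero_rpow (by linarith : p - 1 ≠ 0)]
  · have h : 0 < ‖s‖ := norm_pos_iff.2 hs
    rw [pPow, norm_smul, Real.norm_of_nonneg (by positivity)]
    nth_rewrite 2 [← Real.rpow_one ‖s‖]
    rw [← Real.rpow_add h]; ring_nf

lemma inner_pPow_self (hp : 1 < p) (s : H) : ⟪pPow p s, s⟫ = ‖s‖ ^ p := by
  rcases eq_or_ne s 0 with rfl | hs
  · simp [pPow, Real.zero_rpow (by linarith : p ≠ 0)]
  · have h : 0 < ‖s‖ := norm_pos_iff.2 hs
    rw [pPow, real_inner_smul_left, real_inner_self_eq_norm_sq, ← Real.rpow_natCast,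
      ← Real.rpow_add h]
    norm_num

lemma continuous_pPow (hp : 1 < p) : Continuous (pPow p : H → H) := by
  rw [continuous_iff_continuousAt]
  intro s
  rcases eq_or_ne s 0 with rfl | hs
  · have h0 : pPow p (0 : H) = 0 := by simp [pPow]
    rw [ContinuousAt, h0, tendsto_zero_iff_norm_tendsto_zero]
    simp_rw [norm_pPow hp]
    have h : Continuous fun s : H => ‖s‖ ^ (p - 1) :=
      continuous_norm.rpow_const fun _ => Or.inr (by linarith)
    simpa [Real.zero_rpow (by linarith : p - 1 ≠ 0)] using h.tendsto (0 : H)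
  · exact (continuousAt_id.norm.rpow_const (Or.inl (norm_ne_zero_iff.2 hs))).smul continuousAt_id

lemma pPow_smul {c : ℝ} (hc : 0 < c) (s : H) :
    pPow p (c • s) = c ^ (p - 1) • pPow p s := by
  have h : c ^ (p - 1) = c ^ (p - 2) * c := by
    nth_rewrite 3 [← Real.rpow_one c]
    rw [← Real.rpow_add hc]; ring_nf
  rw [pPow, pPow, norm_smul, Real.norm_of_nonneg hc.le, Real.mul_rpow hc.le (norm_nonneg _), h,
    smul_smul, smul_smul]
  ring_nf

/-- Young's inequality with a parameter. -/
lemma young_param {a b l α s : ℝ} (ha : 0 ≤ a) (hb : 0 ≤ b) (hl : 0 < l) (hα : 0 < α)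
    (hs : α < s) :
    a * b ^ α ≤ l * b ^ s + l ^ (-(α / (s - α))) * a ^ (s / (s - α)) := by
  have hd : 0 < s - α := by linarith
  rcases le_or_gt a (l * b ^ (s - α)) with h | h
  · have h1 : a * b ^ α ≤ l * b ^ s := by
      calc a * b ^ α ≤ l * b ^ (s - α) * b ^ α := by gcongr
        _ = l * b ^ s := by
          rw [mul_assoc, ← Real.rpow_add_of_nonneg hb hd.le hα.le]; ring_nf
    have h2 : 0 ≤ l ^ (-(α / (s - α))) * a ^ (s / (s - α)) := by positivity
    linarith
  · have ha' : 0 < a := lt_of_le_of_lt (by positivity) h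
    have h1 : b ≤ (a / l) ^ (1 / (s - α)) := by
      have : b ^ (s - α) ≤ a / l := by rw [le_div_iff₀ hl]; linarith
      calc b = (b ^ (s - α)) ^ (1 / (s - α)) := by
            rw [← Real.rpow_mul hb, mul_one_div_cancel hd.ne', Real.rpow_one]
        _ ≤ _ := by gcongr
    have h2 : a * b ^ α ≤ l ^ (-(α / (s - α))) * a ^ (s / (s - α)) := by
      calc a * b ^ α ≤ a * ((a / l) ^ (1 / (s - α))) ^ α := by gcongr
        _ = a ^ (1 : ℝ) * ((a / l) ^ (α / (s - α))) := by
            rw [← Real.rpow_mul (by positivity), Real.rpow_one]; ring_nf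
        _ = l ^ (-(α / (s - α))) * a ^ (s / (s - α)) := by
            have : s / (s - α) = 1 + α / (s - α) := by field_simp; ring
            rw [this, Real.rpow_add ha', Real.div_rpow ha'.le hl.le, Real.rpow_neg hl.le]
            field_simp
    have : 0 ≤ l * b ^ s := by positivity
    linarith

lemma add_rpow_le_two_rpow_mul {x y : ℝ} (hx : 0 ≤ x) (hy : 0 ≤ y) (hp : 0 ≤ p) :
    (x + y) ^ p ≤ 2 ^ p * (x ^ p + y ^ p) := by
  have h1 : x + y ≤ 2 * max x y := by
    linarith [le_max_left x y, le_max_right x y]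
  have h2 : (max x y) ^ p ≤ x ^ p + y ^ p := by
    rcases max_cases x y with h | h <;> rw [h.1]
    · linarith [Real.rpow_nonneg hy p]
    · linarith [Real.rpow_nonneg hx p]
  calc (x + y) ^ p ≤ (2 * max x y) ^ p := by gcongr
    _ = 2 ^ p * (max x y) ^ p := Real.mul_rpow (by norm_num) (le_max_of_le_left hx)
    _ ≤ _ := by gcongr

lemma rpow_sub_one_mul_le (hp : 1 < p) {x y : ℝ} (hx : 0 ≤ x) (hy : 0 ≤ y) :
    p * (x ^ (p - 1) * y) ≤ (p - 1) * x ^ p + y ^ p := by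
  have hp0 : 0 < p := by linarith
  have h := Real.young_inequality_of_nonneg (Real.rpow_nonneg hx (p - 1)) hy
    (Real.HolderConjugate.conjExponent hp).symm
  have e : (x ^ (p - 1)) ^ (p.conjExponent) = x ^ p := by
    rw [← Real.rpow_mul hx, Real.conjExponent]; congr 1
    have : p - 1 ≠ 0 := by linarith
    field_simp
  rw [e, Real.conjExponent] at h
  have h' := mul_le_mul_of_nonneg_left h hp0.le
  have : p * (x ^ p / (p / (p - 1)) + y ^ p / p) = (p - 1) * x ^ p + y ^ p := by field_simp
  linarith

lemma norm_rpow_add_inner_le (hp : 1 < p) (a b : H) :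
    ‖a‖ ^ p + p * ⟪pPow p a, b - a⟫ ≤ ‖b‖ ^ p := by
  rw [inner_sub_right, inner_pPow_self hp]
  have h1 : ⟪pPow p a, b⟫ ≤ ‖a‖ ^ (p - 1) * ‖b‖ := by
    rw [← norm_pPow hp]; exact real_inner_le_norm _ _
  have h2 := rpow_sub_one_mul_le hp (norm_nonneg a) (norm_nonneg b)
  have h3 := mul_le_mul_of_nonneg_left h1 (by linarith : 0 ≤ p)
  linarith

lemma pPow_gap_nonneg (hp : 1 < p) (a b : H) : 0 ≤ ⟪pPow p a - pPow p b, a - b⟫ := by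
  have h1 := norm_rpow_add_inner_le hp a b
  have h2 := norm_rpow_add_inner_le hp b a
  have e : ⟪pPow p a - pPow p b, a - b⟫ = - ⟪pPow p a, b - a⟫ - ⟪pPow p b, a - b⟫ := by
    simp only [inner_sub_left, inner_sub_right]; ring
  rw [e]; nlinarith

lemma pPow_gap_pos (hp : 1 < p) {a b : H} (hab : a ≠ b) :
    0 < ⟪pPow p a - pPow p b, a - b⟫ := by
  have hp1 : 0 < p - 1 := by linarith
  have key : ⟪pPow p a - pPow p b, a - b⟫ =
      (‖a‖ ^ (p - 1) - ‖b‖ ^ (p - 1)) * (‖a‖ - ‖b‖)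
        + (‖a‖ ^ (p - 1) * ‖b‖ - ⟪pPow p a, b⟫) + (‖b‖ ^ (p - 1) * ‖a‖ - ⟪pPow p b, a⟫) := by
    have hr : ∀ s : H, ‖s‖ ^ p = ‖s‖ ^ (p - 1) * ‖s‖ := fun s => by
      nth_rewrite 3 [← Real.rpow_one ‖s‖]
      rw [← Real.rpow_add_of_nonneg (norm_nonneg _) hp1.le zero_le_one]; ring_nf
    have e1 := inner_pPow_self hp a
    have e2 := inner_pPow_self hp b
    simp only [inner_sub_left, inner_sub_right]
    rw [e1, e2, hr a, hr b]; ring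
  have hA : 0 ≤ ‖a‖ ^ (p - 1) * ‖b‖ - ⟪pPow p a, b⟫ := by
    rw [← norm_pPow hp]; linarith [real_inner_le_norm (pPow p a) b]
  have hB : 0 ≤ ‖b‖ ^ (p - 1) * ‖a‖ - ⟪pPow p b, a⟫ := by
    rw [← norm_pPow hp]; linarith [real_inner_le_norm (pPow p b) a]
  rcases lt_trichotomy ‖a‖ ‖b‖ with h | h | h
  · have := Real.rpow_lt_rpow (norm_nonneg a) h hp1
    nlinarith
  · have hb : b ≠ 0 := by
      rintro rfl; simp at h; exact hab h
    have ha : a ≠ 0 := by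
      rintro rfl; exact hb (norm_eq_zero.1 (by simpa using h.symm))
    have hlt : ⟪a, b⟫ < ‖a‖ * ‖b‖ := by
      refine inner_lt_norm_mul_iff_real.2 fun he => hab ?_
      rw [h] at he
      exact (smul_right_injective H (norm_ne_zero_iff.2 hb) he)
    have hpos : 0 < ‖a‖ ^ (p - 2) := Real.rpow_pos_of_pos (norm_pos_iff.2 ha) _
    have hs : ‖a‖ ^ (p - 1) * ‖b‖ - ⟪pPow p a, b⟫ = ‖a‖ ^ (p - 2) * (‖a‖ * ‖b‖ - ⟪a, b⟫) := by
      rw [pPow, real_inner_smul_left, ← norm_pPow hp, pPow, norm_smul,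
        Real.norm_of_nonneg hpos.le]; ring
    have : 0 < ‖a‖ ^ (p - 2) * (‖a‖ * ‖b‖ - ⟪a, b⟫) := mul_pos hpos (by linarith)
    have h0 : (‖a‖ ^ (p - 1) - ‖b‖ ^ (p - 1)) * (‖a‖ - ‖b‖) = 0 := by rw [h]; ring
    rw [key, h0, hs]; linarith
  · have := Real.rpow_lt_rpow (norm_nonneg b) h hp1
    nlinarith

lemma exists_pPow_gap_lower [FiniteDimensional ℝ H] (hp : 1 < p) {σ : ℝ} (hσ : 0 < σ) (R : ℝ) :
    ∃ θ > 0, ∀ a b : H, ‖a‖ ≤ R → ‖b‖ ≤ R → σ ≤ ‖a - b‖ →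
      θ ≤ ⟪pPow p a - pPow p b, a - b⟫ := by
  let S : Set (H × H) := (Metric.closedBall 0 R ×ˢ Metric.closedBall 0 R) ∩ {z | σ ≤ ‖z.1 - z.2‖}
  have hS : IsCompact S :=
    ((isCompact_closedBall _ _).prod (isCompact_closedBall _ _)).inter_right
      (isClosed_le continuous_const (by fun_prop))
  have hc : Continuous fun z : H × H => ⟪pPow p z.1 - pPow p z.2, z.1 - z.2⟫ := by
    have := continuous_pPow (H := H) hp
    fun_prop
  obtain ⟨θ, hθ, h⟩ := hS.exists_forall_le' (a := 0) hc.continuousOn (by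
    rintro ⟨a, b⟩ ⟨-, h⟩
    refine pPow_gap_pos hp fun hab => ?_
    simp only at hab
    simp [hab] at h; linarith)
  refine ⟨θ, hθ, fun a b ha hb hab => h (a, b) ⟨⟨?_, ?_⟩, hab⟩⟩ <;> simpa

lemma exists_norm_rpow_add_le [FiniteDimensional ℝ H] (hp : 1 < p) {δ : ℝ} (hδ : 0 < δ) :
    ∃ t > 0, t ≤ 1 ∧ ∀ a b : H,
      ‖a + t • b‖ ^ p ≤ ‖a‖ ^ p + p * t * ⟪pPow p a, b⟫ + p * t * (δ * (‖a‖ + ‖b‖) ^ p) := by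
  have huc := (isCompact_closedBall (0 : H) 2).uniformContinuousOn_of_continuous
    (continuous_pPow hp).continuousOn
  obtain ⟨η, hη, hu⟩ := Metric.uniformContinuousOn_iff.1 huc δ hδ
  refine ⟨min 1 (η / 2), by positivity, min_le_left _ _, fun a b => ?_⟩
  set t := min 1 (η / 2) with ht
  have ht0 : 0 < t := by positivity
  have ht1 : t ≤ 1 := min_le_left _ _
  have ht2 : t < η := lt_of_le_of_lt (min_le_right _ _) (by linarith)
  have h1 := norm_rpow_add_inner_le hp (a + t • b) a
  have e1 : a - (a + t • b) = -(t • b) := by abel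
  rw [e1, inner_neg_right, real_inner_smul_right] at h1
  have h2 : ⟪pPow p (a + t • b), b⟫ ≤ ⟪pPow p a, b⟫ + δ * (‖a‖ + ‖b‖) ^ p := by
    rcases (by positivity : 0 ≤ ‖a‖ + ‖b‖).eq_or_lt with hc | hc
    · have hb : b = 0 := by
        rw [← norm_eq_zero]; linarith [norm_nonneg a, norm_nonneg b]
      rw [← hc]; simp [hb, Real.zero_rpow (by linarith : p ≠ 0)]
    · set c := ‖a‖ + ‖b‖ with hcd
      have ha1 : ‖c⁻¹ • a‖ ≤ 1 := by
        rw [norm_smul, norm_inv, Real.norm_of_nonneg hc.le, inv_mul_le_iff₀ hc]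
        linarith [norm_nonneg b]
      have hb1 : ‖c⁻¹ • b‖ ≤ 1 := by
        rw [norm_smul, norm_inv, Real.norm_of_nonneg hc.le, inv_mul_le_iff₀ hc]
        linarith [norm_nonneg a]
      have htb : ‖t • c⁻¹ • b‖ ≤ t := by
        rw [norm_smul, Real.norm_of_nonneg ht0.le]; nlinarith
      have hd := hu (c⁻¹ • a + t • c⁻¹ • b) (by
          simp only [Metric.mem_closedBall, dist_zero_right]
          linarith [norm_add_le (c⁻¹ • a) (t • c⁻¹ • b)])
        (c⁻¹ • a) (by simp only [Metric.mem_closedBall, dist_zero_right]; linarith)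
        (by rw [dist_eq_norm, add_sub_cancel_left]; linarith)
      rw [dist_eq_norm] at hd
      have e2 : pPow p (a + t • b) - pPow p a
          = c ^ (p - 1) • (pPow p (c⁻¹ • a + t • c⁻¹ • b) - pPow p (c⁻¹ • a)) := by
        rw [smul_sub, ← pPow_smul hc, ← pPow_smul hc, smul_add, smul_smul, mul_inv_cancel₀ hc.ne',
          one_smul, smul_comm t, smul_smul, mul_inv_cancel₀ hc.ne', one_smul]
      have h3 : ⟪pPow p (a + t • b) - pPow p a, b⟫ ≤ c ^ (p - 1) * δ * c := by
        refine (real_inner_le_norm _ _).trans ?_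
        rw [e2, norm_smul, Real.norm_of_nonneg (by positivity)]
        gcongr
        linarith [norm_nonneg a]
      have h4 : c ^ (p - 1) * δ * c = δ * c ^ p := by
        have : c ^ p = c ^ (p - 1) * c := by
          nth_rewrite 3 [← Real.rpow_one c]
          rw [← Real.rpow_add hc]; ring_nf
        rw [this]; ring
      rw [inner_sub_left] at h3
      linarith
  have h3 := mul_le_mul_of_nonneg_left h2 (by positivity : 0 ≤ p * t)
  nlinarith

lemma norm_midpoint_rpow_le (hq : 1 < q) (a b : H) :
    ‖(1 / 2 : ℝ) • (a + b)‖ ^ q ≤ (‖a‖ ^ q + ‖b‖ ^ q) / 2 := by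
  have h1 := norm_rpow_add_inner_le hq ((1 / 2 : ℝ) • (a + b)) a
  have h2 := norm_rpow_add_inner_le hq ((1 / 2 : ℝ) • (a + b)) b
  have e : ⟪pPow q ((1 / 2 : ℝ) • (a + b)), a - (1 / 2 : ℝ) • (a + b)⟫
      + ⟪pPow q ((1 / 2 : ℝ) • (a + b)), b - (1 / 2 : ℝ) • (a + b)⟫ = 0 := by
    rw [← inner_add_right]
    have : a - (1 / 2 : ℝ) • (a + b) + (b - (1 / 2 : ℝ) • (a + b)) = 0 := by module
    rw [this, inner_zero_right]
  nlinarith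

lemma norm_midpoint_rpow_lt (hq : 1 < q) {a b : H} (hab : a ≠ b) :
    ‖(1 / 2 : ℝ) • (a + b)‖ ^ q < (‖a‖ ^ q + ‖b‖ ^ q) / 2 := by
  rcases eq_or_ne ‖a‖ ‖b‖ with h | h
  · have h1 : ‖(1 / 2 : ℝ) • (a + b)‖ < ‖b‖ := by
      have := norm_add_lt_of_not_sameRay (x := a) (y := b)
        (fun hs => hab ((sameRay_iff_of_norm_eq h).1 hs))
      rw [norm_smul]; norm_num; linarith
    have := Real.rpow_lt_rpow (norm_nonneg _) h1 (by linarith : 0 < q)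
    rw [h]; linarith
  · have h1 := (strictConvexOn_rpow hq).2 (norm_nonneg a) (norm_nonneg b) h
      (by norm_num : (0 : ℝ) < 1 / 2) (by norm_num : (0 : ℝ) < 1 / 2) (by norm_num)
    simp only [smul_eq_mul] at h1
    have h2 : ‖(1 / 2 : ℝ) • (a + b)‖ ≤ 1 / 2 * ‖a‖ + 1 / 2 * ‖b‖ := by
      rw [norm_smul]; norm_num; linarith [norm_add_le a b]
    have := Real.rpow_le_rpow (norm_nonneg _) h2 (by linarith : 0 ≤ q)
    linarith

/-- Quantitative uniform convexity of `|·|^q`. -/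
lemma exists_norm_sub_rpow_le [FiniteDimensional ℝ H] (hq : 1 < q) {ε : ℝ} (hε : 0 < ε) :
    ∃ C ≥ 0, ∀ a b : H, ‖a - b‖ ^ q ≤ ε * (‖a‖ ^ q + ‖b‖ ^ q)
      + C * ((‖a‖ ^ q + ‖b‖ ^ q) / 2 - ‖(1 / 2 : ℝ) • (a + b)‖ ^ q) := by
  have hq0 : 0 < q := by linarith
  have hcr : Continuous fun x : ℝ => x ^ q := Real.continuous_rpow_const hq0.le
  let S : Set (H × H) := (Metric.closedBall 0 1 ×ˢ Metric.closedBall 0 1) ∩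
    {z | ε ≤ ‖z.1 - z.2‖ ^ q}
  have hS : IsCompact S :=
    ((isCompact_closedBall _ _).prod (isCompact_closedBall _ _)).inter_right
      (isClosed_le continuous_const (hcr.comp (by fun_prop)))
  have hc : Continuous fun z : H × H =>
      (‖z.1‖ ^ q + ‖z.2‖ ^ q) / 2 - ‖(1 / 2 : ℝ) • (z.1 + z.2)‖ ^ q := by
    have h1 : Continuous fun z : H × H => ‖z.1‖ ^ q := hcr.comp (by fun_prop)
    have h2 : Continuous fun z : H × H => ‖z.2‖ ^ q := hcr.comp (by fun_prop)
    have h3 : Continuous fun z : H × H => ‖(1 / 2 : ℝ) • (z.1 + z.2)‖ ^ q :=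
      hcr.comp (by fun_prop)
    fun_prop
  obtain ⟨θ, hθ, h⟩ := hS.exists_forall_le' (a := 0) hc.continuousOn (by
    rintro ⟨a, b⟩ ⟨-, h⟩
    have := norm_midpoint_rpow_lt hq (a := a) (b := b) (by
      rintro rfl
      simp [Real.zero_rpow hq0.ne'] at h; linarith)
    simp only; linarith)
  refine ⟨2 ^ q / θ, by positivity, fun a b => ?_⟩
  have hgap : 0 ≤ (‖a‖ ^ q + ‖b‖ ^ q) / 2 - ‖(1 / 2 : ℝ) • (a + b)‖ ^ q := by
    linarith [norm_midpoint_rpow_le hq a b]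
  set c := max ‖a‖ ‖b‖ with hcd
  have hac : ‖a‖ ≤ c := le_max_left _ _
  have hbc : ‖b‖ ≤ c := le_max_right _ _
  have hcle : c ^ q ≤ ‖a‖ ^ q + ‖b‖ ^ q := by
    rcases max_cases ‖a‖ ‖b‖ with h | h <;> rw [hcd, h.1]
    · linarith [Real.rpow_nonneg (norm_nonneg b) q]
    · linarith [Real.rpow_nonneg (norm_nonneg a) q]
  rcases ((norm_nonneg a).trans hac).eq_or_lt with hc0 | hc0
  · have ha : a = 0 := norm_le_zero_iff.1 (by linarith)
    have hb : b = 0 := norm_le_zero_iff.1 (by linarith)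
    simp [ha, hb, Real.zero_rpow hq0.ne']
  have hcq : 0 < c ^ q := Real.rpow_pos_of_pos hc0 _
  have hsc : ∀ x : H, ‖c⁻¹ • x‖ ^ q = ‖x‖ ^ q / c ^ q := fun x => by
    rw [norm_smul, norm_inv, Real.norm_of_nonneg hc0.le, inv_mul_eq_div,
      Real.div_rpow (norm_nonneg _) hc0.le]
  by_cases hcase : ε ≤ ‖c⁻¹ • a - c⁻¹ • b‖ ^ q
  · have hz := h (c⁻¹ • a, c⁻¹ • b) ⟨⟨by
        simp only [Metric.mem_closedBall, dist_zero_right]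
        rw [norm_smul, norm_inv, Real.norm_of_nonneg hc0.le, inv_mul_le_iff₀ hc0]; linarith, by
        simp only [Metric.mem_closedBall, dist_zero_right]
        rw [norm_smul, norm_inv, Real.norm_of_nonneg hc0.le, inv_mul_le_iff₀ hc0]; linarith⟩, hcase⟩
    simp only at hz
    rw [← smul_add, smul_comm, hsc, hsc, hsc] at hz
    have hz' : θ * c ^ q ≤ (‖a‖ ^ q + ‖b‖ ^ q) / 2 - ‖(1 / 2 : ℝ) • (a + b)‖ ^ q := by
      have := mul_le_mul_of_nonneg_right hz hcq.le
      have e : ((‖a‖ ^ q / c ^ q + ‖b‖ ^ q / c ^ q) / 2 - ‖(1 / 2 : ℝ) • (a + b)‖ ^ q / c ^ q)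
          * c ^ q
        = (‖a‖ ^ q + ‖b‖ ^ q) / 2 - ‖(1 / 2 : ℝ) • (a + b)‖ ^ q := by field_simp
      linarith
    have h5 : ‖a - b‖ ^ q ≤ 2 ^ q * c ^ q := by
      rw [← Real.mul_rpow (by norm_num) hc0.le]
      gcongr
      linarith [norm_sub_le a b]
    have h6 : 2 ^ q * c ^ q = 2 ^ q / θ * (θ * c ^ q) := by field_simp
    have h7 : 2 ^ q / θ * (θ * c ^ q) ≤ 2 ^ q / θ *
        ((‖a‖ ^ q + ‖b‖ ^ q) / 2 - ‖(1 / 2 : ℝ) • (a + b)‖ ^ q) := by gcongr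
    have h8 : 0 ≤ ε * (‖a‖ ^ q + ‖b‖ ^ q) := by positivity
    linarith
  · rw [not_le, ← smul_sub, hsc, div_lt_iff₀ hcq] at hcase
    have h8 : 0 ≤ 2 ^ q / θ * ((‖a‖ ^ q + ‖b‖ ^ q) / 2 - ‖(1 / 2 : ℝ) • (a + b)‖ ^ q) := by
      positivity
    nlinarith

end Pointwise

/-! ### Convergence of integrals -/

section Convergence

variable {α : Type*} [MeasurableSpace α] {μ : Measure α}

/-- Fatou's lemma for nonnegative real functions with bounded integrals. -/
lemma integrable_and_integral_le_of_tendsto_ae {g : ℕ → α → ℝ} {g' : α → ℝ} {B : ℝ}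
    (hg : ∀ k, Integrable (g k) μ) (h0 : ∀ k, 0 ≤ᵐ[μ] g k) (hB : ∀ᶠ k in atTop, ∫ x, g k x ∂μ ≤ B)
    (hlim : ∀ᵐ x ∂μ, Tendsto (fun k => g k x) atTop (𝓝 (g' x))) :
    Integrable g' μ ∧ ∫ x, g' x ∂μ ≤ B := by
  have hm : AEStronglyMeasurable g' μ :=
    aestronglyMeasurable_of_tendsto_ae atTop (fun k => (hg k).1) hlim
  have h0' : 0 ≤ᵐ[μ] g' := by
    filter_upwards [hlim, ae_all_iff.2 h0] with x hx h0x
    exact ge_of_tendsto' hx h0x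
  have hB0 : 0 ≤ B := by
    obtain ⟨k, hk⟩ := hB.exists
    exact (integral_nonneg_of_ae (h0 k)).trans hk
  have hle : ∫⁻ x, ENNReal.ofReal (g' x) ∂μ ≤ ENNReal.ofReal B := by
    calc ∫⁻ x, ENNReal.ofReal (g' x) ∂μ
        = ∫⁻ x, liminf (fun k => ENNReal.ofReal (g k x)) atTop ∂μ := by
          refine lintegral_congr_ae ?_
          filter_upwards [hlim] with x hx
          exact ((ENNReal.continuous_ofReal.tendsto _).comp hx).liminf_eq.symm
      _ ≤ liminf (fun k => ∫⁻ x, ENNReal.ofReal (g k x) ∂μ) atTop :=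
          lintegral_liminf_le' fun k => (hg k).1.aemeasurable.ennreal_ofReal
      _ ≤ ENNReal.ofReal B := by
          refine liminf_le_of_frequently_le' (Eventually.frequently ?_)
          filter_upwards [hB] with k hk
          rw [← ofReal_integral_eq_lintegral_ofReal (hg k) (h0 k)]
          exact ENNReal.ofReal_le_ofReal hk
  have hi : Integrable g' μ := by
    refine ⟨hm, ?_⟩
    rw [hasFiniteIntegral_iff_ofReal h0']
    exact lt_of_le_of_lt hle ENNReal.ofReal_lt_top
  refine ⟨hi, ?_⟩
  rw [← ofReal_integral_eq_lintegral_ofReal hi h0'] at hle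
  exact (ENNReal.ofReal_le_ofReal_iff hB0).1 hle

/-- A dominated convergence theorem with an equi-integrable family of majorants. -/
lemma integrable_and_tendsto_integral_of_le_add {g Y : ℕ → α → ℝ} {g' : α → ℝ} {B : ℝ}
    (hg : ∀ k, AEStronglyMeasurable (g k) μ) (hY : ∀ k, Integrable (Y k) μ)
    (hY0 : ∀ k, 0 ≤ᵐ[μ] Y k)
    (hB : ∀ k, ∫ x, Y k x ∂μ ≤ B)
    (hdom : ∀ l > 0, ∃ h : α → ℝ, Integrable h μ ∧ ∀ k, ∀ᵐ x ∂μ, |g k x| ≤ l * Y k x + h x)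
    (hlim : ∀ᵐ x ∂μ, Tendsto (fun k => g k x) atTop (𝓝 (g' x))) :
    Integrable g' μ ∧ Tendsto (fun k => ∫ x, g k x ∂μ) atTop (𝓝 (∫ x, g' x ∂μ)) := by
  have hgi : ∀ k, Integrable (g k) μ := fun k => by
    obtain ⟨h, hh, hle⟩ := hdom 1 one_pos
    exact Integrable.mono' (((hY k).const_mul 1).add hh) (hg k) (hle k)
  have hm : AEStronglyMeasurable g' μ := aestronglyMeasurable_of_tendsto_ae atTop hg hlim
  have hg' : Integrable g' μ := by
    obtain ⟨h, hh, hle⟩ := hdom 1 one_pos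
    have := (integrable_and_integral_le_of_tendsto_ae (g := fun k x => |g k x|)
      (g' := fun x => |g' x|) (B := B + ∫ x, h x ∂μ) (fun k => (hgi k).abs)
      (fun k => ae_of_all _ fun x => abs_nonneg _) (Eventually.of_forall fun k => ?_) ?_).1
    · exact (integrable_norm_iff hm).1 this
    · calc ∫ x, |g k x| ∂μ ≤ ∫ x, (1 * Y k x + h x) ∂μ :=
          integral_mono_ae (hgi k).abs (((hY k).const_mul 1).add hh) (hle k)
        _ = ∫ x, Y k x ∂μ + ∫ x, h x ∂μ := by
          rw [integral_add ((hY k).const_mul 1) hh]; simp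
        _ ≤ _ := by linarith [hB k]
    · filter_upwards [hlim] with x hx using hx.abs
  refine ⟨hg', ?_⟩
  have hB0 : 0 ≤ B := (integral_nonneg_of_ae (hY0 0)).trans (hB 0)
  rw [Metric.tendsto_atTop]
  intro ε hε
  set l := ε / (2 * (B + 1)) with hl
  have hl0 : 0 < l := by positivity
  have hlB : l * B ≤ ε / 2 := by
    rw [hl, div_mul_eq_mul_div, div_le_div_iff₀ (by positivity) (by norm_num)]; nlinarith
  obtain ⟨h, hh, hle⟩ := hdom l hl0
  let z : ℕ → α → ℝ := fun k x => max (|g k x - g' x| - l * Y k x) 0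
  have hz : Tendsto (fun k => ∫ x, z k x ∂μ) atTop (𝓝 (∫ _x, (0 : ℝ) ∂μ)) := by
    refine tendsto_integral_of_dominated_convergence (fun x => |h x| + |g' x|) (fun k => ?_)
      (hh.abs.add hg'.abs) (fun k => ?_) ?_
    · exact ((((hgi k).sub hg').abs.sub ((hY k).const_mul l)).1).sup aestronglyMeasurable_const
    · filter_upwards [hle k] with x hx
      rw [Real.norm_of_nonneg (le_max_right _ _)]
      refine max_le ?_ (by positivity)
      have := abs_sub (g k x) (g' x)
      linarith [le_abs_self (h x)]
    · filter_upwards [hlim, ae_all_iff.2 hY0] with x hx hYx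
      have h1 : Tendsto (fun k => |g k x - g' x|) atTop (𝓝 0) := by
        simpa using (hx.sub_const (g' x)).abs
      refine squeeze_zero (fun k => le_max_right _ _) (fun k => ?_) h1
      have : 0 ≤ Y k x := hYx k
      exact max_le (by nlinarith) (abs_nonneg _)
  rw [integral_zero] at hz
  obtain ⟨n, hn⟩ := (Metric.tendsto_atTop.1 hz) (ε / 2) (by positivity)
  refine ⟨n, fun k hk => ?_⟩
  have h1 := hn k hk
  rw [Real.dist_eq, sub_zero] at h1
  have hzi : Integrable (z k) μ := by
    refine Integrable.mono' (g := fun x => |g k x - g' x| + l * Y k x)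
      (((hgi k).sub hg').abs.add ((hY k).const_mul l)) ?_ ?_
    · exact ((((hgi k).sub hg').abs.sub ((hY k).const_mul l)).1).sup aestronglyMeasurable_const
    · filter_upwards [hY0 k] with x hx
      have hx : 0 ≤ Y k x := hx
      rw [Real.norm_of_nonneg (le_max_right _ _)]
      have : 0 ≤ l * Y k x := by positivity
      exact max_le (by linarith) (by positivity)
  rw [Real.dist_eq, ← integral_sub (hgi k) hg']
  calc |∫ x, (g k x - g' x) ∂μ| ≤ ∫ x, |g k x - g' x| ∂μ := abs_integral_le_integral_abs
    _ ≤ ∫ x, (z k x + l * Y k x) ∂μ := by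
        refine integral_mono ((hgi k).sub hg').abs (hzi.add ((hY k).const_mul l)) fun x => ?_
        have := le_max_left (|g k x - g' x| - l * Y k x) 0
        simp only [z]; linarith
    _ = ∫ x, z k x ∂μ + l * ∫ x, Y k x ∂μ := by
        rw [integral_add hzi ((hY k).const_mul l), integral_const_mul]
    _ < ε := by
        have := mul_le_mul_of_nonneg_left (hB k) hl0.le
        linarith [le_abs_self (∫ x, z k x ∂μ)]

/-- A sequence which is Cauchy in measure on each member of an increasing sequence of sets has an
almost everywhere Cauchy subsequence on their union. -/
lemma exists_subseq_ae_cauchySeq {E : Type*} [PseudoMetricSpace E] {g : ℕ → α → E}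
    {K : ℕ → Set α} (hK : Monotone K)
    (hc : ∀ n, ∀ ε > 0, ∃ n0, ∀ k ≥ n0, ∀ m ≥ n0,
      μ (K n ∩ {x | ε < dist (g k x) (g m x)}) ≤ ENNReal.ofReal ε) :
    ∃ φ : ℕ → ℕ, StrictMono φ ∧
      ∀ᵐ x ∂μ, x ∈ ⋃ n, K n → CauchySeq fun j => g (φ j) x := by
  choose n0 hn0 using fun n : ℕ => hc n ((1 / 2 : ℝ) ^ n) (by positivity)
  obtain ⟨φ, hφ, hφn⟩ := extraction_forall_of_eventually (P := fun n k => n0 n ≤ k)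
    fun n => eventually_ge_atTop (n0 n)
  refine ⟨φ, hφ, ?_⟩
  let A : ℕ → Set α := fun j => K j ∩ {x | (1 / 2 : ℝ) ^ j < dist (g (φ j) x) (g (φ (j + 1)) x)}
  have hA : ∑' j, μ (A j) ≠ ⊤ := by
    refine ne_top_of_le_ne_top ?_ (ENNReal.tsum_le_tsum fun j =>
      hn0 j (φ j) (hφn j) (φ (j + 1)) ((hφn j).trans (hφ.monotone (Nat.le_succ j))))
    rw [← ENNReal.ofReal_tsum_of_nonneg (fun _ => by positivity)
      (summable_geometric_of_lt_one (by norm_num) (by norm_num))]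
    exact ENNReal.ofReal_ne_top
  filter_upwards [ae_eventually_notMem hA] with x hx hxK
  obtain ⟨n, hn⟩ := Set.mem_iUnion.1 hxK
  obtain ⟨j0, hj0⟩ := eventually_atTop.1 hx
  set J := max n j0
  refine (cauchySeq_shift J).1 (cauchySeq_of_le_geometric (1 / 2) ((1 / 2) ^ J) (by norm_num)
    fun i => ?_)
  have h1 := hj0 (i + J) (by omega)
  simp only [A, Set.mem_inter_iff, Set.mem_ofPred_eq, not_and, not_lt] at h1
  have := h1 (hK (by omega) hn)
  rw [pow_add, mul_comm] at this
  rwa [show i + 1 + J = i + J + 1 by omega]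

lemma measure_inter_lt_le {K : Set α} (hK : MeasurableSet K) {g : α → ℝ} {B L : ℝ} (hL : 0 < L)
    (hg : IntegrableOn g K μ) (h0 : ∀ x ∈ K, 0 ≤ g x) (hB : ∫ x in K, g x ∂μ ≤ B) :
    μ (K ∩ {x | L ≤ g x}) ≤ ENNReal.ofReal (B / L) := by
  have h1 := mul_meas_ge_le_integral_of_nonneg (μ := μ.restrict K) (f := g)
    ((ae_restrict_iff' hK).2 (ae_of_all _ h0)) hg L
  have h2 : (μ.restrict K) {x | L ≤ g x} = μ (K ∩ {x | L ≤ g x}) := by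
    rw [Measure.restrict_apply' hK, Set.inter_comm]
  have hfin : (μ.restrict K) {x | L ≤ g x} ≠ ⊤ := (hg.measure_ge_lt_top hL).ne
  rw [← h2, ← ENNReal.ofReal_toReal hfin]
  refine ENNReal.ofReal_le_ofReal ?_
  rw [le_div_iff₀ hL, mul_comm]
  exact h1.trans hB

end Convergence

/-! ### Gradients and test functions -/

section TestFunctions

variable {N : ℕ} {Ω : Set (Euc N)}

lemma norm_gradient (u : Euc N → ℝ) (x : Euc N) : ‖gradient u x‖ = ‖fderiv ℝ u x‖ := by
  simp [gradient]

lemma gradient_mul' {u w : Euc N → ℝ} {x : Euc N} (hu : DifferentiableAt ℝ u x)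
    (hw : DifferentiableAt ℝ w x) :
    gradient (fun y => u y * w y) x = u x • gradient w x + w x • gradient u x := by
  simp only [gradient]
  rw [fderiv_fun_mul hu hw, map_add, map_smul, map_smul]

lemma gradient_lin {u w : Euc N → ℝ} {x : Euc N} (a b : ℝ) (hu : DifferentiableAt ℝ u x)
    (hw : DifferentiableAt ℝ w x) :
    gradient (fun y => a * u y + b * w y) x = a • gradient u x + b • gradient w x := by
  simp only [gradient]
  rw [fderiv_fun_add (hu.const_mul a) (hw.const_mul b), fderiv_const_mul hu, fderiv_const_mul hw,
    map_add, map_smul, map_smul]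

lemma gradient_sub' {u w : Euc N → ℝ} {x : Euc N} (hu : DifferentiableAt ℝ u x)
    (hw : DifferentiableAt ℝ w x) :
    gradient (fun y => u y - w y) x = gradient u x - gradient w x := by
  simp only [gradient]
  rw [fderiv_fun_sub hu hw, map_sub]

lemma gradient_scomp {u : Euc N → ℝ} {x : Euc N} {φ : ℝ → ℝ} {φ' : ℝ}
    (hφ : HasDerivAt φ φ' (u x)) (hu : DifferentiableAt ℝ u x) :
    gradient (fun y => φ (u y)) x = φ' • gradient u x := by
  have h := (hφ.comp_hasFDerivAt x hu.hasFDerivAt).fderiv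
  simp only [gradient]
  have e : fderiv ℝ (fun y => φ (u y)) x = φ' • fderiv ℝ u x := h
  rw [e, map_smul]

lemma continuous_gradient {u : Euc N → ℝ} (hu : ContDiff ℝ (⊤ : ℕ∞) u) :
    Continuous (gradient u) := by
  have h := hu.continuous_fderiv (by simp)
  exact (InnerProductSpace.toDual ℝ (Euc N)).symm.continuous.comp h

lemma gradient_eq_zero_of_notMem {u : Euc N → ℝ} {x : Euc N} (hx : x ∉ tsupport u) :
    gradient u x = 0 := by
  have h : fderiv ℝ u x = 0 := by
    by_contra h
    exact hx (support_fderiv_subset ℝ h)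
  simp [gradient, h]

namespace IsTestFun

variable {u w : Euc N → ℝ}

lemma continuous (hu : IsTestFun Ω u) : Continuous u := hu.1.continuous

lemma continuous_gradient (hu : IsTestFun Ω u) : Continuous (gradient u) :=
  _root_.continuous_gradient hu.1

lemma differentiable (hu : IsTestFun Ω u) : Differentiable ℝ u := hu.1.differentiable (by simp)

lemma isCompact (hu : IsTestFun Ω u) : IsCompact (tsupport u) := hu.2.1

lemma mul_contDiff (hu : IsTestFun Ω u) {g : Euc N → ℝ} (hg : ContDiff ℝ (⊤ : ℕ∞) g) :
    IsTestFun Ω (fun x => u x * g x) :=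
  ⟨hu.1.mul hg, hu.2.1.mul_right, (tsupport_mul_subset_left (f := u) (g := g)).trans hu.2.2⟩

lemma lin (hu : IsTestFun Ω u) (hw : IsTestFun Ω w) (a b : ℝ) :
    IsTestFun Ω (fun x => a * u x + b * w x) := by
  have h1 : HasCompactSupport fun x => a * u x := hu.2.1.mul_left
  have h2 : HasCompactSupport fun x => b * w x := hw.2.1.mul_left
  refine ⟨(contDiff_const.mul hu.1).add (contDiff_const.mul hw.1), h1.add h2, ?_⟩
  refine (tsupport_add (fun x => a * u x) (fun x => b * w x)).trans (Set.union_subset ?_ ?_)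
  · exact (tsupport_mul_subset_right (f := fun _ => a) (g := u)).trans hu.2.2
  · exact (tsupport_mul_subset_right (f := fun _ => b) (g := w)).trans hw.2.2

lemma zero : IsTestFun Ω (fun _ => 0) := by
  refine ⟨contDiff_const, HasCompactSupport.zero, ?_⟩
  have : tsupport (fun _ : Euc N => (0 : ℝ)) = ∅ := tsupport_eq_empty_iff.2 rfl
  simp [this]

end IsTestFun

lemma exists_cutoff (hΩ : IsOpen Ω) {K : Set (Euc N)} (hK : IsCompact K) (hKΩ : K ⊆ Ω) :
    ∃ η : Euc N → ℝ, IsTestFun Ω η ∧ (∀ x, 0 ≤ η x) ∧ (∀ x, η x ≤ 1) ∧ ∀ x ∈ K, η x = 1 := by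
  obtain ⟨L, hL, hKL, hLΩ⟩ := exists_compact_between hK hΩ hKΩ
  obtain ⟨g, hg1, hg0, hg⟩ := exists_contMDiffMap_one_nhds_of_subset_interior
    (modelWithCornersSelf ℝ (Euc N)) (n := (⊤ : ℕ∞)) hK.isClosed hKL
  have hsupp : tsupport g ⊆ L :=
    closure_minimal (fun x hx => by by_contra h; exact hx (hg0 x h)) hL.isClosed
  refine ⟨g, ⟨g.contMDiff.contDiff, ?_, hsupp.trans hLΩ⟩, fun x => (hg x).1, fun x => (hg x).2,
    fun x hx => hg1.self_of_nhdsSet x hx⟩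
  exact hL.of_isClosed_subset (isClosed_tsupport _) hsupp

/-- A monotone sequence of compact sets whose union is the open set `Ω`. -/
lemma exists_compact_iUnion_eq (hΩ : IsOpen Ω) :
    ∃ K : ℕ → Set (Euc N), (∀ n, IsCompact (K n)) ∧ (∀ n, K n ⊆ Ω) ∧ Monotone K ∧
      ⋃ n, K n = Ω := by
  obtain ⟨F, hFc, hFU, hF, hFm⟩ := hΩ.exists_iUnion_isClosed
  refine ⟨fun n => F n ∩ Metric.closedBall 0 n,
    fun n => (isCompact_closedBall _ _).inter_left (hFc n),
    fun n => Set.inter_subset_left.trans (hFU n),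
    fun n m h => Set.inter_subset_inter (hFm h)
      (Metric.closedBall_subset_closedBall (by simpa)), ?_⟩
  refine Set.Subset.antisymm (Set.iUnion_subset fun n => Set.inter_subset_left.trans (hFU n)) ?_
  intro x hx
  rw [← hF] at hx
  obtain ⟨n, hn⟩ := Set.mem_iUnion.1 hx
  obtain ⟨m, hm⟩ := exists_nat_ge ‖x‖
  refine Set.mem_iUnion.2 ⟨max n m, hFm (le_max_left _ _) hn, ?_⟩
  rw [mem_closedBall_zero_iff]
  exact hm.trans (by exact_mod_cast le_max_right n m)

lemma integrableOn_mul_of_eq_zero {K : Set (Euc N)} (hK : IsCompact K) {V g : Euc N → ℝ}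
    (hV : IntegrableOn V K) (hg : Continuous g) (h0 : ∀ x ∉ K, g x = 0) (S : Set (Euc N)) :
    IntegrableOn (fun x => V x * g x) S := by
  have h1 : IntegrableOn (fun x => V x * g x) K := hV.mul_continuousOn hg.continuousOn hK
  have h2 : Integrable (fun x => V x * g x) :=
    (integrableOn_iff_integrable_of_support_subset fun x hx => by
      by_contra h; exact hx (by simp [h0 x h])).1 h1
  exact h2.integrableOn

lemma integrableOn_of_eq_zero {K : Set (Euc N)} (hK : IsCompact K) {g : Euc N → ℝ}
    (hg : Continuous g) (h0 : ∀ x ∉ K, g x = 0) (S : Set (Euc N)) : IntegrableOn g S := by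
  have := integrableOn_mul_of_eq_zero hK (V := fun _ => 1)
    (integrableOn_const hK.measure_lt_top.ne) hg h0 S
  simpa using this

lemma setIntegral_eq_of_eq_zero {K S : Set (Euc N)} (hKS : K ⊆ S) {g : Euc N → ℝ}
    (h0 : ∀ x ∉ K, g x = 0) : ∫ x in S, g x = ∫ x in K, g x := by
  rw [setIntegral_eq_integral_of_forall_compl_eq_zero h0,
    setIntegral_eq_integral_of_forall_compl_eq_zero fun x hx => h0 x fun h => hx (hKS h)]

lemma continuous_rpow_norm {E F : Type*} [TopologicalSpace E] [SeminormedAddCommGroup F]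
    {g : E → F} (hg : Continuous g) {s : ℝ} (hs : 0 ≤ s) : Continuous fun x => ‖g x‖ ^ s :=
  hg.norm.rpow_const fun _ => Or.inr hs

lemma exists_pos_le_of_compact {W : Euc N → ℝ} (hWc : ContinuousOn W Ω)
    (hWpos : ∀ x ∈ Ω, 0 < W x) {K : Set (Euc N)} (hK : IsCompact K) (hKΩ : K ⊆ Ω) :
    ∃ c > 0, ∀ x ∈ K, c ≤ W x :=
  hK.exists_forall_le' (hWc.mono hKΩ) fun x hx => hWpos x (hKΩ hx)

end TestFunctions

/-! ### Sobolev-type estimates for smooth compactly supported functions -/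

section Sobolev

variable {N : ℕ}

lemma enorm_sub_le_lintegral_gradient {w : Euc N → ℝ} (hw : ContDiff ℝ (⊤ : ℕ∞) w)
    (x y : Euc N) :
    ‖w (x + y) - w x‖ₑ ≤ ‖y‖ₑ * ∫⁻ t in Set.Ioc (0 : ℝ) 1, ‖gradient w (x + t • y)‖ₑ := by
  have hd : ∀ t ∈ Set.uIcc (0 : ℝ) 1,
      HasDerivAt (fun t : ℝ => w (x + t • y)) (⟪gradient w (x + t • y), y⟫) t := by
    intro t _
    have h1 : HasDerivAt (fun t : ℝ => x + t • y) y t := by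
      simpa using ((hasDerivAt_id t).smul_const y).const_add x
    have h2 := ((hw.differentiable (by simp)) (x + t • y)).hasFDerivAt.comp_hasDerivAt t h1
    rw [inner_gradient_left]
    exact h2
  have hc : Continuous fun t : ℝ => ⟪gradient w (x + t • y), y⟫ := by
    have := continuous_gradient hw
    fun_prop
  have hI := intervalIntegral.integral_eq_sub_of_hasDerivAt hd (hc.intervalIntegrable 0 1)
  simp only [one_smul, zero_smul, add_zero] at hI
  rw [← hI, intervalIntegral.integral_of_le zero_le_one]
  refine (enorm_integral_le_lintegral_enorm _).trans ?_
  rw [← lintegral_const_mul' _ _ enorm_ne_top]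
  refine lintegral_mono fun t => ?_
  rw [mul_comm, ← ofReal_norm, ← ofReal_norm, ← ofReal_norm, ← ENNReal.ofReal_mul (norm_nonneg _)]
  exact ENNReal.ofReal_le_ofReal (norm_inner_le_norm _ _)

lemma lintegral_translate_sub_le {w : Euc N → ℝ} (hw : ContDiff ℝ (⊤ : ℕ∞) w) (y : Euc N) :
    ∫⁻ x, ‖w (x + y) - w x‖ₑ ≤ ‖y‖ₑ * ∫⁻ x, ‖gradient w x‖ₑ := by
  have hg := continuous_gradient hw
  calc ∫⁻ x, ‖w (x + y) - w x‖ₑ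
      ≤ ∫⁻ x, ‖y‖ₑ * ∫⁻ t in Set.Ioc (0 : ℝ) 1, ‖gradient w (x + t • y)‖ₑ :=
        lintegral_mono fun x => enorm_sub_le_lintegral_gradient hw x y
    _ = ‖y‖ₑ * ∫⁻ x, ∫⁻ t in Set.Ioc (0 : ℝ) 1, ‖gradient w (x + t • y)‖ₑ :=
        lintegral_const_mul' _ _ enorm_ne_top
    _ = ‖y‖ₑ * ∫⁻ t in Set.Ioc (0 : ℝ) 1, ∫⁻ x, ‖gradient w (x + t • y)‖ₑ := by
        rw [lintegral_lintegral_swap]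
        have hc : Continuous fun z : Euc N × ℝ => ‖gradient w (z.1 + z.2 • y)‖ₑ := by fun_prop
        exact hc.aemeasurable
    _ = ‖y‖ₑ * ∫⁻ x, ‖gradient w x‖ₑ := by
        congr 1
        have : ∀ t : ℝ, ∫⁻ x, ‖gradient w (x + t • y)‖ₑ = ∫⁻ x, ‖gradient w x‖ₑ := fun t =>
          lintegral_add_right_eq_self (fun x => ‖gradient w x‖ₑ) (t • y)
        simp [this]

/-- The `L^1` distance between a function and its mollification. -/
lemma lintegral_mollify_sub_le {w ρ : Euc N → ℝ} (hw : ContDiff ℝ (⊤ : ℕ∞) w)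
    (hρ : Continuous ρ) (hρc : HasCompactSupport ρ) (hρ0 : ∀ y, 0 ≤ ρ y) (hρ1 : ∫ y, ρ y = 1)
    {δ : ℝ} (hδ : ∀ y, ρ y ≠ 0 → ‖y‖ ≤ δ) :
    ∫⁻ x, ‖(∫ z, ρ (z - x) * w z) - w x‖ₑ ≤ ENNReal.ofReal δ * ∫⁻ x, ‖gradient w x‖ₑ := by
  have hwc := hw.continuous
  have hi : Integrable ρ := hρ.integrable_of_hasCompactSupport hρc
  have e : ∀ x, (∫ z, ρ (z - x) * w z) - w x = ∫ y, ρ y * (w (x + y) - w x) := by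
    intro x
    have h1 : ∫ z, ρ (z - x) * w z = ∫ y, ρ y * w (x + y) := by
      rw [← integral_add_right_eq_self (fun z => ρ (z - x) * w z) x]
      simp [add_comm]
    simp only [mul_sub]
    rw [h1, integral_sub _ (hi.mul_const _), integral_mul_const, hρ1, one_mul]
    exact (hρ.mul (by fun_prop)).integrable_of_hasCompactSupport hρc.mul_right
  have hl1 : ∫⁻ y, ‖ρ y‖ₑ = 1 := by
    have : ∫⁻ y, ENNReal.ofReal (ρ y) = ENNReal.ofReal 1 := by
      rw [← hρ1, ofReal_integral_eq_lintegral_ofReal hi (ae_of_all _ hρ0)]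
    rw [ENNReal.ofReal_one] at this
    rw [← this]
    exact lintegral_congr fun y => Real.enorm_of_nonneg (hρ0 y)
  calc ∫⁻ x, ‖(∫ z, ρ (z - x) * w z) - w x‖ₑ
      ≤ ∫⁻ x, ∫⁻ y, ‖ρ y‖ₑ * ‖w (x + y) - w x‖ₑ := by
        refine lintegral_mono fun x => ?_
        rw [e x]
        refine (enorm_integral_le_lintegral_enorm _).trans (le_of_eq ?_)
        simp only [enorm_mul]
    _ = ∫⁻ y, ∫⁻ x, ‖ρ y‖ₑ * ‖w (x + y) - w x‖ₑ := by
        rw [lintegral_lintegral_swap]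
        have hc : Continuous fun z : Euc N × Euc N => ‖ρ z.2 * (w (z.1 + z.2) - w z.1)‖ₑ := by
          fun_prop
        simp only [enorm_mul] at hc
        exact hc.aemeasurable
    _ ≤ ∫⁻ y, ‖ρ y‖ₑ * (ENNReal.ofReal δ * ∫⁻ x, ‖gradient w x‖ₑ) := by
        refine lintegral_mono fun y => ?_
        simp only
        rw [lintegral_const_mul' _ _ enorm_ne_top]
        rcases eq_or_ne (ρ y) 0 with h | h
        · simp [h]
        · gcongr
          refine (lintegral_translate_sub_le hw y).trans ?_
          gcongr
          rw [← ofReal_norm]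
          exact ENNReal.ofReal_le_ofReal (hδ y h)
    _ = _ := by
        rw [lintegral_mul_const _ hρ.enorm.measurable, hl1, one_mul]

/-- A sequence of mollifiers. -/
lemma exists_mollifier {δ : ℝ} (hδ : 0 < δ) :
    ∃ ρ : Euc N → ℝ, ∃ L A : ℝ, Continuous ρ ∧ HasCompactSupport ρ ∧ (∀ y, 0 ≤ ρ y) ∧
      (∫ y, ρ y = 1) ∧ (∀ y, ρ y ≠ 0 → ‖y‖ ≤ δ) ∧ 0 ≤ L ∧
      (∀ y z, |ρ y - ρ z| ≤ L * ‖y - z‖) ∧ ∀ y, |ρ y| ≤ A := by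
  let b : ContDiffBump (0 : Euc N) := ⟨δ / 2, δ, by positivity, by linarith⟩
  have hs : ContDiff ℝ 1 (b.normed volume) := b.contDiff_normed
  have hcs : HasCompactSupport (b.normed volume) := b.hasCompactSupport_normed
  obtain ⟨L, hL⟩ := hs.lipschitzWith_of_hasCompactSupport hcs (by norm_num)
  obtain ⟨A, hA⟩ := hcs.exists_bound_of_continuous hs.continuous
  refine ⟨b.normed volume, L, A, hs.continuous, hcs, fun y => b.nonneg_normed y,
    b.integral_normed, fun y hy => ?_, L.2, fun y z => ?_, hA⟩
  · have : y ∈ Function.support (b.normed volume) := hy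
    rw [b.support_normed_eq, mem_ball_zero_iff] at this
    exact this.le
  · have := hL.dist_le_mul y z
    rwa [Real.dist_eq, dist_eq_norm] at this

end Sobolev

section Rellich

variable {N : ℕ}

lemma lintegral_enorm_le_of_integral_norm_le {E : Type*} [NormedAddCommGroup E] {g : Euc N → E}
    {B : ℝ} (hg : Integrable g) (hB : ∫ x, ‖g x‖ ≤ B) : ∫⁻ x, ‖g x‖ₑ ≤ ENNReal.ofReal B := by
  rw [← ofReal_integral_norm_eq_lintegral_enorm hg]
  exact ENNReal.ofReal_le_ofReal hB

/-- Local form of the Rellich–Kondrachov theorem, for countably many sequences at once: each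
sequence `w n ·` has uniformly compact supports and is bounded in `W^{1,1}`. -/
lemma exists_subseq_cauchy_integral {w : ℕ → ℕ → Euc N → ℝ} {K : ℕ → Set (Euc N)} {B : ℕ → ℝ}
    (hK : ∀ n, IsCompact (K n)) (hw : ∀ n k, ContDiff ℝ (⊤ : ℕ∞) (w n k))
    (hsupp : ∀ n k, tsupport (w n k) ⊆ K n)
    (hB : ∀ n k, ∫ x, |w n k x| ≤ B n) (hB' : ∀ n k, ∫ x, ‖gradient (w n k) x‖ ≤ B n) :
    ∃ φ : ℕ → ℕ, StrictMono φ ∧ ∀ n, ∀ ε > 0, ∃ k0, ∀ k ≥ k0, ∀ m ≥ k0,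
      ∫ x, |w n (φ k) x - w n (φ m) x| ≤ ε := by
  have hcs : ∀ n k, HasCompactSupport (w n k) := fun n k =>
    (hK n).of_isClosed_subset (isClosed_tsupport _) (hsupp n k)
  have hwi : ∀ n k, Integrable (w n k) := fun n k =>
    (hw n k).continuous.integrable_of_hasCompactSupport (hcs n k)
  have hgi : ∀ n k, Integrable (gradient (w n k)) := fun n k => by
    refine (continuous_gradient (hw n k)).integrable_of_hasCompactSupport ?_
    exact HasCompactSupport.intro (hcs n k) fun x hx => gradient_eq_zero_of_notMem hx
  have hB0 : ∀ n, 0 ≤ B n := fun n => (integral_nonneg fun x => abs_nonneg _).trans (hB n 0)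
  choose ρ L A hρ hρc hρ0 hρ1 hρδ hL0 hL hA using fun j : ℕ =>
    exists_mollifier (N := N) (δ := 1 / ((j : ℝ) + 1)) (by positivity)
  let c : ℕ → ℕ → ℕ → Euc N → ℝ := fun n j k x => ∫ z, ρ j (z - x) * w n k z
  have hci : ∀ n j k x, Integrable fun z => ρ j (z - x) * w n k z := fun n j k x => by
    have h1 := hρ j
    have h2 := (hw n k).continuous
    exact (h1.comp (by fun_prop) |>.mul h2).integrable_of_hasCompactSupport
      (hcs n k).mul_left
  have hcb : ∀ n j k x, |c n j k x| ≤ A j * B n := fun n j k x => by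
    have hAj : 0 ≤ A j := (abs_nonneg _).trans (hA j 0)
    calc |c n j k x| ≤ ∫ z, |ρ j (z - x) * w n k z| := abs_integral_le_integral_abs
      _ ≤ ∫ z, A j * |w n k z| := by
          refine integral_mono (hci n j k x).abs ((hwi n k).abs.const_mul _) fun z => ?_
          simp only [abs_mul]
          exact mul_le_mul_of_nonneg_right (hA j _) (abs_nonneg _)
      _ ≤ A j * B n := by
          rw [integral_const_mul]
          exact mul_le_mul_of_nonneg_left (hB n k) hAj
  have hcl : ∀ n j k x y, |c n j k x - c n j k y| ≤ L j * ‖x - y‖ * B n := fun n j k x y => by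
    simp only [c]
    rw [← integral_sub (hci n j k x) (hci n j k y)]
    calc |∫ z, (ρ j (z - x) * w n k z - ρ j (z - y) * w n k z)|
        ≤ ∫ z, |ρ j (z - x) * w n k z - ρ j (z - y) * w n k z| := abs_integral_le_integral_abs
      _ ≤ ∫ z, L j * ‖x - y‖ * |w n k z| := by
          refine integral_mono ((hci n j k x).sub (hci n j k y)).abs
            ((hwi n k).abs.const_mul _) fun z => ?_
          simp only [← sub_mul, abs_mul]
          refine mul_le_mul_of_nonneg_right ((hL j _ _).trans_eq ?_) (abs_nonneg _)
          rw [sub_sub_sub_cancel_left, norm_sub_rev]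
      _ ≤ _ := by
          rw [integral_const_mul]
          exact mul_le_mul_of_nonneg_left (hB n k) (mul_nonneg (hL0 j) (norm_nonneg _))
  have hccont : ∀ n j k, Continuous (c n j k) := fun n j k => by
    refine LipschitzWith.continuous (K := ⟨L j * B n, mul_nonneg (hL0 j) (hB0 n)⟩)
      (LipschitzWith.of_dist_le_mul fun x y => ?_)
    rw [Real.dist_eq, dist_eq_norm]
    refine (hcl n j k x y).trans_eq ?_
    change _ = L j * B n * ‖x - y‖
    ring
  -- a subsequence along which all the mollifications converge on a countable dense set
  let D := TopologicalSpace.denseSeq (Euc N)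
  have hcpt : IsCompact (Set.univ.pi fun i : ℕ × ℕ × ℕ =>
      Set.Icc (-(A i.2.1 * B i.1)) (A i.2.1 * B i.1)) :=
    isCompact_univ_pi fun i => isCompact_Icc
  obtain ⟨a, -, φ, hφ, hlim⟩ := hcpt.tendsto_subseq
    (x := fun k (i : ℕ × ℕ × ℕ) => c i.1 i.2.1 k (D i.2.2))
    fun k i _ => abs_le.1 (hcb i.1 i.2.1 k (D i.2.2))
  rw [tendsto_pi_nhds] at hlim
  have hcau : ∀ n j x, CauchySeq fun k => c n j (φ k) x := fun n j x => by
    rw [Metric.cauchySeq_iff]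
    intro ε hε
    have hpos : 0 < ε / (3 * (L j * B n + 1)) := by
      have := mul_nonneg (hL0 j) (hB0 n); positivity
    obtain ⟨i, hi⟩ := (TopologicalSpace.denseRange_denseSeq (Euc N)).exists_dist_lt x hpos
    obtain ⟨k0, hk0⟩ := (Metric.cauchySeq_iff.1 (hlim (n, j, i)).cauchySeq) (ε / 3) (by positivity)
    refine ⟨k0, fun k hk m hm => ?_⟩
    have h1 := hk0 k hk m hm
    simp only [Function.comp, Real.dist_eq] at h1
    have hxi : L j * ‖x - D i‖ * B n < ε / 3 := by
      have h2 : ‖x - D i‖ < ε / (3 * (L j * B n + 1)) := by rwa [← dist_eq_norm]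
      have h3 := mul_nonneg (hL0 j) (hB0 n)
      rw [lt_div_iff₀ (by positivity)] at h2
      nlinarith [norm_nonneg (x - D i)]
    have e1 := (hcl n j (φ k) x (D i)).trans_lt hxi
    have e2 := (hcl n j (φ m) x (D i)).trans_lt hxi
    rw [Real.dist_eq]
    rw [abs_lt] at *
    constructor <;> linarith [h1.1, h1.2, e1.1, e1.2, e2.1, e2.2]
  refine ⟨φ, hφ, fun n ε hε => ?_⟩
  obtain ⟨j, hj⟩ := exists_nat_gt (3 * B n / ε)
  have hjB : 1 / ((j : ℝ) + 1) * B n ≤ ε / 3 := by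
    rw [div_lt_iff₀ hε] at hj
    rw [div_mul_eq_mul_div, div_le_iff₀ (by positivity)]
    linarith
  have hmol : ∀ k, ∫ x in K n, |c n j k x - w n k x| ≤ ε / 3 := fun k => by
    have h1 := lintegral_mollify_sub_le (hw n k) (hρ j) (hρc j) (hρ0 j) (hρ1 j) (hρδ j)
    have h2 : ∫⁻ x, ‖c n j k x - w n k x‖ₑ ≤ ENNReal.ofReal (ε / 3) := by
      refine h1.trans ((mul_le_mul_right (lintegral_enorm_le_of_integral_norm_le (hgi n k)
        (hB' n k)) _).trans ?_)
      rw [← ENNReal.ofReal_mul (by positivity)]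
      exact ENNReal.ofReal_le_ofReal hjB
    have hc : Continuous fun x => c n j k x - w n k x := (hccont n j k).sub (hw n k).continuous
    have hi : IntegrableOn (fun x => c n j k x - w n k x) (K n) :=
      hc.continuousOn.integrableOn_compact (hK n)
    have h3 := ofReal_integral_norm_eq_lintegral_enorm hi
    have h4 : ENNReal.ofReal (∫ x in K n, |c n j k x - w n k x|) ≤ ENNReal.ofReal (ε / 3) := by
      simp only [Real.norm_eq_abs] at h3
      rw [h3]
      exact (setLIntegral_le_lintegral _ _).trans h2
    exact (ENNReal.ofReal_le_ofReal_iff (by positivity)).1 h4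
  choose b hb using fun x => cauchySeq_tendsto_of_complete (hcau n j x)
  have hint : ∀ k, IntegrableOn (c n j k) (K n) := fun k =>
    (hccont n j k).continuousOn.integrableOn_compact (hK n)
  have hbm : AEStronglyMeasurable b (volume.restrict (K n)) :=
    aestronglyMeasurable_of_tendsto_ae atTop (fun k => (hint (φ k)).1) (ae_of_all _ hb)
  have hbint : IntegrableOn b (K n) := by
    refine Integrable.mono' (integrableOn_const (C := A j * B n) (hK n).measure_lt_top.ne) hbm
      (ae_of_all _ fun x => ?_)
    exact le_of_tendsto (hb x).norm (Eventually.of_forall fun k => hcb n j (φ k) x)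
  have hconv : Tendsto (fun k => ∫ x in K n, |c n j (φ k) x - b x|) atTop (𝓝 0) := by
    have := tendsto_integral_of_dominated_convergence (μ := volume.restrict (K n))
      (F := fun k x => |c n j (φ k) x - b x|) (f := fun _ => 0) (fun x => A j * B n + |b x|)
      (fun k => ((hint (φ k)).sub hbint).abs.1)
      ((integrableOn_const (hK n).measure_lt_top.ne).add hbint.abs)
      (fun k => ae_of_all _ fun x => by
        rw [Real.norm_eq_abs, abs_abs]
        exact (abs_sub _ _).trans (by linarith [hcb n j (φ k) x]))
      (ae_of_all _ fun x => by simpa using ((hb x).sub_const (b x)).abs)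
    simpa using this
  obtain ⟨k0, hk0⟩ := (Metric.tendsto_atTop.1 hconv) (ε / 6) (by positivity)
  refine ⟨k0, fun k hk m hm => ?_⟩
  have h1 := hk0 k hk
  have h2 := hk0 m hm
  rw [Real.dist_eq, sub_zero] at h1 h2
  have hz : ∀ x ∉ K n, |w n (φ k) x - w n (φ m) x| = 0 := fun x hx => by
    rw [image_eq_zero_of_notMem_tsupport fun h => hx (hsupp n _ h),
      image_eq_zero_of_notMem_tsupport fun h => hx (hsupp n _ h)]; simp
  rw [← setIntegral_eq_integral_of_forall_compl_eq_zero hz]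
  have i1 : ∀ k, IntegrableOn (fun x => |c n j (φ k) x - w n (φ k) x|) (K n) := fun k =>
    ((hint (φ k)).sub (hwi n (φ k)).integrableOn).abs
  have i2 : ∀ k, IntegrableOn (fun x => |c n j (φ k) x - b x|) (K n) := fun k =>
    ((hint (φ k)).sub hbint).abs
  have hle : ∫ x in K n, |w n (φ k) x - w n (φ m) x| ≤ ∫ x in K n,
      ((|c n j (φ k) x - w n (φ k) x| + |c n j (φ k) x - b x|)
        + (|c n j (φ m) x - w n (φ m) x| + |c n j (φ m) x - b x|)) := by
    refine integral_mono ((hwi n (φ k)).integrableOn.sub (hwi n (φ m)).integrableOn).abs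
      (((i1 k).add (i2 k)).add ((i1 m).add (i2 m))) fun x => ?_
    have := abs_le.1 (le_refl |c n j (φ k) x - w n (φ k) x|)
    have := abs_le.1 (le_refl |c n j (φ k) x - b x|)
    have := abs_le.1 (le_refl |c n j (φ m) x - w n (φ m) x|)
    have := abs_le.1 (le_refl |c n j (φ m) x - b x|)
    refine abs_le.2 ⟨?_, ?_⟩ <;> linarith
  have e : ∫ x in K n, ((|c n j (φ k) x - w n (φ k) x| + |c n j (φ k) x - b x|)
        + (|c n j (φ m) x - w n (φ m) x| + |c n j (φ m) x - b x|))
      = ((∫ x in K n, |c n j (φ k) x - w n (φ k) x|) + ∫ x in K n, |c n j (φ k) x - b x|)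
        + ((∫ x in K n, |c n j (φ m) x - w n (φ m) x|) + ∫ x in K n, |c n j (φ m) x - b x|) := by
    have a1 := integral_add ((i1 k).add (i2 k)) ((i1 m).add (i2 m))
    have a2 := integral_add (i1 k) (i2 k)
    have a3 := integral_add (i1 m) (i2 m)
    simp only [Pi.add_apply] at a1
    rw [a1, a2, a3]
  linarith [hmol (φ k), hmol (φ m), (abs_lt.1 h1).2, (abs_lt.1 h2).2]

end Rellich

section Morrey

variable {N : ℕ}

lemma lintegral_comp_add_smul {g : Euc N → ENNReal} (hg : Measurable g) (x : Euc N) {t : ℝ}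
    (ht : 0 < t) :
    ∫⁻ y, g (x + t • y) = ENNReal.ofReal (t ^ (-(N : ℝ))) * ∫⁻ y, g y := by
  have h1 : ∫⁻ y, g (x + t • y) = ∫⁻ z, g (x + z) ∂(Measure.map (fun y : Euc N => t • y) volume) :=
    (lintegral_map (hg.comp (measurable_const_add x)) (measurable_const_smul t)).symm
  have h2 := Measure.map_addHaar_smul (volume : Measure (Euc N)) ht.ne'
  have h3 : Measure.map (fun y : Euc N => t • y) volume
      = ENNReal.ofReal (t ^ (-(N : ℝ))) • (volume : Measure (Euc N)) := by
    change Measure.map (t • ·) volume = _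
    rw [h2, finrank_euclideanSpace_fin, abs_of_pos (by positivity), Real.rpow_neg ht.le,
      Real.rpow_natCast]
  rw [h1, h3, lintegral_smul_measure, lintegral_add_left_eq_self, smul_eq_mul]

lemma le_rpow_add_rpow_mul {q κ s t : ℝ} (hq : 1 < q) (hs : 0 ≤ s) (ht : 0 < t) :
    s ≤ t ^ (-κ) + t ^ (κ * (q - 1)) * s ^ q := by
  have hpos : 0 < t ^ (-κ) := rpow_pos_of_pos ht _
  rcases le_total s (t ^ (-κ)) with h | h
  · have : 0 ≤ t ^ (κ * (q - 1)) * s ^ q := by positivity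
    linarith
  · have hs' : 0 < s := hpos.trans_le h
    have h1 : t ^ (-κ * (q - 1)) ≤ s ^ (q - 1) := by
      rw [rpow_mul ht.le]
      exact rpow_le_rpow hpos.le h (by linarith)
    have h2 : s ^ q = s ^ (q - 1) * s := by
      rw [← rpow_add_one hs'.ne']; ring_nf
    have h3 : 1 ≤ t ^ (κ * (q - 1)) * s ^ (q - 1) := by
      calc (1 : ℝ) = t ^ (κ * (q - 1)) * t ^ (-κ * (q - 1)) := by
            rw [← rpow_add ht]; ring_nf; simp
        _ ≤ _ := mul_le_mul_of_nonneg_left h1 (by positivity)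
    rw [h2]
    nlinarith

lemma lintegral_rpow_Ioc_lt_top {a : ℝ} (ha : -1 < a) :
    ∫⁻ t in Set.Ioc (0 : ℝ) 1, ENNReal.ofReal (t ^ a) < ⊤ := by
  have h := (intervalIntegral.intervalIntegrable_rpow' ha (a := 0) (b := 1)).1
  exact h.lintegral_lt_top

/-- Morrey's inequality for the supremum norm. -/
lemma exists_abs_le_of_lt {q : ℝ} (hq : 1 < q) (hNq : (N : ℝ) < q) :
    ∃ C : ℝ, 0 ≤ C ∧ ∀ w : Euc N → ℝ, ContDiff ℝ (⊤ : ℕ∞) w → HasCompactSupport w → ∀ x,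
      |w x| ≤ C * (1 + (∫ y, |w y|) + ∫ y, ‖gradient w y‖ ^ q) := by
  obtain ⟨κ, hκ1, hκ2⟩ : ∃ κ : ℝ, ((N : ℝ) - 1) / (q - 1) < κ ∧ κ < 1 := by
    apply exists_between
    rw [div_lt_one (by linarith)]
    linarith
  rw [div_lt_iff₀ (by linarith)] at hκ1
  set B : Set (Euc N) := Metric.closedBall 0 1
  set m := volume B with hm
  have hm0 : m ≠ 0 := (Metric.measure_closedBall_pos volume 0 one_pos).ne'
  have hmt : m ≠ ⊤ := (isCompact_closedBall (0 : Euc N) 1).measure_lt_top.ne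
  set I1 := ∫⁻ t in Set.Ioc (0 : ℝ) 1, ENNReal.ofReal (t ^ (-κ)) with hI1
  set I2 := ∫⁻ t in Set.Ioc (0 : ℝ) 1, ENNReal.ofReal (t ^ (κ * (q - 1) - N)) with hI2
  have hI1t : I1 ≠ ⊤ := (lintegral_rpow_Ioc_lt_top (by linarith)).ne
  have hI2t : I2 ≠ ⊤ := (lintegral_rpow_Ioc_lt_top (by linarith)).ne
  refine ⟨(m⁻¹).toReal * (1 + (m * I1).toReal + I2.toReal), by positivity, fun w hw hwc x => ?_⟩
  have hg := continuous_gradient hw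
  have hwi : Integrable w := hw.continuous.integrable_of_hasCompactSupport hwc
  have hgc : Continuous fun y => ‖gradient w y‖ ^ q := continuous_rpow_norm hg (by linarith)
  have hgi : Integrable fun y => ‖gradient w y‖ ^ q := by
    refine hgc.integrable_of_hasCompactSupport (HasCompactSupport.intro hwc fun y hy => ?_)
    rw [gradient_eq_zero_of_notMem hy, norm_zero, zero_rpow (by linarith)]
  set G := ∫⁻ y, ENNReal.ofReal (‖gradient w y‖ ^ q) with hG
  have hGe : G = ENNReal.ofReal (∫ y, ‖gradient w y‖ ^ q) :=
    (ofReal_integral_eq_lintegral_ofReal hgi (ae_of_all _ fun y => by positivity)).symm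
  have hWe : ∫⁻ y, ‖w y‖ₑ = ENNReal.ofReal (∫ y, |w y|) :=
    (ofReal_integral_norm_eq_lintegral_enorm hwi).symm
  have key : m * ‖w x‖ₑ ≤ (∫⁻ y, ‖w y‖ₑ) + (m * I1 + I2 * G) := by
    have hmeas : Measurable fun z : Euc N × ℝ => ‖gradient w (x + z.2 • z.1)‖ₑ := by
      have : Continuous fun z : Euc N × ℝ => gradient w (x + z.2 • z.1) := hg.comp (by fun_prop)
      exact this.measurable.enorm
    calc m * ‖w x‖ₑ = ∫⁻ y in B, ‖w x‖ₑ := by rw [setLIntegral_const, mul_comm]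
      _ ≤ ∫⁻ y in B, (‖w (x + y)‖ₑ
            + ∫⁻ t in Set.Ioc (0 : ℝ) 1, ‖gradient w (x + t • y)‖ₑ) := by
          refine setLIntegral_mono' Metric.isClosed_closedBall.measurableSet fun y hy => ?_
          have h1 := enorm_sub_le_lintegral_gradient hw x y
          have hy1 : ‖y‖ₑ ≤ 1 := by
            have : ‖y‖ ≤ 1 := by simpa [B] using hy
            rw [← ofReal_norm]
            exact ENNReal.ofReal_le_one.2 this
          have h2 : ‖w x‖ₑ ≤ ‖w (x + y)‖ₑ + ‖w (x + y) - w x‖ₑ := by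
            have := enorm_sub_le (a := w (x + y)) (b := w (x + y) - w x)
            simpa using this
          refine h2.trans (add_le_add le_rfl (h1.trans ?_))
          exact (mul_le_mul_left hy1 _).trans_eq (one_mul _)
      _ = (∫⁻ y in B, ‖w (x + y)‖ₑ)
            + ∫⁻ y in B, ∫⁻ t in Set.Ioc (0 : ℝ) 1, ‖gradient w (x + t • y)‖ₑ := by
          refine lintegral_add_left ?_ _
          exact (hw.continuous.comp (by fun_prop)).measurable.enorm
      _ ≤ (∫⁻ y, ‖w y‖ₑ)
            + ∫⁻ t in Set.Ioc (0 : ℝ) 1, ∫⁻ y in B, ‖gradient w (x + t • y)‖ₑ := by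
          refine add_le_add ?_ (le_of_eq ?_)
          · refine (setLIntegral_le_lintegral _ _).trans_eq ?_
            exact lintegral_add_left_eq_self (fun y => ‖w y‖ₑ) x
          · exact lintegral_lintegral_swap hmeas.aemeasurable
      _ ≤ (∫⁻ y, ‖w y‖ₑ) + ∫⁻ t in Set.Ioc (0 : ℝ) 1,
            (m * ENNReal.ofReal (t ^ (-κ)) + ENNReal.ofReal (t ^ (κ * (q - 1) - N)) * G) := by
          refine add_le_add le_rfl (setLIntegral_mono' measurableSet_Ioc fun t ht => ?_)
          have ht0 : 0 < t := ht.1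
          calc ∫⁻ y in B, ‖gradient w (x + t • y)‖ₑ
              ≤ ∫⁻ y in B, (ENNReal.ofReal (t ^ (-κ)) + ENNReal.ofReal (t ^ (κ * (q - 1)))
                  * ENNReal.ofReal (‖gradient w (x + t • y)‖ ^ q)) := by
                refine lintegral_mono fun y => ?_
                simp only []
                rw [← ofReal_norm, ← ENNReal.ofReal_mul (by positivity),
                  ← ENNReal.ofReal_add (by positivity) (by positivity)]
                exact ENNReal.ofReal_le_ofReal (le_rpow_add_rpow_mul hq (norm_nonneg _) ht0)
            _ = m * ENNReal.ofReal (t ^ (-κ)) + ENNReal.ofReal (t ^ (κ * (q - 1)))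
                  * ∫⁻ y in B, ENNReal.ofReal (‖gradient w (x + t • y)‖ ^ q) := by
                rw [lintegral_add_left measurable_const, setLIntegral_const, mul_comm,
                  lintegral_const_mul' _ _ ENNReal.ofReal_ne_top]
            _ ≤ _ := by
                refine add_le_add le_rfl ?_
                have h3 := lintegral_comp_add_smul (g := fun y => ENNReal.ofReal
                  (‖gradient w y‖ ^ q)) hgc.measurable.ennreal_ofReal x ht0
                refine (mul_le_mul_right ((setLIntegral_le_lintegral _ _).trans_eq h3)
                  _).trans_eq ?_
                rw [← mul_assoc, ← ENNReal.ofReal_mul (by positivity), ← rpow_add ht0]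
                rfl
      _ = _ := by
          rw [lintegral_add_left (by fun_prop), lintegral_const_mul' _ _ hmt,
            lintegral_mul_const _ (by fun_prop)]
  have hW0 : 0 ≤ ∫ y, |w y| := integral_nonneg fun y => abs_nonneg _
  have hG0 : 0 ≤ ∫ y, ‖gradient w y‖ ^ q := integral_nonneg fun y => by positivity
  rw [hWe, hGe] at key
  have hfin : ENNReal.ofReal (∫ y, |w y|) + (m * I1 + I2 * ENNReal.ofReal
      (∫ y, ‖gradient w y‖ ^ q)) ≠ ⊤ := by finiteness
  have key2 := ENNReal.toReal_mono hfin key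
  rw [ENNReal.toReal_add (by finiteness) (by finiteness), ENNReal.toReal_add (by finiteness)
    (by finiteness), ENNReal.toReal_mul, ENNReal.toReal_mul (a := I2), ENNReal.toReal_ofReal hW0,
    ENNReal.toReal_ofReal hG0, toReal_enorm, Real.norm_eq_abs] at key2
  have hmr : 0 < m.toReal := ENNReal.toReal_pos hm0 hmt
  rw [ENNReal.toReal_inv, mul_assoc, inv_mul_eq_div, le_div_iff₀ hmr, mul_comm]
  have a1 : 0 ≤ (m * I1).toReal := ENNReal.toReal_nonneg
  have a2 : 0 ≤ I2.toReal := ENNReal.toReal_nonneg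
  nlinarith [mul_nonneg a1 hW0, mul_nonneg a1 hG0, mul_nonneg a2 hW0]

end Morrey

section Sobolev

variable {N : ℕ}

/-- The Gagliardo–Nirenberg–Sobolev inequality, as boundedness in `L^s`. -/
lemma exists_integral_rpow_le {q s : ℝ} (hN : 0 < N) (hq : 1 ≤ q) (hs : 0 < s)
    (hqs : s⁻¹ = q⁻¹ - (N : ℝ)⁻¹) (B : ℝ) :
    ∃ B' : ℝ, ∀ w : Euc N → ℝ, ContDiff ℝ (⊤ : ℕ∞) w → HasCompactSupport w →
      ∫ y, ‖gradient w y‖ ^ q ≤ B → ∫ y, |w y| ^ s ≤ B' := by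
  let q' : NNReal := ⟨q, by linarith⟩
  let s' : NNReal := ⟨s, hs.le⟩
  have hq0 : (q' : ENNReal) ≠ 0 := by
    intro h
    have : q' = 0 := by exact_mod_cast h
    have : q = 0 := congrArg NNReal.toReal this
    linarith
  have hs0 : (s' : ENNReal) ≠ 0 := by
    intro h
    have : s' = 0 := by exact_mod_cast h
    have : s = 0 := congrArg NNReal.toReal this
    linarith
  set C := SNormLESNormFDerivOfEqConst ℝ (volume : Measure (Euc N)) q' with hC
  refine ⟨(C * B ^ q⁻¹) ^ s, fun w hw hwc hB => ?_⟩
  have hw1 : ContDiff ℝ 1 w := hw.of_le (by exact_mod_cast le_top)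
  have h := eLpNorm_le_eLpNorm_fderiv_of_eq (volume : Measure (Euc N)) hw1 hwc (p := q') (p' := s')
    (by exact_mod_cast hq) (by simpa using hN) (by rw [finrank_euclideanSpace_fin]; exact hqs)
  have hm1 : MemLp w s' := hw.continuous.memLp_of_hasCompactSupport hwc
  have hm2 : MemLp (fderiv ℝ w) q' :=
    (hw.continuous_fderiv (by simp)).memLp_of_hasCompactSupport (hwc.fderiv ℝ)
  rw [hm1.eLpNorm_eq_integral_rpow_norm hs0 ENNReal.coe_ne_top,
    hm2.eLpNorm_eq_integral_rpow_norm hq0 ENNReal.coe_ne_top,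
    ← hC, ← ENNReal.ofReal_coe_nnreal (p := C), ← ENNReal.ofReal_mul (by positivity)] at h
  have e1 : ENNReal.toReal (s' : ENNReal) = s := rfl
  have e2 : ENNReal.toReal (q' : ENNReal) = q := rfl
  have hI1 : 0 ≤ ∫ y, |w y| ^ s := integral_nonneg fun y => by positivity
  have hI2 : 0 ≤ ∫ y, ‖gradient w y‖ ^ q := integral_nonneg fun y => by positivity
  simp only [e1, e2, ← norm_gradient, Real.norm_eq_abs] at h
  rw [ENNReal.ofReal_le_ofReal_iff (by positivity)] at h
  have h2 : (∫ y, |w y| ^ s) ^ s⁻¹ ≤ C * B ^ q⁻¹ :=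
    h.trans (mul_le_mul_of_nonneg_left (rpow_le_rpow hI2 hB (by positivity)) C.2)
  calc ∫ y, |w y| ^ s = ((∫ y, |w y| ^ s) ^ s⁻¹) ^ s := by
        rw [← rpow_mul hI1, inv_mul_cancel₀ hs.ne', rpow_one]
    _ ≤ _ := rpow_le_rpow (by positivity) h2 hs.le

end Sobolev

section Potential

variable {N : ℕ} {Ω : Set (Euc N)}

/-- The weighted Sobolev energy `∫_Ω (|∇u|^q + |u|^q) W`. -/
def wEnergy (q : ℝ) (Ω : Set (Euc N)) (W : Euc N → ℝ) (u : Euc N → ℝ) : ℝ :=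
  ∫ x in Ω, (‖gradient u x‖ ^ q + |u x| ^ q) * W x

lemma rpow_le_one_add_rpow {s a b : ℝ} (hs : 0 ≤ s) (ha : 0 ≤ a) (hab : a ≤ b) :
    s ^ a ≤ 1 + s ^ b := by
  rcases le_total s 1 with h | h
  · have := rpow_le_one hs h ha
    have := rpow_nonneg hs b
    linarith
  · have := rpow_le_rpow_of_exponent_le h hab
    linarith

lemma IsTestFun.integrableOn_energy {u W : Euc N → ℝ} {q : ℝ} (hu : IsTestFun Ω u) (hq : 0 < q)
    (hWc : ContinuousOn W Ω) :
    IntegrableOn (fun x => (‖gradient u x‖ ^ q + |u x| ^ q) * W x) Ω := by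
  have hc : Continuous fun x => ‖gradient u x‖ ^ q + |u x| ^ q :=
    (continuous_rpow_norm hu.continuous_gradient hq.le).add
      (continuous_rpow_norm hu.continuous hq.le)
  have := integrableOn_mul_of_eq_zero hu.isCompact (V := W)
    ((hWc.mono hu.2.2).integrableOn_compact hu.isCompact) hc (fun x hx => by
      rw [gradient_eq_zero_of_notMem hx, image_eq_zero_of_notMem_tsupport hx]
      simp [zero_rpow hq.ne']) Ω
  simpa only [mul_comm] using this

lemma wEnergy_nonneg {u W : Euc N → ℝ} {q : ℝ} (hΩ : IsOpen Ω) (hWpos : ∀ x ∈ Ω, 0 < W x) :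
    0 ≤ wEnergy q Ω W u :=
  setIntegral_nonneg hΩ.measurableSet fun x hx => mul_nonneg (by positivity) (hWpos x hx).le

/-- A bound on the weighted energy gives local bounds in `W^{1,q}`. -/
lemma exists_local_energy_bound {W : Euc N → ℝ} {q : ℝ} (hΩ : IsOpen Ω) (hq : 0 < q)
    (hWc : ContinuousOn W Ω) (hWpos : ∀ x ∈ Ω, 0 < W x) {K : Set (Euc N)} (hK : IsCompact K)
    (hKΩ : K ⊆ Ω) (M : ℝ) :
    ∃ B : ℝ, ∀ u, IsTestFun Ω u → wEnergy q Ω W u ≤ M →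
      ∫ x in K, (‖gradient u x‖ ^ q + |u x| ^ q) ≤ B := by
  obtain ⟨c, hc, hcW⟩ := exists_pos_le_of_compact hWc hWpos hK hKΩ
  refine ⟨M / c, fun u hu hM => ?_⟩
  rw [le_div_iff₀ hc]
  refine le_trans ?_ hM
  have hcont : Continuous fun x => ‖gradient u x‖ ^ q + |u x| ^ q :=
    (continuous_rpow_norm hu.continuous_gradient hq.le).add
      (continuous_rpow_norm hu.continuous hq.le)
  have hi := hu.integrableOn_energy hq hWc
  calc (∫ x in K, (‖gradient u x‖ ^ q + |u x| ^ q)) * c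
      = ∫ x in K, (‖gradient u x‖ ^ q + |u x| ^ q) * c := (integral_mul_const _ _).symm
    _ ≤ ∫ x in K, (‖gradient u x‖ ^ q + |u x| ^ q) * W x := by
        refine setIntegral_mono_on ((hcont.mul continuous_const).continuousOn.integrableOn_compact
          hK) (hi.mono_set hKΩ) hK.measurableSet fun x hx => ?_
        exact mul_le_mul_of_nonneg_left (hcW x hx) (by positivity)
    _ ≤ _ := setIntegral_mono_set hi ((ae_restrict_iff' hΩ.measurableSet).2 (ae_of_all _
        fun x hx => mul_nonneg (by positivity) (hWpos x hx).le)) hKΩ.eventuallyLE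

/-- Cutting off turns the local bounds into global ones. -/
lemma exists_cutoff_energy_bound {W η : Euc N → ℝ} {q : ℝ} (hΩ : IsOpen Ω) (hq : 1 < q)
    (hWc : ContinuousOn W Ω) (hWpos : ∀ x ∈ Ω, 0 < W x) (hη : IsTestFun Ω η) (M : ℝ) :
    ∃ B : ℝ, ∀ u, IsTestFun Ω u → wEnergy q Ω W u ≤ M → ∀ a, 1 ≤ a → a ≤ q →
      ∫ x, ‖gradient (fun y => η y * u y) x‖ ^ a ≤ B ∧ ∫ x, |η x * u x| ^ a ≤ B := by
  set K := tsupport η with hKdef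
  have hK : IsCompact K := hη.isCompact
  obtain ⟨B, hB⟩ := exists_local_energy_bound hΩ (by linarith) hWc hWpos hK hη.2.2 (q := q) M
  obtain ⟨A1, hA1⟩ := hη.2.1.exists_bound_of_continuous hη.continuous
  obtain ⟨A2, hA2⟩ := (HasCompactSupport.intro hη.2.1 fun x hx =>
    gradient_eq_zero_of_notMem hx : HasCompactSupport (gradient η)).exists_bound_of_continuous
    hη.continuous_gradient
  set A := max A1 A2 with hA
  have hA0 : 0 ≤ A := ((norm_nonneg _).trans (hA1 0)).trans (le_max_left _ _)
  refine ⟨volume.real K + A ^ q * 2 ^ q * B, fun u hu hM a ha haq => ?_⟩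
  have hcont : Continuous fun x => ‖gradient u x‖ ^ q + |u x| ^ q :=
    (continuous_rpow_norm hu.continuous_gradient (by linarith)).add
      (continuous_rpow_norm hu.continuous (by linarith))
  have hηu : IsTestFun Ω (fun y => η y * u y) := hη.mul_contDiff hu.1
  have main : ∀ g : Euc N → ℝ, Continuous g → (∀ x, 0 ≤ g x) → (∀ x ∉ K, g x = 0) →
      (∀ x, g x ≤ A * (‖gradient u x‖ + |u x|)) →
      ∫ x, g x ^ a ≤ volume.real K + A ^ q * 2 ^ q * B := by
    intro g hg hg0 hgK hgle
    calc ∫ x, g x ^ a = ∫ x in K, g x ^ a := by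
          rw [setIntegral_eq_integral_of_forall_compl_eq_zero]
          intro x hx
          rw [hgK x hx, zero_rpow (by linarith)]
      _ ≤ ∫ x in K, (1 + A ^ q * 2 ^ q * (‖gradient u x‖ ^ q + |u x| ^ q)) := by
          refine setIntegral_mono_on ?_ ?_ hK.measurableSet fun x _ => ?_
          · exact (hg.rpow_const fun x => Or.inr (by linarith)).continuousOn.integrableOn_compact hK
          · exact (continuous_const.add
              (continuous_const.mul hcont)).continuousOn.integrableOn_compact
              hK
          · refine (rpow_le_one_add_rpow (hg0 x) (by linarith) haq).trans (add_le_add le_rfl ?_)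
            calc g x ^ q ≤ (A * (‖gradient u x‖ + |u x|)) ^ q :=
                  rpow_le_rpow (hg0 x) (hgle x) (by linarith)
              _ = A ^ q * (‖gradient u x‖ + |u x|) ^ q := mul_rpow hA0 (by positivity)
              _ ≤ A ^ q * (2 ^ q * (‖gradient u x‖ ^ q + |u x| ^ q)) :=
                  mul_le_mul_of_nonneg_left (add_rpow_le_two_rpow_mul (norm_nonneg _)
                    (abs_nonneg _) (by linarith)) (by positivity)
              _ = _ := by ring
      _ = volume.real K + A ^ q * 2 ^ q * ∫ x in K, (‖gradient u x‖ ^ q + |u x| ^ q) := by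
          have h1 : IntegrableOn (fun _ : Euc N => (1 : ℝ)) K :=
            integrableOn_const hK.measure_lt_top.ne
          rw [integral_add h1 ((hcont.continuousOn.integrableOn_compact hK).const_mul _),
            integral_const_mul, setIntegral_const, smul_eq_mul, mul_one]
      _ ≤ _ := add_le_add le_rfl (mul_le_mul_of_nonneg_left (hB u hu hM) (by positivity))
  have hb1 : ∀ x, |η x| ≤ A := fun x => (hA1 x).trans (le_max_left _ _)
  have hb2 : ∀ x, ‖gradient η x‖ ≤ A := fun x => (hA2 x).trans (le_max_right _ _)
  constructor
  · refine main _ hηu.continuous_gradient.norm (fun x => norm_nonneg _) (fun x hx => ?_) fun x => ?_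
    · rw [gradient_eq_zero_of_notMem, norm_zero]
      exact fun h => hx ((tsupport_mul_subset_left (f := η) (g := u)) h)
    · rw [gradient_mul' (hη.differentiable x) (hu.differentiable x)]
      refine (norm_add_le _ _).trans ?_
      rw [norm_smul, norm_smul, Real.norm_eq_abs, Real.norm_eq_abs]
      nlinarith [hb1 x, hb2 x, norm_nonneg (gradient u x), abs_nonneg (u x)]
  · refine main _ hηu.continuous.abs (fun x => abs_nonneg _) (fun x hx => ?_) fun x => ?_
    · simp [image_eq_zero_of_notMem_tsupport hx]
    · rw [abs_mul]
      nlinarith [hb1 x, norm_nonneg (gradient u x), abs_nonneg (u x)]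

lemma integrableOn_rpow_of_le {V : Euc N → ℝ} {r a : ℝ} {K : Set (Euc N)} (hK : IsCompact K)
    (hV0 : ∀ x ∈ K, 0 ≤ V x) (hr : 1 ≤ r) (ha : 0 ≤ a) (har : a ≤ r)
    (hV : IntegrableOn (fun x => V x ^ r) K) : IntegrableOn (fun x => V x ^ a) K := by
  have hm : AEStronglyMeasurable (fun x => V x ^ a) (volume.restrict K) := by
    have h1 : AEStronglyMeasurable (fun x => (V x ^ r) ^ (a / r)) (volume.restrict K) :=
      (continuous_rpow_const (div_nonneg ha (by linarith))).comp_aestronglyMeasurable hV.1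
    refine h1.congr ((ae_restrict_iff' hK.measurableSet).2 (ae_of_all _ fun x hx => ?_))
    simp only []
    rw [← rpow_mul (hV0 x hx), mul_div_cancel₀ _ (by linarith)]
  refine Integrable.mono' ((integrableOn_const (C := (1 : ℝ)) hK.measure_lt_top.ne).add hV) hm
    ((ae_restrict_iff' hK.measurableSet).2 (ae_of_all _ fun x hx => ?_))
  rw [Real.norm_eq_abs, abs_of_nonneg (rpow_nonneg (hV0 x hx) _)]
  exact rpow_le_one_add_rpow (hV0 x hx) ha har

/-- Uniform integrability of `V |u|^{p-1}` over a compact set, for `u` of bounded energy: the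
integrands are dominated by `l • y(u)` up to an integrable function, for arbitrarily small `l`. -/
def PotentialBound (p q : ℝ) (Ω : Set (Euc N)) (V W : Euc N → ℝ) : Prop :=
  ∀ (K : Set (Euc N)), IsCompact K → K ⊆ Ω → ∀ M : ℝ, ∃ (y : ℝ → ℝ) (B : ℝ), Continuous y ∧
    (∀ t, 0 ≤ y t) ∧ (∀ u, IsTestFun Ω u → wEnergy q Ω W u ≤ M → ∫ x in K, y (u x) ≤ B) ∧
    ∀ l > 0, ∃ H : Euc N → ℝ, IntegrableOn H K ∧ ∀ u, IsTestFun Ω u → wEnergy q Ω W u ≤ M →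
      ∀ x ∈ K, V x * |u x| ^ (p - 1) ≤ l * y (u x) + H x

lemma potentialBound_of_sobolev {V W : Euc N → ℝ} {p q r a s : ℝ} (hp : 1 < p) (hΩ : IsOpen Ω)
    (hV0 : ∀ x ∈ Ω, 0 ≤ V x)
    (hVr : ∀ K : Set (Euc N), IsCompact K → K ⊆ Ω → IntegrableOn (fun x => V x ^ r) K)
    (hq : 1 < q) (hWc : ContinuousOn W Ω) (hWpos : ∀ x ∈ Ω, 0 < W x) (hr : 1 ≤ r) (hN : 0 < N)
    (ha : 1 ≤ a) (haq : a ≤ q) (hs : p - 1 < s) (has : s⁻¹ = a⁻¹ - (N : ℝ)⁻¹)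
    (hsr : s / (s - (p - 1)) ≤ r) : PotentialBound p q Ω V W := by
  intro K hK hKΩ M
  obtain ⟨η, hη, hη0, hη1, hηK⟩ := exists_cutoff hΩ hK hKΩ
  obtain ⟨B, hB⟩ := exists_cutoff_energy_bound hΩ hq hWc hWpos hη M
  obtain ⟨B', hB'⟩ := exists_integral_rpow_le hN ha (by linarith) has B
  refine ⟨fun t => |t| ^ s, B', ?_, fun t => by positivity, fun u hu hM => ?_, fun l hl => ?_⟩
  · exact continuous_abs.rpow_const fun _ => Or.inr (by linarith)
  · have hηu : IsTestFun Ω (fun y => η y * u y) := hη.mul_contDiff hu.1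
    have h1 := hB' _ hηu.1 hηu.2.1 (hB u hu hM a ha haq).1
    refine le_trans ?_ h1
    calc ∫ x in K, |u x| ^ s = ∫ x in K, |η x * u x| ^ s :=
          setIntegral_congr_fun hK.measurableSet fun x hx => by simp [hηK x hx]
      _ ≤ _ := by
          refine setIntegral_le_integral ?_ (ae_of_all _ fun x => by positivity)
          have := integrableOn_of_eq_zero hηu.isCompact (g := fun x => |η x * u x| ^ s)
            (continuous_rpow_norm hηu.continuous (by linarith)) (fun x hx => by
              have h0 : η x * u x = 0 :=
                image_eq_zero_of_notMem_tsupport (f := fun y => η y * u y) hx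
              rw [h0, abs_zero, zero_rpow (by linarith)]) Set.univ
          simpa using this
  · refine ⟨fun x => l ^ (-((p - 1) / (s - (p - 1)))) * V x ^ (s / (s - (p - 1))), ?_,
      fun u hu hM x hx => ?_⟩
    · exact (integrableOn_rpow_of_le hK (fun x hx => hV0 x (hKΩ hx)) hr
        (div_nonneg (by linarith) (by linarith)) hsr (hVr K hK hKΩ)).const_mul _
    · exact young_param (hV0 x (hKΩ hx)) (abs_nonneg _) hl (by linarith) hs

lemma potentialBound_of_morrey {V W : Euc N → ℝ} {p q : ℝ} (hp : 1 < p) (hΩ : IsOpen Ω)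
    (hV0 : ∀ x ∈ Ω, 0 ≤ V x)
    (hVi : ∀ K : Set (Euc N), IsCompact K → K ⊆ Ω → IntegrableOn V K)
    (hq : 1 < q) (hWc : ContinuousOn W Ω) (hWpos : ∀ x ∈ Ω, 0 < W x) (hNq : (N : ℝ) < q) :
    PotentialBound p q Ω V W := by
  intro K hK hKΩ M
  obtain ⟨η, hη, hη0, hη1, hηK⟩ := exists_cutoff hΩ hK hKΩ
  obtain ⟨B, hB⟩ := exists_cutoff_energy_bound hΩ hq hWc hWpos hη M
  obtain ⟨C, hC0, hC⟩ := exists_abs_le_of_lt hq hNq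
  refine ⟨fun _ => 0, 0, continuous_const, fun _ => le_rfl, by simp, fun l hl =>
    ⟨fun x => V x * (C * (1 + B + B)) ^ (p - 1), (hVi K hK hKΩ).mul_const _,
      fun u hu hM x hx => ?_⟩⟩
  have hηu : IsTestFun Ω (fun y => η y * u y) := hη.mul_contDiff hu.1
  have h1 := hC _ hηu.1 hηu.2.1 x
  have h2 := (hB u hu hM q hq.le le_rfl).1
  have h3 := (hB u hu hM 1 le_rfl hq.le).2
  simp only [rpow_one] at h3
  have h4 : |u x| ≤ C * (1 + B + B) := by
    have e : |u x| = |η x * u x| := by rw [hηK x hx, one_mul]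
    rw [e]
    refine h1.trans (mul_le_mul_of_nonneg_left ?_ hC0)
    linarith
  rw [mul_zero, zero_add]
  exact mul_le_mul_of_nonneg_left (rpow_le_rpow (abs_nonneg _) h4 (by linarith)) (hV0 x (hKΩ hx))

lemma one_le_of_integrability {p q r : ℝ} (hp : 1 < p) (hq1 : 1 < q) (hpq : p - 1 < q)
    (hrlt : (N : ℝ) < q → r = 1) (hreq : (N : ℝ) = q → 1 < r)
    (hrgt : q < (N : ℝ) → 1 / r + (p - 1) / ((N * q) / (N - q)) = 1) : 1 ≤ r := by
  rcases lt_trichotomy (N : ℝ) q with h | h | h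
  · exact (hrlt h).ge
  · exact (hreq h).le
  · have h1 := hrgt h
    have hd : 0 < (N : ℝ) - q := by linarith
    have hN : 0 < (N : ℝ) := by linarith
    set s := (N * q) / ((N : ℝ) - q) with hs
    have hsq : q ≤ s := by
      rw [hs, le_div_iff₀ hd]; nlinarith
    have h2 : 0 < (p - 1) / s := div_pos (by linarith) (by linarith)
    have h3 : (p - 1) / s < 1 := by rw [div_lt_one (by linarith)]; linarith
    have h4 : 0 < 1 / r := by linarith
    have hr : 0 < r := one_div_pos.1 h4
    have h5 : 1 / r ≤ 1 := by linarith
    rwa [div_le_one hr] at h5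

lemma potentialBound {V W : Euc N → ℝ} {p q r : ℝ} (hp : 1 < p) (hΩ : IsOpen Ω)
    (hV0 : ∀ x ∈ Ω, 0 ≤ V x)
    (hVr : ∀ K : Set (Euc N), IsCompact K → K ⊆ Ω → IntegrableOn (fun x => V x ^ r) K)
    (hq1 : 1 < q) (hpq : p - 1 < q)
    (hrlt : (N : ℝ) < q → r = 1) (hreq : (N : ℝ) = q → 1 < r)
    (hrgt : q < (N : ℝ) → 1 / r + (p - 1) / ((N * q) / (N - q)) = 1)
    (hWc : ContinuousOn W Ω) (hWpos : ∀ x ∈ Ω, 0 < W x) : PotentialBound p q Ω V W := by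
  have hr := one_le_of_integrability hp hq1 hpq hrlt hreq hrgt
  rcases lt_trichotomy (N : ℝ) q with h | h | h
  · refine potentialBound_of_morrey hp hΩ hV0 (fun K hK hKΩ => ?_) hq1 hWc hWpos h
    simpa [hrlt h] using hVr K hK hKΩ
  · have hr1 := hreq h
    have hN : (1 : ℝ) < N := by linarith
    have hN2 : (2 : ℝ) ≤ N := by
      have : 1 < N := by exact_mod_cast hN
      exact_mod_cast this
    set s := (p - 1) * r / (r - 1) + 2 with hs
    have hr10 : 0 < r - 1 := by linarith
    have hs2 : (p - 1) * r ≤ s * (r - 1) := by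
      rw [hs, add_mul, div_mul_cancel₀ _ hr10.ne']; linarith
    have hs3 : 2 ≤ s := by
      have : 0 ≤ (p - 1) * r / (r - 1) :=
        div_nonneg (mul_nonneg (by linarith) (by linarith)) hr10.le
      linarith
    have hs4 : p - 1 < s := by nlinarith
    refine potentialBound_of_sobolev (a := N * s / (N + s)) (s := s) hp hΩ hV0 hVr hq1 hWc hWpos hr
      (by exact_mod_cast (by linarith : (0 : ℝ) < N)) ?_ ?_ hs4 ?_ ?_
    · rw [le_div_iff₀ (by linarith)]; nlinarith
    · rw [div_le_iff₀ (by linarith), ← h]; nlinarith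
    · field_simp; ring
    · rw [div_le_iff₀ (by linarith)]; nlinarith
  · have hd : 0 < (N : ℝ) - q := by linarith
    have hN : 0 < (N : ℝ) := by linarith
    have h1 := hrgt h
    set s := (N * q) / ((N : ℝ) - q) with hs
    have hsq : q ≤ s := by
      rw [hs, le_div_iff₀ hd]; nlinarith
    refine potentialBound_of_sobolev (a := q) (s := s) hp hΩ hV0 hVr hq1 hWc hWpos hr
      (by exact_mod_cast hN) hq1.le le_rfl (by linarith) ?_ ?_
    · rw [hs]; field_simp
    · rw [div_le_iff₀ (by linarith)]
      have hs0 : 0 < s := by linarith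
      field_simp at h1
      nlinarith

end Potential

section Critical

variable {N : ℕ} {Ω : Set (Euc N)} {p q : ℝ} {V W : Euc N → ℝ} {f : (Euc N → ℝ) → ℝ}
  {u h : Euc N → ℝ}

lemma almost_critical_arith {p t e ε l l' δ M m Eu Eh Euh Pu Puh I P Fu F : ℝ} (hp : 0 < p)
    (ht : 0 < t) (he : 0 < e) (he1 : e ≤ 1) (hl : 0 < l) (hε : 0 ≤ ε)
    (hδe : 2 * (δ * m) * (M / e + 1) = ε / 4) (hlM : l * M = ε / 4) (hel : e * l' ≤ ε / 4)
    (hEu : Eu ≤ M / e) (hEu0 : 0 ≤ Eu) (hEh : 0 ≤ Eh)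
    (hmin : (1 + e) * Eu - Pu - p * Fu - p * (t * (ε / 4))
      ≤ (1 + e) * Euh - Puh - p * (1 * Fu + t * F))
    (hE : Euh ≤ Eu + p * t * I + p * t * (δ * m * (Eu + Eh)))
    (hP : Pu + p * t * P ≤ Puh) (hI : I ≤ l * Eu + l' * Eh) :
    -(I - P - F) ≤ ε * (1 + Eh) := by
  have hEue : Eu * e ≤ M := by rwa [le_div_iff₀ he] at hEu
  have hMe : 0 ≤ M / e := hEu0.trans hEu
  have hδ : 0 ≤ δ * m := by
    by_contra! h
    nlinarith
  have h7 := mul_le_mul_of_nonneg_left hE (by linarith : 0 ≤ 1 + e)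
  have h8 : p * t * (-(ε / 4)) ≤ p * t * ((1 + e) * I - P - F
      + (1 + e) * (δ * m * (Eu + Eh))) := by linarith
  have h9 := le_of_mul_le_mul_left h8 (by positivity)
  have h10 : (1 + e) * (δ * m * (Eu + Eh)) ≤ ε / 4 * (1 + Eh) := by
    have a1 : 0 ≤ δ * m * (Eu + Eh) := mul_nonneg hδ (by linarith)
    have a2 : 2 * (δ * m) * (Eu + Eh) ≤ 2 * (δ * m) * ((M / e + 1) * (1 + Eh)) :=
      mul_le_mul_of_nonneg_left (by nlinarith) (by linarith)
    rw [← hδe]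
    nlinarith
  have h11 : e * I ≤ ε / 4 + ε / 4 * Eh := by
    have a1 := mul_le_mul_of_nonneg_left hI he.le
    have a2 : l * (Eu * e) ≤ l * M := mul_le_mul_of_nonneg_left hEue hl.le
    have a3 : e * l' * Eh ≤ ε / 4 * Eh := mul_le_mul_of_nonneg_right hel hEh
    linarith
  have := mul_nonneg hε hEh
  linarith

/-- The standing assumptions, in the form in which they are used. -/
structure Admissible (p q : ℝ) (Ω : Set (Euc N)) (V W : Euc N → ℝ) (f : (Euc N → ℝ) → ℝ) :
    Prop where
  hp : 1 < p
  hΩ : IsOpen Ω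
  hV0 : ∀ x ∈ Ω, 0 ≤ V x
  hVi : ∀ K : Set (Euc N), IsCompact K → K ⊆ Ω → IntegrableOn V K
  hq1 : 1 < q
  hpq : p - 1 < q
  hWc : ContinuousOn W Ω
  hWpos : ∀ x ∈ Ω, 0 < W x
  hA : ∀ u : Euc N → ℝ, IsTestFun Ω u → wEnergy q Ω W u ^ (p / q) ≤ QV p Ω V u
  hlin : ∀ (a b : ℝ) (ζ η : Euc N → ℝ), IsTestFun Ω ζ → IsTestFun Ω η →
      f (fun x => a * ζ x + b * η x) = a * f ζ + b * f η
  hf : ∃ C : ℝ, 0 ≤ C ∧ ∀ u, IsTestFun Ω u → |f u| ≤ C * QV p Ω V u ^ (1 / p)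
  hVB : PotentialBound p q Ω V W

/-- The Dirichlet `p`-energy. -/
def pEnergy (p : ℝ) (Ω : Set (Euc N)) (u : Euc N → ℝ) : ℝ := ∫ x in Ω, ‖gradient u x‖ ^ p

/-- The residual of the equation at `u`, tested against `h`. -/
def resid (p : ℝ) (Ω : Set (Euc N)) (V : Euc N → ℝ) (f : (Euc N → ℝ) → ℝ) (u h : Euc N → ℝ) : ℝ :=
  (∫ x in Ω, ⟪pPow p (gradient u x), gradient h x⟫) - (∫ x in Ω, V x * pPow p (u x) * h x) - f h

lemma pEnergy_nonneg : 0 ≤ pEnergy p Ω u := integral_nonneg fun x => by positivity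

lemma IsTestFun.integrableOn_gradient_rpow (hu : IsTestFun Ω u) {s : ℝ} (hs : 0 < s)
    (S : Set (Euc N)) : IntegrableOn (fun x => ‖gradient u x‖ ^ s) S :=
  integrableOn_of_eq_zero hu.isCompact (continuous_rpow_norm hu.continuous_gradient hs.le)
    (fun x hx => by rw [gradient_eq_zero_of_notMem hx, norm_zero, zero_rpow hs.ne']) S

lemma IsTestFun.integrableOn_inner_pPow (hh : IsTestFun Ω h) (hu : ContDiff ℝ (⊤ : ℕ∞) u)
    (hp : 1 < p) (S : Set (Euc N)) :
    IntegrableOn (fun x => ⟪pPow p (gradient u x), gradient h x⟫) S :=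
  integrableOn_of_eq_zero hh.isCompact
    (((continuous_pPow hp).comp (_root_.continuous_gradient hu)).inner hh.continuous_gradient)
    (fun x hx => by rw [gradient_eq_zero_of_notMem hx, inner_zero_right]) S

namespace Admissible

lemma integrableOn_mul (S : Admissible p q Ω V W f) (hh : IsTestFun Ω h)
    {g : Euc N → ℝ} (hg : Continuous g)
    (h0 : ∀ x ∉ tsupport h, g x = 0) : IntegrableOn (fun x => V x * g x) Ω :=
  integrableOn_mul_of_eq_zero hh.isCompact (S.hVi _ hh.isCompact hh.2.2) hg h0 Ω

lemma integrableOn_potential (S : Admissible p q Ω V W f) (hu : IsTestFun Ω u) :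
    IntegrableOn (fun x => V x * |u x| ^ p) Ω :=
  S.integrableOn_mul hu (continuous_rpow_norm hu.continuous (by linarith [S.hp])) fun x hx => by
    rw [image_eq_zero_of_notMem_tsupport hx, abs_zero, zero_rpow (by linarith [S.hp])]

lemma integrableOn_potential_mul (S : Admissible p q Ω V W f) (hu : Continuous u)
    (hh : IsTestFun Ω h) :
    IntegrableOn (fun x => V x * pPow p (u x) * h x) Ω := by
  have := S.integrableOn_mul hh (g := fun x => pPow p (u x) * h x)
    (((continuous_pPow S.hp).comp hu).mul hh.continuous)
    fun x hx => by rw [image_eq_zero_of_notMem_tsupport hx, mul_zero]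
  simpa only [mul_assoc] using this

lemma QV_nonneg (S : Admissible p q Ω V W f) (hu : IsTestFun Ω u) : 0 ≤ QV p Ω V u :=
  (rpow_nonneg (wEnergy_nonneg S.hΩ S.hWpos) _).trans (S.hA u hu)

lemma QV_le_pEnergy (S : Admissible p q Ω V W f) : QV p Ω V u ≤ pEnergy p Ω u := by
  have : 0 ≤ ∫ x in Ω, V x * |u x| ^ p :=
    setIntegral_nonneg S.hΩ.measurableSet fun x hx => mul_nonneg (S.hV0 x hx) (by positivity)
  simp only [QV, pEnergy]
  linarith

lemma wEnergy_le (S : Admissible p q Ω V W f) {M : ℝ} (hu : IsTestFun Ω u) (hM : QV p Ω V u ≤ M) :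
    wEnergy q Ω W u ≤ M ^ (q / p) := by
  have hp0 : 0 < p := by linarith [S.hp]
  have hq0 : 0 < q := by linarith [S.hq1]
  have h0 : 0 ≤ wEnergy q Ω W u := wEnergy_nonneg S.hΩ S.hWpos
  calc wEnergy q Ω W u = (wEnergy q Ω W u ^ (p / q)) ^ (q / p) := by
        rw [← rpow_mul h0, div_mul_div_cancel₀ hq0.ne', div_self hp0.ne', rpow_one]
    _ ≤ M ^ (q / p) := rpow_le_rpow (by positivity) ((S.hA u hu).trans hM) (by positivity)

lemma exists_abs_f_le (S : Admissible p q Ω V W f) {l : ℝ} (hl : 0 < l) :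
    ∃ C : ℝ, 0 ≤ C ∧ ∀ u, IsTestFun Ω u → |f u| ≤ l * QV p Ω V u + C := by
  obtain ⟨C, hC0, hC⟩ := S.hf
  have hp := S.hp
  refine ⟨l ^ (-(1 / p / (1 - 1 / p))) * C ^ (1 / (1 - 1 / p)), by positivity, fun u hu => ?_⟩
  have := young_param (α := 1 / p) (s := 1) hC0 (S.QV_nonneg hu) hl (by positivity)
    ((div_lt_one (by linarith)).2 hp)
  rw [rpow_one] at this
  exact (hC u hu).trans this

lemma f_neg (S : Admissible p q Ω V W f) (hu : IsTestFun Ω u) :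
    f (fun x => (-1) * u x + 0 * u x) = -f u := by
  rw [S.hlin (-1) 0 u u hu hu]; ring

lemma resid_neg (S : Admissible p q Ω V W f) (hh : IsTestFun Ω h) :
    resid p Ω V f u (fun x => (-1) * h x + 0 * h x) = -resid p Ω V f u h := by
  simp only [resid, S.f_neg hh]
  have e1 : ∀ x, gradient (fun x => (-1) * h x + 0 * h x) x = -gradient h x := fun x => by
    rw [gradient_lin _ _ (hh.differentiable x) (hh.differentiable x)]; simp
  simp only [e1, inner_neg_right, integral_neg]
  have e2 : ∀ x, V x * pPow p (u x) * (-1 * h x + 0 * h x) = -(V x * pPow p (u x) * h x) :=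
    fun x => by ring
  simp only [e2, integral_neg]
  ring

lemma pEnergy_neg (hh : IsTestFun Ω h) :
    pEnergy p Ω (fun x => (-1) * h x + 0 * h x) = pEnergy p Ω h := by
  simp only [pEnergy]
  congr 1; ext x
  rw [gradient_lin _ _ (hh.differentiable x) (hh.differentiable x)]; simp

lemma potential_convex (S : Admissible p q Ω V W f) (hu : IsTestFun Ω u)
    (hh : IsTestFun Ω h) (t : ℝ) :
    (∫ x in Ω, V x * |u x| ^ p) + p * t * ∫ x in Ω, V x * pPow p (u x) * h x
      ≤ ∫ x in Ω, V x * |1 * u x + t * h x| ^ p := by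
  have i1 := S.integrableOn_potential hu
  have i2 := (S.integrableOn_potential_mul hu.continuous hh).const_mul (p * t)
  rw [← integral_const_mul, ← integral_add i1 i2]
  refine setIntegral_mono_on (i1.add i2) (S.integrableOn_potential (hu.lin hh 1 t))
    S.hΩ.measurableSet fun x hx => ?_
  have h1 := norm_rpow_add_inner_le S.hp (u x) (1 * u x + t * h x)
  have e : ⟪pPow p (u x), 1 * u x + t * h x - u x⟫ = t * (pPow p (u x) * h x) := by
    rw [show (1 * u x + t * h x - u x) = t * h x by ring, real_inner_comm]; simp; ring
  rw [e] at h1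
  simp only [Real.norm_eq_abs] at h1
  nlinarith [mul_le_mul_of_nonneg_left h1 (S.hV0 x hx)]

lemma pEnergy_expand (S : Admissible p q Ω V W f) {δ t : ℝ}
    (hδ : 0 ≤ δ) (ht : 0 < t) (hdt : ∀ a b : Euc N, ‖a + t • b‖ ^ p
      ≤ ‖a‖ ^ p + p * t * ⟪pPow p a, b⟫ + p * t * (δ * (‖a‖ + ‖b‖) ^ p))
    (hu : IsTestFun Ω u) (hh : IsTestFun Ω h) :
    pEnergy p Ω (fun x => 1 * u x + t * h x) ≤ pEnergy p Ω u
      + p * t * (∫ x in Ω, ⟪pPow p (gradient u x), gradient h x⟫)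
      + p * t * (δ * 2 ^ p * (pEnergy p Ω u + pEnergy p Ω h)) := by
  have hp0 : 0 < p := by linarith [S.hp]
  have i1 := hu.integrableOn_gradient_rpow hp0 Ω
  have i2 := hh.integrableOn_gradient_rpow hp0 Ω
  have i3 := hh.integrableOn_inner_pPow hu.1 S.hp Ω
  simp only [pEnergy]
  have i4 : IntegrableOn (fun x => ‖gradient u x‖ ^ p
      + p * t * ⟪pPow p (gradient u x), gradient h x⟫) Ω := i1.add (i3.const_mul _)
  have i5 : IntegrableOn (fun x => p * t * (δ * 2 ^ p * (‖gradient u x‖ ^ p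
      + ‖gradient h x‖ ^ p))) Ω := ((i1.add i2).const_mul _).const_mul _
  rw [← integral_add i1 i2, ← integral_const_mul, ← integral_const_mul, ← integral_const_mul,
    ← integral_add i1 (i3.const_mul _), ← integral_add i4 i5]
  refine setIntegral_mono_on ((hu.lin hh 1 t).integrableOn_gradient_rpow hp0 Ω) (i4.add i5)
    S.hΩ.measurableSet fun x _ => ?_
  rw [gradient_lin _ _ (hu.differentiable x) (hh.differentiable x), one_smul]
  refine (hdt _ _).trans (add_le_add le_rfl ?_)
  refine mul_le_mul_of_nonneg_left ?_ (by positivity)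
  rw [mul_assoc]
  exact mul_le_mul_of_nonneg_left (add_rpow_le_two_rpow_mul (norm_nonneg _) (norm_nonneg _)
    hp0.le) hδ

lemma integral_inner_le (S : Admissible p q Ω V W f) {l : ℝ} (hl : 0 < l)
    (hu : IsTestFun Ω u) (hh : IsTestFun Ω h) :
    ∫ x in Ω, ⟪pPow p (gradient u x), gradient h x⟫
      ≤ l * pEnergy p Ω u + l ^ (-(p - 1)) * pEnergy p Ω h := by
  have hp := S.hp
  have hp0 : 0 < p := by linarith
  have i1 := hu.integrableOn_gradient_rpow hp0 Ω
  have i2 := hh.integrableOn_gradient_rpow hp0 Ω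
  simp only [pEnergy]
  rw [← integral_const_mul, ← integral_const_mul, ← integral_add (i1.const_mul _) (i2.const_mul _)]
  refine setIntegral_mono_on (hh.integrableOn_inner_pPow hu.1 S.hp Ω)
    ((i1.const_mul _).add (i2.const_mul _)) S.hΩ.measurableSet fun x _ => ?_
  refine (real_inner_le_norm _ _).trans ?_
  rw [norm_pPow hp, mul_comm]
  have := young_param (norm_nonneg (gradient h x)) (norm_nonneg (gradient u x)) hl
    (α := p - 1) (s := p) (by linarith) (by linarith)
  simpa using this

/-- Existence of almost critical test functions, with a uniform bound on the form `Q_V`. -/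
lemma exists_almost_critical (S : Admissible p q Ω V W f) :
    ∃ M : ℝ, ∀ ε > 0, ∃ u, IsTestFun Ω u ∧ QV p Ω V u ≤ M ∧
    ∀ h, IsTestFun Ω h → |resid p Ω V f u h| ≤ ε * (1 + pEnergy p Ω h) := by
  have hp := S.hp
  have hp0 : 0 < p := by linarith
  obtain ⟨C, hC0, hC⟩ := S.exists_abs_f_le (l := 1 / (2 * p)) (by positivity)
  refine ⟨2 * p * (1 + C), fun ε hε => ?_⟩
  set M := p * (1 + C) with hM
  have hMpos : 0 < M := by positivity
  set l := ε / (4 * M) with hl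
  have hlpos : 0 < l := by positivity
  have hlM : l * M = ε / 4 := by rw [hl]; field_simp
  set e := min 1 (ε / (4 * l ^ (-(p - 1)))) with he
  have hepos : 0 < e := lt_min one_pos (by positivity)
  have he1 : e ≤ 1 := min_le_left _ _
  have hel : e * l ^ (-(p - 1)) ≤ ε / 4 := by
    have h1 : e ≤ ε / (4 * l ^ (-(p - 1))) := min_le_right _ _
    rw [le_div_iff₀ (by positivity)] at h1
    linarith
  set δ := ε / (8 * 2 ^ p * (M / e + 1)) with hδ
  have hδpos : 0 < δ := by positivity
  have hδe : 2 * (δ * 2 ^ p) * (M / e + 1) = ε / 4 := by rw [hδ]; field_simp; ring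
  obtain ⟨t, ht, ht1, hdt⟩ := exists_norm_rpow_add_le (H := Euc N) hp hδpos
  let J : (Euc N → ℝ) → ℝ := fun u => (QV p Ω V u + e * pEnergy p Ω u) / p - f u
  have hJ : ∀ u, IsTestFun Ω u →
      QV p Ω V u / (2 * p) + e * pEnergy p Ω u / p - C ≤ J u := fun u hu => by
    have h1 := (abs_le.1 (hC u hu)).2
    have h2 : QV p Ω V u / p = 2 * (QV p Ω V u / (2 * p)) := by field_simp
    have h3 : 1 / (2 * p) * QV p Ω V u = QV p Ω V u / (2 * p) := by ring
    simp only [J, add_div]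
    linarith
  have hJlow : ∀ u, IsTestFun Ω u → -C ≤ J u := fun u hu => by
    have h1 := hJ u hu
    have h2 : 0 ≤ QV p Ω V u / (2 * p) := div_nonneg (S.QV_nonneg hu) (by positivity)
    have h3 : 0 ≤ e * pEnergy p Ω u / p := div_nonneg (mul_nonneg hepos.le pEnergy_nonneg) hp0.le
    linarith
  let T : Set ℝ := J '' {u | IsTestFun Ω u}
  have hTb : BddBelow T := ⟨-C, by rintro _ ⟨u, hu, rfl⟩; exact hJlow u hu⟩
  have hJ0 : J (fun _ => 0) ≤ 0 := by
    have hf0 : f (fun _ : Euc N => (0 : ℝ)) = 0 := by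
      have := S.hlin 0 0 (fun _ => 0) (fun _ => 0) IsTestFun.zero IsTestFun.zero
      simpa using this
    have hg0 : ∀ x, gradient (fun _ : Euc N => (0 : ℝ)) x = 0 := fun x =>
      gradient_eq_zero_of_notMem (by
        have : tsupport (fun _ : Euc N => (0 : ℝ)) = ∅ := tsupport_eq_empty_iff.2 rfl
        simp [this])
    have hE0 : pEnergy p Ω (fun _ : Euc N => (0 : ℝ)) = 0 := by
      simp [pEnergy, hg0, zero_rpow hp0.ne']
    have hQ0 : QV p Ω V (fun _ : Euc N => (0 : ℝ)) ≤ 0 := S.QV_le_pEnergy.trans_eq hE0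
    simp only [J, hf0, hE0, mul_zero, add_zero, sub_zero]
    exact div_nonpos_of_nonpos_of_nonneg hQ0 hp0.le
  have hTne : T.Nonempty := ⟨_, _, IsTestFun.zero, rfl⟩
  have hτ : 0 < min 1 (t * (ε / 4)) := lt_min one_pos (by positivity)
  obtain ⟨_, ⟨u, hu, rfl⟩, hlt⟩ := exists_lt_of_csInf_lt hTne (lt_add_of_pos_right (sInf T) hτ)
  have hinf0 : sInf T ≤ 0 := (csInf_le hTb ⟨_, IsTestFun.zero, rfl⟩).trans hJ0
  have hJu : J u ≤ 1 := by linarith [min_le_left 1 (t * (ε / 4))]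
  have hmin : ∀ w, IsTestFun Ω w → J u - t * (ε / 4) ≤ J w := fun w hw => by
    have := csInf_le hTb ⟨w, hw, rfl⟩
    linarith [min_le_right 1 (t * (ε / 4))]
  have hEu : pEnergy p Ω u ≤ M / e := by
    have h1 := hJ u hu
    have h2 : 0 ≤ QV p Ω V u / (2 * p) := div_nonneg (S.QV_nonneg hu) (by positivity)
    have h3 : e * pEnergy p Ω u / p ≤ 1 + C := by linarith
    rw [div_le_iff₀ hp0] at h3
    rw [le_div_iff₀ hepos]
    linarith
  have hQu : QV p Ω V u ≤ 2 * p * (1 + C) := by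
    have h1 := hJ u hu
    have h2 : 0 ≤ e * pEnergy p Ω u / p := div_nonneg (mul_nonneg hepos.le pEnergy_nonneg) hp0.le
    have h3 : QV p Ω V u / (2 * p) ≤ 1 + C := by linarith
    rw [div_le_iff₀ (by positivity)] at h3
    linarith
  have main : ∀ h, IsTestFun Ω h → -resid p Ω V f u h ≤ ε * (1 + pEnergy p Ω h) := by
    intro h hh
    have h1 := hmin _ (hu.lin hh 1 t)
    have h2 := S.pEnergy_expand hδpos.le ht hdt hu hh
    have h3 := S.potential_convex hu hh t
    have h4 := S.hlin 1 t u h hu hh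
    have h5 := S.integral_inner_le hlpos hu hh
    have hEh : 0 ≤ pEnergy p Ω h := pEnergy_nonneg
    have hEu0 : 0 ≤ pEnergy p Ω u := pEnergy_nonneg
    set I := ∫ x in Ω, ⟪pPow p (gradient u x), gradient h x⟫ with hI
    set P := ∫ x in Ω, V x * pPow p (u x) * h x with hP
    have hJexp : ∀ w, p * J w
        = (1 + e) * pEnergy p Ω w - (∫ x in Ω, V x * |w x| ^ p) - p * f w := fun w => by
      simp only [J, QV]
      change p * ((pEnergy p Ω w - _ + _) / p - _) = _
      field_simp
      ring
    have h6 := mul_le_mul_of_nonneg_left h1 hp0.le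
    rw [mul_sub, hJexp, hJexp, h4] at h6
    exact almost_critical_arith hp0 ht hepos he1 hlpos hε.le hδe hlM hel hEu hEu0 hEh h6 h2 h3 h5
  refine ⟨u, hu, hQu, fun h hh => abs_le.2 ⟨by linarith [main h hh], ?_⟩⟩
  have := main _ (hh.lin hh (-1) 0)
  rwa [S.resid_neg hh, pEnergy_neg hh, neg_neg] at this

end Admissible

end Critical

section Truncation

/-- A smooth bounded truncation of the identity at height `δ`. -/
def trunc (δ s : ℝ) : ℝ := δ * arctan (s / δ)

/-- The derivative of `trunc`. -/
def truncDeriv (δ s : ℝ) : ℝ := 1 / (1 + (s / δ) ^ 2)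

variable {δ : ℝ}

lemma contDiff_trunc : ContDiff ℝ (⊤ : ℕ∞) (trunc δ) :=
  contDiff_const.mul (Real.contDiff_arctan.comp (contDiff_id.div_const δ))

lemma hasDerivAt_trunc (hδ : 0 < δ) (s : ℝ) : HasDerivAt (trunc δ) (truncDeriv δ s) s := by
  have h := (((hasDerivAt_id s).div_const δ).arctan).const_mul δ
  refine h.congr_deriv ?_
  simp only [truncDeriv, id]
  field_simp

lemma abs_trunc_le (hδ : 0 < δ) (s : ℝ) : |trunc δ s| ≤ 2 * δ := by
  have h1 := arctan_lt_pi_div_two (s / δ)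
  have h2 := neg_pi_div_two_lt_arctan (s / δ)
  have h3 := pi_le_four
  have h4 : |arctan (s / δ)| ≤ 2 := abs_le.2 ⟨by linarith, by linarith⟩
  rw [trunc, abs_mul, abs_of_pos hδ]
  nlinarith

lemma truncDeriv_pos (s : ℝ) : 0 < truncDeriv δ s := by unfold truncDeriv; positivity

lemma truncDeriv_le_one (s : ℝ) : truncDeriv δ s ≤ 1 := by
  rw [truncDeriv, div_le_one (by positivity)]
  linarith [sq_nonneg (s / δ)]

lemma half_le_truncDeriv (hδ : 0 < δ) {s : ℝ} (hs : |s| ≤ δ) : 1 / 2 ≤ truncDeriv δ s := by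
  have h1 : (s / δ) ^ 2 ≤ 1 := by
    rw [sq_le_one_iff_abs_le_one, abs_div, abs_of_pos hδ]
    exact (div_le_one hδ).2 hs
  exact one_div_le_one_div_of_le (by positivity) (by linarith)

lemma continuous_truncDeriv : Continuous (truncDeriv δ) := by
  unfold truncDeriv
  exact continuous_const.div (by fun_prop) fun s => by positivity

lemma exists_real_cutoff {L : ℝ} (hL : 0 < L) :
    ∃ (s s' : ℝ → ℝ) (D : ℝ), ContDiff ℝ (⊤ : ℕ∞) s ∧ Continuous s' ∧
      (∀ t, HasDerivAt s (s' t) t) ∧ (∀ t, 0 ≤ s t) ∧ (∀ t, s t ≤ 1) ∧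
      (∀ t, |t| ≤ L → s t = 1) ∧ (∀ t, 2 * L < |t| → s t = 0 ∧ s' t = 0) ∧ ∀ t, |s' t| ≤ D := by
  let b : ContDiffBump (0 : ℝ) := ⟨L, 2 * L, hL, by linarith⟩
  have hb : ContDiff ℝ (⊤ : ℕ∞) b := b.contDiff
  have hd : Continuous (deriv b) := hb.continuous_deriv (by simp)
  have hts : ∀ t : ℝ, 2 * L < |t| → t ∉ tsupport b := fun t ht => by
    rw [b.tsupport_eq]
    simpa [b] using ht
  obtain ⟨D, hD⟩ := b.hasCompactSupport.deriv.exists_bound_of_continuous hd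
  refine ⟨b, deriv b, D, hb, hd, fun t => (hb.differentiable (by simp) t).hasDerivAt,
    fun t => b.nonneg, fun t => b.le_one, fun t ht => ?_, fun t ht => ⟨?_, ?_⟩, hD⟩
  · exact b.one_of_mem_closedBall (by simpa [b] using ht)
  · exact image_eq_zero_of_notMem_tsupport (hts t ht)
  · exact image_eq_zero_of_notMem_tsupport fun h => hts t ht (tsupport_deriv_subset h)

end Truncation

section TruncatedEnergy

variable {N : ℕ} {Ω : Set (Euc N)} {p q : ℝ} {V W : Euc N → ℝ} {f : (Euc N → ℝ) → ℝ}
  {u h : Euc N → ℝ}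

lemma IsTestFun.exists_norm_gradient_le {η : Euc N → ℝ} (hη : IsTestFun Ω η) :
    ∃ D : ℝ, 1 ≤ D ∧ ∀ x, ‖gradient η x‖ ≤ D := by
  obtain ⟨A, hA⟩ := (HasCompactSupport.intro hη.2.1 fun x hx =>
    gradient_eq_zero_of_notMem hx : HasCompactSupport (gradient η)).exists_bound_of_continuous
    hη.continuous_gradient
  exact ⟨max 1 A, le_max_left _ _, fun x => (hA x).trans (le_max_right _ _)⟩

lemma resid_eq_setIntegral {K : Set (Euc N)} (hKΩ : K ⊆ Ω) (hK : tsupport h ⊆ K) :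
    resid p Ω V f u h = (∫ x in K, ⟪pPow p (gradient u x), gradient h x⟫)
      - (∫ x in K, V x * pPow p (u x) * h x) - f h := by
  rw [resid, setIntegral_eq_of_eq_zero hKΩ fun x hx => ?_, setIntegral_eq_of_eq_zero hKΩ
    fun x hx => ?_]
  · rw [image_eq_zero_of_notMem_tsupport fun h' => hx (hK h'), mul_zero]
  · rw [gradient_eq_zero_of_notMem fun h' => hx (hK h'), inner_zero_right]

lemma pEnergy_eq_setIntegral {K : Set (Euc N)} (hp : 0 < p) (hKΩ : K ⊆ Ω) (hK : tsupport h ⊆ K) :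
    pEnergy p Ω h = ∫ x in K, ‖gradient h x‖ ^ p :=
  setIntegral_eq_of_eq_zero hKΩ fun x hx => by
    rw [gradient_eq_zero_of_notMem fun h' => hx (hK h'), norm_zero, zero_rpow hp.ne']

namespace Admissible

lemma exists_potential_integral_bound (S : Admissible p q Ω V W f) {K : Set (Euc N)}
    (hK : IsCompact K) (hKΩ : K ⊆ Ω) (M : ℝ) :
    ∃ C : ℝ, ∀ u, IsTestFun Ω u → wEnergy q Ω W u ≤ M → ∫ x in K, V x * |u x| ^ (p - 1) ≤ C := by
  obtain ⟨y, B, hy, hy0, hB, hH⟩ := S.hVB K hK hKΩ M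
  obtain ⟨H, hHi, hH⟩ := hH 1 one_pos
  refine ⟨B + ∫ x in K, H x, fun u hu hM => ?_⟩
  have i1 : IntegrableOn (fun x => y (u x)) K :=
    (hy.comp hu.continuous).continuousOn.integrableOn_compact hK
  have i2 : IntegrableOn (fun x => V x * |u x| ^ (p - 1)) K :=
    (S.hVi K hK hKΩ).mul_continuousOn (continuous_rpow_norm hu.continuous
      (by linarith [S.hp])).continuousOn hK
  calc ∫ x in K, V x * |u x| ^ (p - 1) ≤ ∫ x in K, (y (u x) + H x) :=
        setIntegral_mono_on i2 (i1.add hHi) hK.measurableSet fun x hx => by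
          simpa using hH u hu hM x hx
    _ = (∫ x in K, y (u x)) + ∫ x in K, H x := integral_add i1 hHi
    _ ≤ _ := by linarith [hB u hu hM]

lemma exists_gradient_integral_bound (S : Admissible p q Ω V W f) {K : Set (Euc N)}
    (hK : IsCompact K) (hKΩ : K ⊆ Ω) (M : ℝ) :
    ∃ C : ℝ, ∀ u, IsTestFun Ω u → wEnergy q Ω W u ≤ M → ∫ x in K, ‖gradient u x‖ ^ (p - 1) ≤ C := by
  obtain ⟨B, hB⟩ := exists_local_energy_bound S.hΩ (by linarith [S.hq1]) S.hWc S.hWpos hK hKΩ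
    (q := q) M
  refine ⟨volume.real K + B, fun u hu hM => ?_⟩
  have i0 : IntegrableOn (fun _ : Euc N => (1 : ℝ)) K := integrableOn_const hK.measure_lt_top.ne
  have i1 : IntegrableOn (fun x => ‖gradient u x‖ ^ q + |u x| ^ q) K :=
    ((continuous_rpow_norm hu.continuous_gradient (by linarith [S.hq1])).add
      (continuous_rpow_norm hu.continuous
        (by linarith [S.hq1]))).continuousOn.integrableOn_compact hK
  have i2 := hu.integrableOn_gradient_rpow (s := p - 1) (by linarith [S.hp]) K
  calc ∫ x in K, ‖gradient u x‖ ^ (p - 1)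
      ≤ ∫ x in K, (1 + (‖gradient u x‖ ^ q + |u x| ^ q)) :=
        setIntegral_mono_on i2 (i0.add i1) hK.measurableSet fun x hx => by
          have h1 := rpow_le_one_add_rpow (norm_nonneg (gradient u x))
            (by linarith [S.hp] : 0 ≤ p - 1) S.hpq.le
          have h2 : 0 ≤ |u x| ^ q := by positivity
          linarith
    _ = volume.real K + ∫ x in K, (‖gradient u x‖ ^ q + |u x| ^ q) := by
        rw [integral_add i0 i1, setIntegral_const, smul_eq_mul, mul_one]
    _ ≤ _ := by linarith [hB u hu hM]

/-- The energy of an almost critical test function is locally bounded where the function is. -/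
lemma exists_truncated_energy_bound (S : Admissible p q Ω V W f) {K : Set (Euc N)}
    (hK : IsCompact K) (hKΩ : K ⊆ Ω) (M : ℝ) {L : ℝ} (hL : 0 < L) :
    ∃ (C ε₀ : ℝ), 0 < ε₀ ∧ ∀ u, IsTestFun Ω u → wEnergy q Ω W u ≤ M →
      (∀ h, IsTestFun Ω h → |resid p Ω V f u h| ≤ ε₀ * (1 + pEnergy p Ω h)) →
      ∫ x in K, truncDeriv L (u x) * ‖gradient u x‖ ^ p ≤ C := by
  have hp := S.hp
  have hp0 : 0 < p := by linarith
  obtain ⟨η, hη, hη0, hη1, hηK⟩ := exists_cutoff S.hΩ hK hKΩ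
  obtain ⟨D, hD1, hD⟩ := hη.exists_norm_gradient_le
  set K' := tsupport η with hK'def
  have hK' : IsCompact K' := hη.isCompact
  have hK'Ω : K' ⊆ Ω := hη.2.2
  have hKK' : K ⊆ K' := fun x hx => subset_tsupport η (by simp [hηK x hx])
  obtain ⟨C1, hC1⟩ := S.exists_gradient_integral_bound hK' hK'Ω M
  obtain ⟨C2, hC2⟩ := S.exists_potential_integral_bound hK' hK'Ω M
  set ε := 1 / (4 * (2 : ℝ) ^ p) with hε
  have hεpos : 0 < ε := by positivity
  have hε2 : ε * 2 ^ p = 1 / 4 := by rw [hε]; field_simp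
  obtain ⟨C3, hC30, hC3⟩ := S.exists_abs_f_le hεpos
  set C4 := (2 * L * D) ^ p * volume.real K' with hC4
  refine ⟨2 * (2 * L * D * C1 + 2 * L * C2 + C3 + ε + C4 / 2), ε, hεpos, fun u hu hM hcrit => ?_⟩
  set h : Euc N → ℝ := fun x => η x * trunc L (u x) with hh
  have hTu : ContDiff ℝ (⊤ : ℕ∞) fun x => trunc L (u x) := contDiff_trunc.comp hu.1
  have hht : IsTestFun Ω h := hη.mul_contDiff hTu
  have hhK : tsupport h ⊆ K' := tsupport_mul_subset_left
  have hgrad : ∀ x, gradient h x = (η x * truncDeriv L (u x)) • gradient u x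
      + trunc L (u x) • gradient η x := fun x => by
    rw [hh, gradient_mul' (hη.differentiable x) ((hTu.differentiable (by simp)) x),
      gradient_scomp (hasDerivAt_trunc hL (u x)) (hu.differentiable x), smul_smul]
  have hcu := hu.continuous
  have hcg := hu.continuous_gradient
  have hcη := hη.continuous
  have hcgη := hη.continuous_gradient
  have hcT : Continuous fun x => trunc L (u x) := hTu.continuous
  have hcT' : Continuous fun x => truncDeriv L (u x) := continuous_truncDeriv.comp hcu
  have hcp : Continuous fun x => ‖gradient u x‖ ^ p := continuous_rpow_norm hcg hp0.le
  have hcA : Continuous fun x => η x * truncDeriv L (u x) * ‖gradient u x‖ ^ p :=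
    (hcη.mul hcT').mul hcp
  have iA : IntegrableOn (fun x => η x * truncDeriv L (u x) * ‖gradient u x‖ ^ p) K' :=
    hcA.continuousOn.integrableOn_compact hK'
  have ig : IntegrableOn (fun x => ‖gradient u x‖ ^ (p - 1)) K' :=
    hu.integrableOn_gradient_rpow (by linarith) K'
  have iV : IntegrableOn (fun x => V x * |u x| ^ (p - 1)) K' :=
    (S.hVi K' hK' hK'Ω).mul_continuousOn (continuous_rpow_norm hcu (by linarith)).continuousOn hK'
  have iVh : IntegrableOn (fun x => V x * pPow p (u x) * h x) K' :=
    (S.integrableOn_potential_mul hcu hht).mono_set hK'Ω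
  set A := ∫ x in K', η x * truncDeriv L (u x) * ‖gradient u x‖ ^ p with hA
  -- the three parts of the residual
  have b1 : A - 2 * L * D * C1 ≤ ∫ x in K', ⟪pPow p (gradient u x), gradient h x⟫ := by
    have : A - 2 * L * D * ∫ x in K', ‖gradient u x‖ ^ (p - 1)
        ≤ ∫ x in K', ⟪pPow p (gradient u x), gradient h x⟫ := by
      rw [← integral_const_mul, hA, ← integral_sub iA (ig.const_mul _)]
      refine setIntegral_mono_on (iA.sub (ig.const_mul _)) (hht.integrableOn_inner_pPow hu.1 hp K')
        hK'.measurableSet fun x _ => ?_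
      rw [hgrad, inner_add_right, inner_smul_right, inner_smul_right, inner_pPow_self hp]
      have e1 : |trunc L (u x) * ⟪pPow p (gradient u x), gradient η x⟫|
          ≤ 2 * L * (‖gradient u x‖ ^ (p - 1) * D) := by
        rw [abs_mul]
        refine mul_le_mul (abs_trunc_le hL _) ?_ (abs_nonneg _) (by positivity)
        refine (abs_real_inner_le_norm _ _).trans ?_
        rw [norm_pPow hp]
        exact mul_le_mul_of_nonneg_left (hD x) (by positivity)
      linarith [(abs_le.1 e1).1]
    have h2 := mul_le_mul_of_nonneg_left (hC1 u hu hM) (by positivity : 0 ≤ 2 * L * D)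
    linarith
  have b2 : ∫ x in K', V x * pPow p (u x) * h x ≤ 2 * L * C2 := by
    refine le_trans ?_ (mul_le_mul_of_nonneg_left (hC2 u hu hM) (by positivity))
    rw [← integral_const_mul]
    refine setIntegral_mono_on iVh (iV.const_mul _) hK'.measurableSet fun x hx => ?_
    have e1 : pPow p (u x) * h x ≤ |u x| ^ (p - 1) * (2 * L) := by
      refine (le_abs_self _).trans ?_
      rw [abs_mul]
      refine mul_le_mul (norm_pPow hp (u x)).le ?_ (abs_nonneg _) (by positivity)
      rw [hh, abs_mul, abs_of_nonneg (hη0 x)]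
      exact (mul_le_of_le_one_left (abs_nonneg _) (hη1 x)).trans (abs_trunc_le hL _)
    have := mul_le_mul_of_nonneg_left e1 (S.hV0 x (hK'Ω hx))
    linarith
  have b3 : pEnergy p Ω h ≤ 2 ^ p * (A + C4) := by
    have i0 : IntegrableOn (fun _ : Euc N => (2 * L * D) ^ p) K' :=
      integrableOn_const hK'.measure_lt_top.ne
    have e0 : 2 ^ p * (A + C4) = ∫ x in K', 2 ^ p * (η x * truncDeriv L (u x) * ‖gradient u x‖ ^ p
        + (2 * L * D) ^ p) := by
      rw [integral_const_mul, integral_add iA i0, setIntegral_const, smul_eq_mul, hC4]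
      ring
    rw [pEnergy_eq_setIntegral hp0 hK'Ω hhK, e0]
    refine setIntegral_mono_on (hht.integrableOn_gradient_rpow hp0 K') ((iA.add i0).const_mul _)
      hK'.measurableSet fun x _ => ?_
    set a := η x * truncDeriv L (u x) with ha
    have ha0 : 0 ≤ a := mul_nonneg (hη0 x) (truncDeriv_pos _).le
    have ha1 : a ≤ 1 := mul_le_one₀ (hη1 x) (truncDeriv_pos _).le (truncDeriv_le_one _)
    have e1 : ‖gradient h x‖ ≤ a * ‖gradient u x‖ + 2 * L * D := by
      rw [hgrad]
      refine (norm_add_le _ _).trans ?_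
      rw [norm_smul, norm_smul, Real.norm_eq_abs, abs_of_nonneg ha0, Real.norm_eq_abs]
      exact add_le_add le_rfl (mul_le_mul (abs_trunc_le hL _) (hD x) (norm_nonneg _)
        (by positivity))
    refine (rpow_le_rpow (norm_nonneg _) e1 hp0.le).trans
      ((add_rpow_le_two_rpow_mul (by positivity) (by positivity) hp0.le).trans ?_)
    refine mul_le_mul_of_nonneg_left (add_le_add ?_ le_rfl) (by positivity)
    rw [mul_rpow ha0 (norm_nonneg _)]
    refine mul_le_mul_of_nonneg_right ?_ (by positivity)
    calc a ^ p ≤ a ^ (1 : ℝ) := rpow_le_rpow_of_exponent_ge' ha0 ha1 zero_le_one hp.le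
      _ = a := rpow_one a
  have b4 := (abs_le.1 (hcrit h hht)).2
  have b5 := (abs_le.1 (hC3 h hht)).2
  have b6 : ε * QV p Ω V h ≤ ε * pEnergy p Ω h :=
    mul_le_mul_of_nonneg_left S.QV_le_pEnergy hεpos.le
  have b7 : ε * pEnergy p Ω h ≤ (A + C4) / 4 := by
    have := mul_le_mul_of_nonneg_left b3 hεpos.le
    rw [← mul_assoc, hε2] at this
    linarith
  rw [resid_eq_setIntegral hK'Ω hhK] at b4
  have b8 : ∫ x in K, truncDeriv L (u x) * ‖gradient u x‖ ^ p ≤ A := by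
    calc ∫ x in K, truncDeriv L (u x) * ‖gradient u x‖ ^ p
        = ∫ x in K, η x * truncDeriv L (u x) * ‖gradient u x‖ ^ p :=
          setIntegral_congr_fun hK.measurableSet fun x hx => by simp [hηK x hx]
      _ ≤ A := setIntegral_mono_set iA (ae_of_all _ fun x =>
          mul_nonneg (mul_nonneg (hη0 x) (truncDeriv_pos _).le) (by positivity)) hKK'.eventuallyLE
  linarith

end Admissible

end TruncatedEnergy

section GradientGap

variable {p : ℝ}

lemma one_add_add_rpow_le (hp : 0 ≤ p) {a b : ℝ} (ha : 0 ≤ a) (hb : 0 ≤ b) :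
    (1 + a + b) ^ p ≤ 4 ^ p * (1 + a ^ p + b ^ p) := by
  have h1 := add_rpow_le_two_rpow_mul (by positivity : 0 ≤ 1 + a) hb hp
  have h2 := add_rpow_le_two_rpow_mul zero_le_one ha hp
  rw [one_rpow] at h2
  have h3 : (4 : ℝ) ^ p = 2 ^ p * 2 ^ p := by
    rw [← mul_rpow (by norm_num) (by norm_num)]; norm_num
  have h4 : (1 : ℝ) ≤ 2 ^ p := one_le_rpow (by norm_num) hp
  have h5 : b ^ p ≤ 2 ^ p * b ^ p := le_mul_of_one_le_left (by positivity) h4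
  rw [h3, mul_assoc]
  refine h1.trans (mul_le_mul_of_nonneg_left ?_ (by positivity))
  linarith

lemma one_add_add_rpow_le_of_half_le (hp : 0 ≤ p) {a b α β : ℝ} (ha : 0 ≤ a) (hb : 0 ≤ b)
    (hα : 1 / 2 ≤ α) (hβ : 1 / 2 ≤ β) :
    (1 + a + b) ^ p ≤ 4 ^ p * 2 * (1 + α * a ^ p + β * b ^ p) := by
  refine (one_add_add_rpow_le hp ha hb).trans ?_
  rw [mul_assoc]
  refine mul_le_mul_of_nonneg_left ?_ (by positivity)
  have h1 := mul_le_mul_of_nonneg_right hα (by positivity : 0 ≤ a ^ p)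
  have h2 := mul_le_mul_of_nonneg_right hβ (by positivity : 0 ≤ b ^ p)
  linarith

variable {H : Type*} [NormedAddCommGroup H] [InnerProductSpace ℝ H]

lemma abs_inner_pPow_sub_le (hp : 1 < p) {D : ℝ} {a b R : H}
    (hR : ‖R‖ ≤ D * (1 + ‖a‖ + ‖b‖)) :
    |⟪pPow p a - pPow p b, R⟫| ≤ 2 * D * (1 + ‖a‖ + ‖b‖) ^ p := by
  have h0 : 0 < 1 + ‖a‖ + ‖b‖ := by positivity
  have hp1 : 0 ≤ p - 1 := by linarith
  have ha : ‖a‖ ^ (p - 1) ≤ (1 + ‖a‖ + ‖b‖) ^ (p - 1) :=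
    rpow_le_rpow (norm_nonneg _) (by linarith [norm_nonneg b]) hp1
  have hb : ‖b‖ ^ (p - 1) ≤ (1 + ‖a‖ + ‖b‖) ^ (p - 1) :=
    rpow_le_rpow (norm_nonneg _) (by linarith [norm_nonneg a]) hp1
  have h1 : ‖pPow p a - pPow p b‖ ≤ 2 * (1 + ‖a‖ + ‖b‖) ^ (p - 1) := by
    refine (norm_sub_le _ _).trans ?_
    rw [norm_pPow hp, norm_pPow hp]
    linarith
  have h2 : (1 + ‖a‖ + ‖b‖) ^ p = (1 + ‖a‖ + ‖b‖) ^ (p - 1) * (1 + ‖a‖ + ‖b‖) := by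
    rw [← rpow_add_one h0.ne']; ring_nf
  calc |⟪pPow p a - pPow p b, R⟫| ≤ ‖pPow p a - pPow p b‖ * ‖R‖ := abs_real_inner_le_norm _ _
    _ ≤ (2 * (1 + ‖a‖ + ‖b‖) ^ (p - 1)) * (D * (1 + ‖a‖ + ‖b‖)) :=
        mul_le_mul h1 hR (norm_nonneg _) (by positivity)
    _ = _ := by rw [h2]; ring

end GradientGap

section GradientGap

variable {N : ℕ} {Ω : Set (Euc N)} {p q : ℝ} {V W : Euc N → ℝ} {f : (Euc N → ℝ) → ℝ}

lemma IsTestFun.integrableOn_gap_inner {h u w : Euc N → ℝ} (hh : IsTestFun Ω h)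
    (hu : IsTestFun Ω u) (hw : IsTestFun Ω w) (hp : 1 < p) (K : Set (Euc N)) :
    IntegrableOn (fun x => ⟪pPow p (gradient u x) - pPow p (gradient w x), gradient h x⟫) K := by
  simp only [inner_sub_left]
  exact (hh.integrableOn_inner_pPow hu.1 hp K).sub (hh.integrableOn_inner_pPow hw.1 hp K)

lemma continuous_gap {u w : Euc N → ℝ} (hp : 1 < p) (hu : IsTestFun Ω u) (hw : IsTestFun Ω w) :
    Continuous fun x =>
      ⟪pPow p (gradient u x) - pPow p (gradient w x), gradient u x - gradient w x⟫ :=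
  (((continuous_pPow hp).comp hu.continuous_gradient).sub
    ((continuous_pPow hp).comp hw.continuous_gradient)).inner
      (hu.continuous_gradient.sub hw.continuous_gradient)

namespace Admissible

/-- The monotonicity gap of two almost critical test functions is small where both functions
are bounded and close to each other. -/
lemma exists_gradient_gap_bound (S : Admissible p q Ω V W f) {η : Euc N → ℝ} (hη : IsTestFun Ω η)
    (hη0 : ∀ x, 0 ≤ η x) (hη1 : ∀ x, η x ≤ 1) (M : ℝ) {L D₀ : ℝ} (hL : 0 < L) {s s' : ℝ → ℝ}
    (hs : ContDiff ℝ (⊤ : ℕ∞) s) (hs' : ∀ t, HasDerivAt s (s' t) t) (hs0 : ∀ t, 0 ≤ s t)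
    (hs1 : ∀ t, s t ≤ 1) (hsL : ∀ t, 2 * L < |t| → s t = 0 ∧ s' t = 0) (hsD : ∀ t, |s' t| ≤ D₀) :
    ∃ (C ε₀ : ℝ), 0 < ε₀ ∧ ∀ δ, 0 < δ → δ ≤ 1 → ∀ ε, 0 ≤ ε → ε ≤ ε₀ → ∀ u w,
      IsTestFun Ω u → IsTestFun Ω w → wEnergy q Ω W u ≤ M → wEnergy q Ω W w ≤ M →
      (∀ h, IsTestFun Ω h → |resid p Ω V f u h| ≤ ε * (1 + pEnergy p Ω h)) →
      (∀ h, IsTestFun Ω h → |resid p Ω V f w h| ≤ ε * (1 + pEnergy p Ω h)) →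
      ∫ x in tsupport η, η x * (s (u x) * (s (w x) * truncDeriv δ (u x - w x))) *
        ⟪pPow p (gradient u x) - pPow p (gradient w x), gradient u x - gradient w x⟫
          ≤ C * (ε + δ) := by
  have hp := S.hp
  have hp0 : 0 < p := by linarith
  obtain ⟨D₁, hD₁1, hD₁⟩ := hη.exists_norm_gradient_le
  obtain ⟨D, hD1, hD, hD'⟩ : ∃ D : ℝ, 1 ≤ D ∧ (∀ x, ‖gradient η x‖ ≤ D) ∧ ∀ t, |s' t| ≤ D :=
    ⟨max D₁ D₀, hD₁1.trans (le_max_left _ _), fun x => (hD₁ x).trans (le_max_left _ _),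
      fun t => (hsD t).trans (le_max_right _ _)⟩
  set K := tsupport η with hKdef
  have hK : IsCompact K := hη.isCompact
  have hKΩ : K ⊆ Ω := hη.2.2
  obtain ⟨C₁, ε₀, hε₀, hC₁⟩ := S.exists_truncated_energy_bound hK hKΩ M
    (by linarith : 0 < 2 * L)
  obtain ⟨C₂, hC₂⟩ := S.exists_potential_integral_bound hK hKΩ M
  set B := volume.real K + 2 * |C₁| with hB
  have hB0 : 0 ≤ B := by positivity
  set E : ℝ := 4 ^ p * 2 with hE
  have hE0 : 0 < E := by positivity
  refine ⟨2 * (1 + (3 * D) ^ p * E * B) + 4 * D * E * B + 4 * |C₂|, ε₀, hε₀,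
    fun δ hδ hδ1 ε hε hεε₀ u w hu hw hMu hMw hru hrw => ?_⟩
  have weaken : ∀ z, (∀ h, IsTestFun Ω h → |resid p Ω V f z h| ≤ ε * (1 + pEnergy p Ω h)) →
      ∀ h, IsTestFun Ω h → |resid p Ω V f z h| ≤ ε₀ * (1 + pEnergy p Ω h) := fun z hz h hh =>
    (hz h hh).trans (mul_le_mul_of_nonneg_right hεε₀
      (by linarith [pEnergy_nonneg (p := p) (Ω := Ω) (u := h)]))
  have hEu := hC₁ u hu hMu (weaken u hru)
  have hEw := hC₁ w hw hMw (weaken w hrw)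
  have hcu := hu.continuous
  have hcw := hw.continuous
  set h : Euc N → ℝ := fun x => η x * (s (u x) * (s (w x) * trunc δ (u x - w x))) with hh
  have csu : ContDiff ℝ (⊤ : ℕ∞) fun x => s (u x) := hs.comp hu.1
  have csw : ContDiff ℝ (⊤ : ℕ∞) fun x => s (w x) := hs.comp hw.1
  have cT : ContDiff ℝ (⊤ : ℕ∞) fun x => trunc δ (u x - w x) := contDiff_trunc.comp (hu.1.sub hw.1)
  have hht : IsTestFun Ω h := hη.mul_contDiff (csu.mul (csw.mul cT))
  have hhK : tsupport h ⊆ K := tsupport_mul_subset_left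
  set R : Euc N → Euc N := fun x => (s (u x) * s (w x)) • gradient η x
    + (η x * (s' (u x) * s (w x))) • gradient u x
    + (η x * (s (u x) * s' (w x))) • gradient w x with hR
  set c : Euc N → ℝ := fun x => η x * (s (u x) * (s (w x) * truncDeriv δ (u x - w x))) with hc
  have hgrad : ∀ x, gradient h x = c x • (gradient u x - gradient w x)
      + trunc δ (u x - w x) • R x := fun x => by
    have d1 := csu.differentiable (by simp) x
    have d2 := csw.differentiable (by simp) x
    have d3 := cT.differentiable (by simp) x
    have g3 : gradient (fun y => trunc δ (u y - w y)) x
        = truncDeriv δ (u x - w x) • (gradient u x - gradient w x) := by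
      rw [gradient_scomp (u := fun y => u y - w y) (hasDerivAt_trunc hδ _)
        ((hu.differentiable x).sub (hw.differentiable x)),
        gradient_sub' (hu.differentiable x) (hw.differentiable x)]
    rw [hh, gradient_mul' (hη.differentiable x) (d1.fun_mul (d2.fun_mul d3)),
      gradient_mul' d1 (d2.fun_mul d3), gradient_mul' d2 d3, g3,
      gradient_scomp (hs' (u x)) (hu.differentiable x),
      gradient_scomp (hs' (w x)) (hw.differentiable x)]
    simp only [hR, hc]
    module
  have hc0 : ∀ x, 0 ≤ c x := fun x =>
    mul_nonneg (hη0 x) (mul_nonneg (hs0 _) (mul_nonneg (hs0 _) (truncDeriv_pos _).le))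
  have hc1 : ∀ x, c x ≤ 1 := fun x =>
    mul_le_one₀ (hη1 x) (mul_nonneg (hs0 _) (mul_nonneg (hs0 _) (truncDeriv_pos _).le))
      (mul_le_one₀ (hs1 _) (mul_nonneg (hs0 _) (truncDeriv_pos _).le)
        (mul_le_one₀ (hs1 _) (truncDeriv_pos _).le (truncDeriv_le_one _)))
  have hRle : ∀ x, ‖R x‖ ≤ D * (1 + ‖gradient u x‖ + ‖gradient w x‖) := fun x => by
    have e1 : ‖(s (u x) * s (w x)) • gradient η x‖ ≤ D := by
      rw [norm_smul, Real.norm_eq_abs, abs_of_nonneg (mul_nonneg (hs0 _) (hs0 _))]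
      exact (mul_le_of_le_one_left (norm_nonneg _)
        (mul_le_one₀ (hs1 _) (hs0 _) (hs1 _))).trans (hD x)
    have e2 : ∀ a b : ℝ, |η x * (s' a * s b)| ≤ D := fun a b => by
      rw [abs_mul, abs_mul, abs_of_nonneg (hη0 x), abs_of_nonneg (hs0 b)]
      exact (mul_le_of_le_one_left (mul_nonneg (abs_nonneg _) (hs0 b)) (hη1 x)).trans
        ((mul_le_of_le_one_right (abs_nonneg _) (hs1 b)).trans (hD' a))
    have e3 : ‖(η x * (s' (u x) * s (w x))) • gradient u x‖ ≤ D * ‖gradient u x‖ := by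
      rw [norm_smul]
      exact mul_le_mul_of_nonneg_right (e2 _ _) (norm_nonneg _)
    have e4 : ‖(η x * (s (u x) * s' (w x))) • gradient w x‖ ≤ D * ‖gradient w x‖ := by
      rw [norm_smul, mul_comm (s (u x))]
      exact mul_le_mul_of_nonneg_right (e2 _ _) (norm_nonneg _)
    refine (norm_add₃_le).trans ?_
    linarith
  set Z : Euc N → ℝ := fun x => 1 + truncDeriv (2 * L) (u x) * ‖gradient u x‖ ^ p
    + truncDeriv (2 * L) (w x) * ‖gradient w x‖ ^ p with hZ
  have hZ0 : ∀ x, 0 ≤ Z x := fun x => by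
    have e1 : 0 ≤ truncDeriv (2 * L) (u x) * ‖gradient u x‖ ^ p :=
      mul_nonneg (truncDeriv_pos _).le (by positivity)
    have e2 : 0 ≤ truncDeriv (2 * L) (w x) * ‖gradient w x‖ ^ p :=
      mul_nonneg (truncDeriv_pos _).le (by positivity)
    simp only [hZ]
    linarith
  have hcases : ∀ x, (1 + ‖gradient u x‖ + ‖gradient w x‖) ^ p ≤ E * Z x ∨ c x = 0 ∧ R x = 0 :=
    fun x => by
    by_cases hu2 : |u x| ≤ 2 * L
    · by_cases hw2 : |w x| ≤ 2 * L
      · exact Or.inl (one_add_add_rpow_le_of_half_le hp0.le (norm_nonneg _) (norm_nonneg _)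
          (half_le_truncDeriv (by linarith) hu2) (half_le_truncDeriv (by linarith) hw2))
      · obtain ⟨z1, z2⟩ := hsL _ (not_le.1 hw2)
        exact Or.inr ⟨by simp [hc, z1], by simp [hR, z1, z2]⟩
    · obtain ⟨z1, z2⟩ := hsL _ (not_le.1 hu2)
      exact Or.inr ⟨by simp [hc, z1], by simp [hR, z1, z2]⟩
  have hbE : ∀ x, ‖gradient h x‖ ^ p ≤ (3 * D) ^ p * E * Z x := fun x => by
    rcases hcases x with hx | ⟨h1, h2⟩
    · have e1 : ‖gradient h x‖ ≤ 3 * D * (1 + ‖gradient u x‖ + ‖gradient w x‖) := by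
        rw [hgrad]
        refine (norm_add_le _ _).trans ?_
        have e2 : ‖c x • (gradient u x - gradient w x)‖ ≤ ‖gradient u x‖ + ‖gradient w x‖ := by
          rw [norm_smul, Real.norm_eq_abs, abs_of_nonneg (hc0 x)]
          exact (mul_le_of_le_one_left (norm_nonneg _) (hc1 x)).trans (norm_sub_le _ _)
        have e3 : ‖trunc δ (u x - w x) • R x‖
            ≤ 2 * (D * (1 + ‖gradient u x‖ + ‖gradient w x‖)) := by
          rw [norm_smul, Real.norm_eq_abs]
          exact mul_le_mul ((abs_trunc_le hδ _).trans (by linarith)) (hRle x) (norm_nonneg _)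
            zero_le_two
        have e4 := le_mul_of_one_le_left
          (by positivity : 0 ≤ 1 + ‖gradient u x‖ + ‖gradient w x‖) hD1
        linarith
      refine (rpow_le_rpow (norm_nonneg _) e1 hp0.le).trans ?_
      rw [mul_rpow (by positivity) (by positivity), mul_assoc]
      exact mul_le_mul_of_nonneg_left hx (by positivity)
    · rw [hgrad, h1, h2]
      simp only [zero_smul, smul_zero, add_zero, norm_zero, zero_rpow hp0.ne']
      have := hZ0 x
      positivity
  have hbR : ∀ x, |trunc δ (u x - w x) * ⟪pPow p (gradient u x) - pPow p (gradient w x), R x⟫|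
      ≤ 4 * δ * D * E * Z x := fun x => by
    rcases hcases x with hx | ⟨h1, h2⟩
    · rw [abs_mul]
      calc _ ≤ 2 * δ * (2 * D * (1 + ‖gradient u x‖ + ‖gradient w x‖) ^ p) :=
            mul_le_mul (abs_trunc_le hδ _) (abs_inner_pPow_sub_le hp (hRle x)) (abs_nonneg _)
              (by positivity)
        _ ≤ 2 * δ * (2 * D * (E * Z x)) := by gcongr
        _ = _ := by ring
    · rw [h2]
      have := hZ0 x
      simp only [inner_zero_right, mul_zero, abs_zero]
      positivity
  have hcpu : Continuous fun x => truncDeriv (2 * L) (u x) * ‖gradient u x‖ ^ p :=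
    (continuous_truncDeriv.comp hcu).mul (continuous_rpow_norm hu.continuous_gradient hp0.le)
  have hcpw : Continuous fun x => truncDeriv (2 * L) (w x) * ‖gradient w x‖ ^ p :=
    (continuous_truncDeriv.comp hcw).mul (continuous_rpow_norm hw.continuous_gradient hp0.le)
  have iu := hcpu.continuousOn.integrableOn_compact (μ := volume) hK
  have iw := hcpw.continuousOn.integrableOn_compact (μ := volume) hK
  have i1 : IntegrableOn (fun _ : Euc N => (1 : ℝ)) K := integrableOn_const hK.measure_lt_top.ne
  have i1u : IntegrableOn (fun x => 1 + truncDeriv (2 * L) (u x) * ‖gradient u x‖ ^ p) K :=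
    i1.add iu
  have iZ : IntegrableOn Z K := i1u.add iw
  have hZB : ∫ x in K, Z x ≤ B := by
    simp only [hZ]
    rw [integral_add i1u iw, integral_add i1 iu, setIntegral_const, smul_eq_mul, mul_one, hB]
    linarith [le_abs_self C₁]
  have hcc : Continuous c := hη.continuous.mul (csu.continuous.mul (csw.continuous.mul
    (continuous_truncDeriv.comp (hcu.sub hcw))))
  have hcG := hcc.mul (continuous_gap hp hu hw)
  have iG : IntegrableOn (fun x => c x *
      ⟪pPow p (gradient u x) - pPow p (gradient w x), gradient u x - gradient w x⟫) K :=
    hcG.continuousOn.integrableOn_compact hK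
  set I := ∫ x in K, c x *
    ⟪pPow p (gradient u x) - pPow p (gradient w x), gradient u x - gradient w x⟫ with hI
  have iVu : IntegrableOn (fun x => V x * |u x| ^ (p - 1)) K :=
    (S.hVi K hK hKΩ).mul_continuousOn (continuous_rpow_norm hcu (by linarith)).continuousOn hK
  have iVw : IntegrableOn (fun x => V x * |w x| ^ (p - 1)) K :=
    (S.hVi K hK hKΩ).mul_continuousOn (continuous_rpow_norm hcw (by linarith)).continuousOn hK
  have iVuh : IntegrableOn (fun x => V x * pPow p (u x) * h x) K :=
    (S.integrableOn_potential_mul hcu hht).mono_set hKΩ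
  have iVwh : IntegrableOn (fun x => V x * pPow p (w x) * h x) K :=
    (S.integrableOn_potential_mul hcw hht).mono_set hKΩ
  have hh2 : ∀ x, |h x| ≤ 2 * δ := fun x => by
    rw [hh, abs_mul, abs_mul, abs_mul, abs_of_nonneg (hη0 x), abs_of_nonneg (hs0 _),
      abs_of_nonneg (hs0 _)]
    have e0 := abs_nonneg (trunc δ (u x - w x))
    exact (mul_le_of_le_one_left (mul_nonneg (hs0 _) (mul_nonneg (hs0 _) e0)) (hη1 x)).trans
      ((mul_le_of_le_one_left (mul_nonneg (hs0 _) e0) (hs1 _)).trans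
        ((mul_le_of_le_one_left e0 (hs1 _)).trans (abs_trunc_le hδ _)))
  have hVle : ∀ z : Euc N → ℝ, ∀ x ∈ K,
      |V x * pPow p (z x) * h x| ≤ 2 * δ * (V x * |z x| ^ (p - 1)) := fun z x hx => by
    have e1 := S.hV0 x (hKΩ hx)
    have e2 : |pPow p (z x)| = |z x| ^ (p - 1) := norm_pPow hp (z x)
    rw [abs_mul, abs_mul, abs_of_nonneg e1, e2, mul_comm (2 * δ)]
    exact mul_le_mul_of_nonneg_left (hh2 x) (mul_nonneg e1 (by positivity))
  have hVabs : ∀ z : Euc N → ℝ, IntegrableOn (fun x => V x * pPow p (z x) * h x) K →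
      IntegrableOn (fun x => V x * |z x| ^ (p - 1)) K → ∫ x in K, V x * |z x| ^ (p - 1) ≤ C₂ →
      |∫ x in K, V x * pPow p (z x) * h x| ≤ 2 * δ * |C₂| := fun z j1 j2 j3 => by
    refine (abs_integral_le_integral_abs).trans ?_
    refine (setIntegral_mono_on j1.abs (j2.const_mul (2 * δ)) hK.measurableSet (hVle z)).trans ?_
    rw [integral_const_mul]
    exact mul_le_mul_of_nonneg_left (j3.trans (le_abs_self _)) (by positivity)
  have b1 := hVabs u iVuh iVu (hC₂ u hu hMu)
  have b2 := hVabs w iVwh iVw (hC₂ w hw hMw)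
  have b3 : I - 4 * δ * D * E * B
      ≤ ∫ x in K, ⟪pPow p (gradient u x) - pPow p (gradient w x), gradient h x⟫ := by
    have e1 : I - 4 * δ * D * E * ∫ x in K, Z x
        ≤ ∫ x in K, ⟪pPow p (gradient u x) - pPow p (gradient w x), gradient h x⟫ := by
      rw [← integral_const_mul, hI, ← integral_sub iG (iZ.const_mul _)]
      refine setIntegral_mono_on (iG.sub (iZ.const_mul _)) (hht.integrableOn_gap_inner hu hw hp K)
        hK.measurableSet fun x _ => ?_
      rw [hgrad, inner_add_right, inner_smul_right, inner_smul_right]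
      linarith [(abs_le.1 (hbR x)).1]
    have e2 := mul_le_mul_of_nonneg_left hZB (by positivity : 0 ≤ 4 * δ * D * E)
    linarith
  have b4 : pEnergy p Ω h ≤ (3 * D) ^ p * E * B := by
    rw [pEnergy_eq_setIntegral hp0 hKΩ hhK]
    refine (setIntegral_mono_on (hht.integrableOn_gradient_rpow hp0 K) (iZ.const_mul _)
      hK.measurableSet fun x _ => hbE x).trans ?_
    rw [integral_const_mul]
    exact mul_le_mul_of_nonneg_left hZB (by positivity)
  have b5 : ∫ x in K, ⟪pPow p (gradient u x) - pPow p (gradient w x), gradient h x⟫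
      = (∫ x in K, ⟪pPow p (gradient u x), gradient h x⟫)
        - ∫ x in K, ⟪pPow p (gradient w x), gradient h x⟫ := by
    simp only [inner_sub_left]
    exact integral_sub (hht.integrableOn_inner_pPow hu.1 hp K)
      (hht.integrableOn_inner_pPow hw.1 hp K)
  have r1 := (abs_le.1 (hru h hht)).2
  have r2 := (abs_le.1 (hrw h hht)).1
  rw [resid_eq_setIntegral hKΩ hhK] at r1 r2
  have r3 : ε * (1 + pEnergy p Ω h) ≤ ε * (1 + (3 * D) ^ p * E * B) :=
    mul_le_mul_of_nonneg_left (by linarith) hε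
  have c1 := (abs_le.1 b1).2
  have c2 := (abs_le.1 b2).1
  have key : I ≤ 2 * (ε * (1 + (3 * D) ^ p * E * B)) + 4 * δ * D * E * B + 4 * δ * |C₂| := by
    linarith
  refine key.trans ?_
  have p1 : 0 ≤ (3 * D) ^ p * E * B := by positivity
  have p2 : 0 ≤ D * E * B := by positivity
  have p3 : 0 ≤ |C₂| := abs_nonneg _
  generalize (3 * D) ^ p * E * B = A1 at p1 ⊢
  have p4 : 4 * δ * D * E * B = 4 * δ * (D * E * B) := by ring
  have p5 : 4 * D * E * B = 4 * (D * E * B) := by ring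
  rw [p4, p5]
  generalize D * E * B = A2 at p2 ⊢
  have q1 : 0 ≤ δ * (1 + A1) := by positivity
  have q2 : 0 ≤ ε * A2 := by positivity
  have q3 : 0 ≤ ε * |C₂| := by positivity
  linarith

end Admissible

end GradientGap

section CauchyInMeasure

variable {N : ℕ} {Ω : Set (Euc N)} {p q : ℝ} {V W : Euc N → ℝ} {f : (Euc N → ℝ) → ℝ}

namespace Admissible

/-- Almost critical test functions that are close in `L¹` on a compact set are, together with
their gradients, close in measure there. -/
lemma exists_measure_dist_le (S : Admissible p q Ω V W f) {K : Set (Euc N)} (hK : IsCompact K)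
    (hKΩ : K ⊆ Ω) (M : ℝ) {σ : ℝ} (hσ : 0 < σ) :
    ∃ τ > 0, ∀ u w, IsTestFun Ω u → IsTestFun Ω w →
      wEnergy q Ω W u ≤ M → wEnergy q Ω W w ≤ M →
      (∀ h, IsTestFun Ω h → |resid p Ω V f u h| ≤ τ * (1 + pEnergy p Ω h)) →
      (∀ h, IsTestFun Ω h → |resid p Ω V f w h| ≤ τ * (1 + pEnergy p Ω h)) →
      ∫ x in K, |u x - w x| ≤ τ →
      volume (K ∩ {x | σ < dist (u x, gradient u x) (w x, gradient w x)}) ≤ ENNReal.ofReal σ := by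
  have hp := S.hp
  have hq0 : 0 < q := by linarith [S.hq1]
  obtain ⟨B, hB⟩ := exists_local_energy_bound S.hΩ hq0 S.hWc S.hWpos hK hKΩ M
  set B' := max B 1 with hB'
  have hB'0 : 0 < B' := lt_max_of_lt_right one_pos
  set L := (4 * B' / σ) ^ (1 / q) with hLdef
  have hL : 0 < L := by positivity
  have hLq : L ^ q = 4 * B' / σ := by
    rw [hLdef, ← rpow_mul (by positivity), one_div_mul_cancel hq0.ne', rpow_one]
  obtain ⟨θ, hθ, hgap⟩ := exists_pPow_gap_lower (H := Euc N) hp hσ L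
  obtain ⟨s, s', D, hs, -, hs', hs0, hs1, hsL, hs2L, hsD⟩ := exists_real_cutoff hL
  obtain ⟨η, hη, hη0, hη1, hηK⟩ := exists_cutoff S.hΩ hK hKΩ
  have hKη : K ⊆ tsupport η := fun x hx => subset_tsupport η (by simp [hηK x hx])
  obtain ⟨C, ε₀, hε₀, hC⟩ := S.exists_gradient_gap_bound hη hη0 hη1 M hL hs hs' hs0 hs1 hs2L hsD
  set C' := max C 1 with hC'
  have hC'0 : 0 < C' := lt_max_of_lt_right one_pos
  set κ := σ * θ / (16 * C') with hκ
  have hκ0 : 0 < κ := by positivity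
  set δ := min (min 1 σ) κ with hδdef
  have hδ : 0 < δ := lt_min (lt_min one_pos hσ) hκ0
  have hδ1 : δ ≤ 1 := (min_le_left _ _).trans (min_le_left _ _)
  have hδσ : δ ≤ σ := (min_le_left _ _).trans (min_le_right _ _)
  have hδκ : δ ≤ κ := min_le_right _ _
  set τ := min (min ε₀ κ) (σ * δ / 4) with hτdef
  have hτ : 0 < τ := lt_min (lt_min hε₀ hκ0) (by positivity)
  have hτε : τ ≤ ε₀ := (min_le_left _ _).trans (min_le_left _ _)
  have hτκ : τ ≤ κ := (min_le_left _ _).trans (min_le_right _ _)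
  have hτδ : τ ≤ σ * δ / 4 := min_le_right _ _
  refine ⟨τ, hτ, fun u w hu hw hMu hMw hru hrw huw => ?_⟩
  have hcu := hu.continuous
  have hcw := hw.continuous
  set e : (Euc N → ℝ) → Euc N → ℝ := fun z x => ‖gradient z x‖ ^ q + |z x| ^ q with he
  have he0 : ∀ z x, 0 ≤ e z x := fun z x => by positivity
  set G : Euc N → ℝ := fun x => η x * (s (u x) * (s (w x) * truncDeriv δ (u x - w x))) *
    ⟪pPow p (gradient u x) - pPow p (gradient w x), gradient u x - gradient w x⟫ with hG
  have hG0 : ∀ x, 0 ≤ G x := fun x => mul_nonneg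
    (mul_nonneg (hη0 x) (mul_nonneg (hs0 _) (mul_nonneg (hs0 _) (truncDeriv_pos _).le)))
    (pPow_gap_nonneg hp _ _)
  have hGc : Continuous G := (hη.continuous.mul ((hs.continuous.comp hcu).mul
    ((hs.continuous.comp hcw).mul (continuous_truncDeriv.comp (hcu.sub hcw))))).mul
      (continuous_gap hp hu hw)
  have m1 : ∀ z, IsTestFun Ω z → wEnergy q Ω W z ≤ M →
      volume (K ∩ {x | L ^ q ≤ e z x}) ≤ ENNReal.ofReal (σ / 4) := fun z hz hMz => by
    have hec : Continuous (e z) := (continuous_rpow_norm hz.continuous_gradient hq0.le).add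
      (continuous_rpow_norm hz.continuous hq0.le)
    have := measure_inter_lt_le hK.measurableSet (by positivity : 0 < L ^ q)
      (hec.continuousOn.integrableOn_compact (μ := volume) hK) (fun x _ => he0 z x)
      ((hB z hz hMz).trans (le_max_left B 1))
    rwa [hLq, show B' / (4 * B' / σ) = σ / 4 by field_simp, ← hLq] at this
  have m2 : volume (K ∩ {x | δ ≤ |u x - w x|}) ≤ ENNReal.ofReal (σ / 4) := by
    have hdc : Continuous fun x => |u x - w x| := (hcu.sub hcw).abs
    have := measure_inter_lt_le hK.measurableSet hδ
      (hdc.continuousOn.integrableOn_compact (μ := volume) hK) (fun x _ => abs_nonneg _)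
      (huw.trans hτδ)
    rwa [show σ * δ / 4 / δ = σ / 4 by field_simp] at this
  have m3 : volume (K ∩ {x | θ / 2 ≤ G x}) ≤ ENNReal.ofReal (σ / 4) := by
    have b1 : ∫ x in K, G x ≤ C' * (κ + κ) :=
      calc ∫ x in K, G x ≤ ∫ x in tsupport η, G x :=
            setIntegral_mono_set (hGc.continuousOn.integrableOn_compact hη.isCompact)
              (ae_of_all _ hG0) hKη.eventuallyLE
        _ ≤ C * (τ + δ) := hC δ hδ hδ1 τ hτ.le hτε u w hu hw hMu hMw hru hrw
        _ ≤ C' * (κ + κ) := mul_le_mul (le_max_left _ _) (by linarith) (by linarith) hC'0.le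
    have := measure_inter_lt_le hK.measurableSet (by positivity : 0 < θ / 2)
      (hGc.continuousOn.integrableOn_compact (μ := volume) hK) (fun x _ => hG0 x) b1
    rwa [show C' * (κ + κ) / (θ / 2) = σ / 4 by rw [hκ]; field_simp; norm_num] at this
  have small : ∀ z x, e z x < L ^ q → ‖gradient z x‖ ≤ L ∧ |z x| ≤ L := fun z x hz => by
    have p1 : 0 ≤ ‖gradient z x‖ ^ q := by positivity
    have p2 : 0 ≤ |z x| ^ q := by positivity
    simp only [he] at hz
    exact ⟨((rpow_lt_rpow_iff (norm_nonneg _) hL.le hq0).1 (by linarith)).le,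
      ((rpow_lt_rpow_iff (abs_nonneg _) hL.le hq0).1 (by linarith)).le⟩
  have hsub : K ∩ {x | σ < dist (u x, gradient u x) (w x, gradient w x)} ⊆
      ((K ∩ {x | L ^ q ≤ e u x}) ∪ (K ∩ {x | L ^ q ≤ e w x})) ∪
        ((K ∩ {x | δ ≤ |u x - w x|}) ∪ (K ∩ {x | θ / 2 ≤ G x})) := by
    rintro x ⟨hxK, hx⟩
    by_contra hcon
    simp only [Set.mem_union, Set.mem_inter_iff, hxK, true_and, Set.mem_ofPred_eq, not_or,
      not_le] at hcon hx
    obtain ⟨⟨c1, c2⟩, c3, c4⟩ := hcon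
    obtain ⟨u1, u2⟩ := small u x c1
    obtain ⟨w1, w2⟩ := small w x c2
    have hd : σ < ‖gradient u x - gradient w x‖ := by
      rw [Prod.dist_eq, Real.dist_eq, dist_eq_norm] at hx
      rcases lt_max_iff.1 hx with h | h
      · linarith
      · exact h
    have hg := hgap _ _ u1 w1 hd.le
    have ht := half_le_truncDeriv hδ c3.le
    have : θ / 2 ≤ G x := by
      simp only [hG, hηK x hxK, hsL _ u2, hsL _ w2, one_mul]
      calc θ / 2 = 1 / 2 * θ := by ring
        _ ≤ _ := mul_le_mul ht hg hθ.le (truncDeriv_pos _).le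
    linarith
  calc _ ≤ _ := measure_mono hsub
    _ ≤ (ENNReal.ofReal (σ / 4) + ENNReal.ofReal (σ / 4))
        + (ENNReal.ofReal (σ / 4) + ENNReal.ofReal (σ / 4)) :=
      (measure_union_le _ _).trans (add_le_add
        ((measure_union_le _ _).trans (add_le_add (m1 u hu hMu) (m1 w hw hMw)))
        ((measure_union_le _ _).trans (add_le_add m2 m3)))
    _ = ENNReal.ofReal σ := by
      rw [← ENNReal.ofReal_add (by positivity) (by positivity),
        ← ENNReal.ofReal_add (by positivity) (by positivity)]
      congr 1
      ring

end Admissible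

end CauchyInMeasure

section Compactness

variable {N : ℕ} {Ω : Set (Euc N)} {p q : ℝ} {V W : Euc N → ℝ} {f : (Euc N → ℝ) → ℝ}

/-- A sequence of test functions with bounded weighted energy whose residuals vanish in the limit
and which converges almost everywhere together with its gradients. -/
structure IsSolvingSequence (p q : ℝ) (Ω : Set (Euc N)) (V W : Euc N → ℝ) (f : (Euc N → ℝ) → ℝ)
    (M : ℝ) (φ : ℕ → Euc N → ℝ) (u : Euc N → ℝ) (v : Euc N → Euc N) : Prop where
  isTestFun : ∀ k, IsTestFun Ω (φ k)
  wEnergy_le : ∀ k, wEnergy q Ω W (φ k) ≤ M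
  tendsto_resid : ∀ ζ, IsTestFun Ω ζ → Tendsto (fun k => resid p Ω V f (φ k) ζ) atTop (𝓝 0)
  tendsto_ae : ∀ᵐ x ∂volume.restrict Ω, Tendsto (fun k => φ k x) atTop (𝓝 (u x))
  tendsto_gradient_ae :
    ∀ᵐ x ∂volume.restrict Ω, Tendsto (fun k => gradient (φ k) x) atTop (𝓝 (v x))

lemma exists_tendsto_of_cauchySeq_ae {E : Type*} [MetricSpace E] [CompleteSpace E] [Nonempty E]
    {g : ℕ → Euc N → E} {μ : Measure (Euc N)} (h : ∀ᵐ x ∂μ, CauchySeq fun k => g k x) :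
    ∃ g' : Euc N → E, ∀ᵐ x ∂μ, Tendsto (fun k => g k x) atTop (𝓝 (g' x)) :=
  ⟨fun x => limUnder atTop fun k => g k x, h.mono fun _ hx => hx.tendsto_limUnder⟩

lemma exists_subseq_cauchy_on_compacts {M : ℝ} (hΩ : IsOpen Ω) (hq : 1 < q)
    (hWc : ContinuousOn W Ω) (hWpos : ∀ x ∈ Ω, 0 < W x) {K : ℕ → Set (Euc N)}
    (hK : ∀ n, IsCompact (K n)) (hKΩ : ∀ n, K n ⊆ Ω) {u : ℕ → Euc N → ℝ}
    (hu : ∀ k, IsTestFun Ω (u k)) (hM : ∀ k, wEnergy q Ω W (u k) ≤ M) :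
    ∃ φ : ℕ → ℕ, StrictMono φ ∧ ∀ n, ∀ ε > 0, ∃ k0, ∀ k ≥ k0, ∀ m ≥ k0,
      ∫ x in K n, |u (φ k) x - u (φ m) x| ≤ ε := by
  choose η hη hη0 hη1 hηK using fun n => exists_cutoff hΩ (hK n) (hKΩ n)
  choose B hB using fun n => exists_cutoff_energy_bound hΩ hq hWc hWpos (hη n) M
  have hηu : ∀ n k, IsTestFun Ω fun x => η n x * u k x := fun n k =>
    (hη n).mul_contDiff (hu k).1
  obtain ⟨φ, hφ, hc⟩ := exists_subseq_cauchy_integral (w := fun n k x => η n x * u k x)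
    (K := fun n => tsupport (η n)) (B := B) (fun n => (hη n).isCompact) (fun n k => (hηu n k).1)
    (fun n k => tsupport_mul_subset_left)
    (fun n k => by simpa using (hB n (u k) (hu k) (hM k) 1 le_rfl hq.le).2)
    (fun n k => by simpa using (hB n (u k) (hu k) (hM k) 1 le_rfl hq.le).1)
  refine ⟨φ, hφ, fun n ε hε => ?_⟩
  obtain ⟨k0, hk0⟩ := hc n ε hε
  refine ⟨k0, fun k hk m hm => le_trans ?_ (hk0 k hk m hm)⟩
  have hi : Integrable fun x => |η n x * u (φ k) x - η n x * u (φ m) x| :=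
    (((hηu n (φ k)).continuous.integrable_of_hasCompactSupport (hηu n (φ k)).2.1).sub
      ((hηu n (φ m)).continuous.integrable_of_hasCompactSupport (hηu n (φ m)).2.1)).abs
  calc ∫ x in K n, |u (φ k) x - u (φ m) x|
      = ∫ x in K n, |η n x * u (φ k) x - η n x * u (φ m) x| :=
        setIntegral_congr_fun (hK n).measurableSet fun x hx => by simp [hηK n x hx]
    _ ≤ _ := setIntegral_le_integral hi (ae_of_all _ fun x => abs_nonneg _)

namespace Admissible

lemma exists_isSolvingSequence (S : Admissible p q Ω V W f) :
    ∃ M φ u v, IsSolvingSequence p q Ω V W f M φ u v := by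
  obtain ⟨M₀, hM₀⟩ := S.exists_almost_critical
  choose z hz hzM hzr using fun k : ℕ => hM₀ (1 / ((k : ℝ) + 1)) (by positivity)
  set M := M₀ ^ (q / p) with hM
  have hzW : ∀ k, wEnergy q Ω W (z k) ≤ M := fun k => S.wEnergy_le (hz k) (hzM k)
  obtain ⟨K, hK, hKΩ, hKm, hKU⟩ := exists_compact_iUnion_eq S.hΩ
  obtain ⟨φ, hφ, hc⟩ := exists_subseq_cauchy_on_compacts S.hΩ S.hq1 S.hWc S.hWpos hK hKΩ hz hzW
  have hsmall : ∀ τ > 0, ∀ᶠ k : ℕ in atTop, 1 / ((φ k : ℝ) + 1) ≤ τ := fun τ hτ =>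
    (tendsto_one_div_add_atTop_nhds_zero_nat.comp hφ.tendsto_atTop).eventually_le_const hτ
  have weaken : ∀ τ k, 1 / ((φ k : ℝ) + 1) ≤ τ → ∀ h, IsTestFun Ω h →
      |resid p Ω V f (z (φ k)) h| ≤ τ * (1 + pEnergy p Ω h) := fun τ k hk h hh =>
    (hzr (φ k) h hh).trans (mul_le_mul_of_nonneg_right hk
      (by linarith [pEnergy_nonneg (p := p) (Ω := Ω) (u := h)]))
  obtain ⟨ψ, hψ, hae⟩ := exists_subseq_ae_cauchySeq (μ := volume)
    (g := fun k x => (z (φ k) x, gradient (z (φ k)) x)) hKm fun n σ hσ => by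
      obtain ⟨τ, hτ, h⟩ := S.exists_measure_dist_le (hK n) (hKΩ n) M hσ
      obtain ⟨k0, hk0⟩ := hc n τ hτ
      obtain ⟨k1, hk1⟩ := eventually_atTop.1 (hsmall τ hτ)
      exact ⟨max k0 k1, fun k hk m hm => h _ _ (hz _) (hz _) (hzW _) (hzW _)
        (weaken τ k (hk1 k (le_of_max_le_right hk))) (weaken τ m (hk1 m (le_of_max_le_right hm)))
        (hk0 k (le_of_max_le_left hk) m (le_of_max_le_left hm))⟩
  rw [hKU] at hae
  obtain ⟨g, hg⟩ := exists_tendsto_of_cauchySeq_ae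
    ((ae_restrict_iff' S.hΩ.measurableSet).2 hae)
  refine ⟨M, fun k => z (φ (ψ k)), fun x => (g x).1, fun x => (g x).2, fun k => hz _,
    fun k => hzW _, fun ζ hζ => ?_, hg.mono fun x hx => (continuous_fst.tendsto _).comp hx,
    hg.mono fun x hx => (continuous_snd.tendsto _).comp hx⟩
  have h1 := ((tendsto_one_div_add_atTop_nhds_zero_nat (𝕜 := ℝ)).comp
    (hφ.comp hψ).tendsto_atTop).mul_const (1 + pEnergy p Ω ζ)
  rw [zero_mul] at h1
  exact squeeze_zero_norm (fun k => hzr _ ζ hζ) h1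

end Admissible

end Compactness

section LimitEquation

variable {N : ℕ} {Ω : Set (Euc N)} {p q M : ℝ} {V W : Euc N → ℝ} {f : (Euc N → ℝ) → ℝ}
  {φ : ℕ → Euc N → ℝ} {u : Euc N → ℝ} {v : Euc N → Euc N}

lemma gradient_ofLp (ζ : Euc N → ℝ) (x : Euc N) (i : Fin N) :
    fderiv ℝ ζ x (EuclideanSpace.single i 1) = gradient ζ x i := by
  rw [← inner_gradient_left, EuclideanSpace.inner_single_right]
  simp

lemma IsTestFun.integral_mul_gradient {ζ w : Euc N → ℝ} (hζ : IsTestFun Ω ζ) (hw : IsTestFun Ω w)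
    (i : Fin N) : ∫ x in Ω, w x * gradient ζ x i = - ∫ x in Ω, gradient w x i * ζ x := by
  have hcζ : Continuous fun x => gradient ζ x i :=
    (EuclideanSpace.proj i).continuous.comp hζ.continuous_gradient
  have hcw : Continuous fun x => gradient w x i :=
    (EuclideanSpace.proj i).continuous.comp hw.continuous_gradient
  have zζ : ∀ x ∉ Ω, w x * gradient ζ x i = 0 := fun x hx => by
    rw [image_eq_zero_of_notMem_tsupport fun h => hx (hw.2.2 h), zero_mul]
  have zw : ∀ x ∉ Ω, gradient w x i * ζ x = 0 := fun x hx => by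
    rw [image_eq_zero_of_notMem_tsupport fun h => hx (hζ.2.2 h), mul_zero]
  rw [setIntegral_eq_integral_of_forall_compl_eq_zero zζ,
    setIntegral_eq_integral_of_forall_compl_eq_zero zw]
  simp only [← gradient_ofLp] at hcζ hcw ⊢
  refine integral_mul_fderiv_eq_neg_fderiv_mul_of_integrable ?_ ?_ ?_
    (fun x _ => hw.differentiable x) (fun x _ => hζ.differentiable x)
  · exact (hcw.mul hζ.continuous).integrable_of_hasCompactSupport hζ.2.1.mul_left
  · exact (hw.continuous.mul hcζ).integrable_of_hasCompactSupport hw.2.1.mul_right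
  · exact (hw.continuous.mul hζ.continuous).integrable_of_hasCompactSupport hw.2.1.mul_right

lemma tendsto_setIntegral_of_eq_zero {K : Set (Euc N)} (hΩ : MeasurableSet Ω) (hKΩ : K ⊆ Ω)
    {g : ℕ → Euc N → ℝ} {g' : Euc N → ℝ} (h0 : ∀ k, ∀ x ∉ K, g k x = 0) (h0' : ∀ x ∉ K, g' x = 0)
    (h : IntegrableOn g' K ∧ Tendsto (fun k => ∫ x in K, g k x) atTop (𝓝 (∫ x in K, g' x))) :
    IntegrableOn g' Ω ∧ Tendsto (fun k => ∫ x in Ω, g k x) atTop (𝓝 (∫ x in Ω, g' x)) := by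
  refine ⟨h.1.of_forall_sdiff_eq_zero hΩ fun x hx => h0' x hx.2, ?_⟩
  rw [setIntegral_eq_of_eq_zero hKΩ h0']
  refine h.2.congr fun k => ?_
  rw [setIntegral_eq_of_eq_zero hKΩ (h0 k)]

namespace IsSolvingSequence

lemma integrableOn_weighted (S : Admissible p q Ω V W f)
    (T : IsSolvingSequence p q Ω V W f M φ u v) :
    IntegrableOn (fun x => (‖v x‖ ^ q + |u x| ^ q) * W x) Ω := by
  have hq0 : 0 < q := by linarith [S.hq1]
  refine (integrable_and_integral_le_of_tendsto_ae
    (g := fun k x => (‖gradient (φ k) x‖ ^ q + |φ k x| ^ q) * W x) (B := M)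
    (fun k => (T.isTestFun k).integrableOn_energy hq0 S.hWc) (fun k => ?_)
    (Eventually.of_forall T.wEnergy_le) ?_).1
  · filter_upwards [ae_restrict_mem S.hΩ.measurableSet] with x hx
    exact mul_nonneg (by positivity) (S.hWpos x hx).le
  · filter_upwards [T.tendsto_ae, T.tendsto_gradient_ae] with x h1 h2
    exact ((h2.norm.rpow_const (Or.inr hq0.le)).add
      (h1.abs.rpow_const (Or.inr hq0.le))).mul_const _

/-- Convergence of integrals of quantities of growth less than `q`. -/
lemma tendsto_setIntegral_of_growth (S : Admissible p q Ω V W f)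
    (T : IsSolvingSequence p q Ω V W f M φ u v) {K : Set (Euc N)} (hK : IsCompact K)
    (hKΩ : K ⊆ Ω) {α A : ℝ} (hα : 0 < α) (hαq : α < q) (hA : 0 ≤ A) {g : ℕ → Euc N → ℝ}
    {g' : Euc N → ℝ} (hg : ∀ k, Continuous (g k))
    (hle : ∀ k x, |g k x| ≤ A * ‖gradient (φ k) x‖ ^ α + A * |φ k x| ^ α)
    (hlim : ∀ᵐ x ∂volume.restrict Ω, Tendsto (fun k => g k x) atTop (𝓝 (g' x))) :
    IntegrableOn g' K ∧ Tendsto (fun k => ∫ x in K, g k x) atTop (𝓝 (∫ x in K, g' x)) := by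
  have hq0 : 0 < q := by linarith
  obtain ⟨B, hB⟩ := exists_local_energy_bound S.hΩ hq0 S.hWc S.hWpos hK hKΩ M
  refine integrable_and_tendsto_integral_of_le_add (B := B)
    (Y := fun k x => ‖gradient (φ k) x‖ ^ q + |φ k x| ^ q)
    (fun k => (hg k).aestronglyMeasurable) (fun k => ?_)
    (fun k => ae_of_all _ fun x => by positivity)
    (fun k => hB _ (T.isTestFun k) (T.wEnergy_le k)) (fun l hl => ?_)
    (ae_restrict_of_ae_restrict_of_subset hKΩ hlim)
  · exact ((continuous_rpow_norm (T.isTestFun k).continuous_gradient hq0.le).add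
      (continuous_rpow_norm (T.isTestFun k).continuous hq0.le)).continuousOn.integrableOn_compact hK
  · refine ⟨fun _ => 2 * (l ^ (-(α / (q - α))) * A ^ (q / (q - α))),
      integrableOn_const hK.measure_lt_top.ne, fun k => ae_of_all _ fun x => ?_⟩
    have h1 := young_param hA (norm_nonneg (gradient (φ k) x)) hl hα hαq
    have h2 := young_param hA (abs_nonneg (φ k x)) hl hα hαq
    linarith [hle k x]

lemma integrableOn_compact (S : Admissible p q Ω V W f)
    (T : IsSolvingSequence p q Ω V W f M φ u v) {K : Set (Euc N)} (hK : IsCompact K)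
    (hKΩ : K ⊆ Ω) : IntegrableOn u K :=
  (T.tendsto_setIntegral_of_growth S hK hKΩ one_pos S.hq1 zero_le_one
    (fun k => (T.isTestFun k).continuous)
    (fun k x => by simp) T.tendsto_ae).1

lemma hasWeakGradOn (S : Admissible p q Ω V W f)
    (T : IsSolvingSequence p q Ω V W f M φ u v) : HasWeakGradOn Ω u v := by
  intro ζ hζ i
  simp only [gradient_ofLp]
  obtain ⟨D, hD1, hD⟩ := hζ.exists_norm_gradient_le
  obtain ⟨A, hA⟩ := hζ.2.1.exists_bound_of_continuous hζ.continuous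
  have hA0 : 0 ≤ A := (norm_nonneg _).trans (hA 0)
  have hcoord : ∀ (y : Euc N), |y i| ≤ ‖y‖ := fun y => PiLp.norm_apply_le y i
  have hcζ : Continuous fun x => gradient ζ x i :=
    (EuclideanSpace.proj i).continuous.comp hζ.continuous_gradient
  have l1 := (tendsto_setIntegral_of_eq_zero (g := fun k x => φ k x * gradient ζ x i)
    (g' := fun x => u x * gradient ζ x i) S.hΩ.measurableSet hζ.2.2
    (fun k x hx => by simp [gradient_eq_zero_of_notMem hx])
    (fun x hx => by simp [gradient_eq_zero_of_notMem hx])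
    (T.tendsto_setIntegral_of_growth S hζ.isCompact hζ.2.2 one_pos S.hq1
      (by linarith : 0 ≤ D) (fun k => (T.isTestFun k).continuous.mul hcζ) (fun k x => by
        rw [rpow_one, rpow_one, abs_mul]
        have h1 := mul_le_mul_of_nonneg_left ((hcoord _).trans (hD x)) (abs_nonneg (φ k x))
        have h2 : 0 ≤ D * ‖gradient (φ k) x‖ := by positivity
        linarith)
      (T.tendsto_ae.mono fun x hx => hx.mul_const _))).2
  have l2 := (tendsto_setIntegral_of_eq_zero (g := fun k x => gradient (φ k) x i * ζ x)
    (g' := fun x => v x i * ζ x) S.hΩ.measurableSet hζ.2.2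
    (fun k x hx => by simp [image_eq_zero_of_notMem_tsupport hx])
    (fun x hx => by simp [image_eq_zero_of_notMem_tsupport hx])
    (T.tendsto_setIntegral_of_growth S hζ.isCompact hζ.2.2 one_pos S.hq1 hA0
      (fun k => ((EuclideanSpace.proj i).continuous.comp
        (T.isTestFun k).continuous_gradient).mul hζ.continuous) (fun k x => by
        rw [rpow_one, rpow_one, abs_mul]
        have h1 := mul_le_mul (hcoord (gradient (φ k) x)) (hA x) (norm_nonneg _) (norm_nonneg _)
        have h2 : 0 ≤ A * |φ k x| := by positivity
        rw [Real.norm_eq_abs] at h1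
        linarith)
      (T.tendsto_gradient_ae.mono fun x hx =>
        (((EuclideanSpace.proj i).continuous.tendsto _).comp hx).mul_const _))).2
  refine tendsto_nhds_unique l1 (l2.neg.congr fun k => ?_)
  rw [hζ.integral_mul_gradient (T.isTestFun k)]

lemma tendsto_integral_inner (S : Admissible p q Ω V W f)
    (T : IsSolvingSequence p q Ω V W f M φ u v) {ζ : Euc N → ℝ} (hζ : IsTestFun Ω ζ) :
    IntegrableOn (fun x => ⟪pPow p (v x), gradient ζ x⟫) Ω ∧
      Tendsto (fun k => ∫ x in Ω, ⟪pPow p (gradient (φ k) x), gradient ζ x⟫) atTop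
        (𝓝 (∫ x in Ω, ⟪pPow p (v x), gradient ζ x⟫)) := by
  have hp := S.hp
  obtain ⟨D, hD1, hD⟩ := hζ.exists_norm_gradient_le
  refine tendsto_setIntegral_of_eq_zero
    (g := fun k x => ⟪pPow p (gradient (φ k) x), gradient ζ x⟫) S.hΩ.measurableSet hζ.2.2
    (fun k x hx => by simp [gradient_eq_zero_of_notMem hx])
    (fun x hx => by simp [gradient_eq_zero_of_notMem hx])
    (T.tendsto_setIntegral_of_growth S hζ.isCompact hζ.2.2 (by linarith) S.hpq
      (by linarith : 0 ≤ D) (fun k => ((continuous_pPow hp).comp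
        (T.isTestFun k).continuous_gradient).inner hζ.continuous_gradient) (fun k x => ?_)
      (T.tendsto_gradient_ae.mono fun x hx =>
        (((continuous_pPow hp).tendsto _).comp hx).inner tendsto_const_nhds))
  have h1 := abs_real_inner_le_norm (pPow p (gradient (φ k) x)) (gradient ζ x)
  rw [norm_pPow hp] at h1
  have h2 := mul_le_mul_of_nonneg_left (hD x)
    (by positivity : 0 ≤ ‖gradient (φ k) x‖ ^ (p - 1))
  have h3 : 0 ≤ D * |φ k x| ^ (p - 1) := by positivity
  linarith

lemma tendsto_integral_potential (S : Admissible p q Ω V W f)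
    (T : IsSolvingSequence p q Ω V W f M φ u v) {ζ : Euc N → ℝ} (hζ : IsTestFun Ω ζ) :
    IntegrableOn (fun x => V x * pPow p (u x) * ζ x) Ω ∧
      Tendsto (fun k => ∫ x in Ω, V x * pPow p (φ k x) * ζ x) atTop
        (𝓝 (∫ x in Ω, V x * pPow p (u x) * ζ x)) := by
  have hp := S.hp
  set K := tsupport ζ
  have hK : IsCompact K := hζ.isCompact
  have hKΩ : K ⊆ Ω := hζ.2.2
  obtain ⟨A₀, hA₀⟩ := hζ.2.1.exists_bound_of_continuous hζ.continuous
  obtain ⟨A, hA0, hA⟩ : ∃ A : ℝ, 0 < A ∧ ∀ x, |ζ x| ≤ A :=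
    ⟨max A₀ 1, lt_max_of_lt_right one_pos, fun x => (hA₀ x).trans (le_max_left _ _)⟩
  obtain ⟨y, B, hy, hy0, hB, hH⟩ := S.hVB K hK hKΩ M
  refine tendsto_setIntegral_of_eq_zero (g := fun k x => V x * pPow p (φ k x) * ζ x)
    S.hΩ.measurableSet hKΩ
    (fun k x hx => by simp [image_eq_zero_of_notMem_tsupport hx])
    (fun x hx => by simp [image_eq_zero_of_notMem_tsupport hx])
    (integrable_and_tendsto_integral_of_le_add (Y := fun k x => y (φ k x))
      (fun k => ((S.integrableOn_potential_mul (T.isTestFun k).continuous hζ).mono_set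
        hKΩ).aestronglyMeasurable)
      (fun k => (hy.comp (T.isTestFun k).continuous).continuousOn.integrableOn_compact hK)
      (fun k => ae_of_all _ fun x => hy0 _) (fun k => hB _ (T.isTestFun k) (T.wEnergy_le k))
      (fun l hl => ?_) (ae_restrict_of_ae_restrict_of_subset hKΩ
        (T.tendsto_ae.mono fun x hx => ((((continuous_pPow hp).tendsto _).comp hx).const_mul
          _).mul_const _)))
  obtain ⟨H, hHi, hHle⟩ := hH (l / A) (by positivity)
  refine ⟨fun x => A * H x, hHi.const_mul A, fun k => ?_⟩
  filter_upwards [ae_restrict_mem hK.measurableSet] with x hx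
  have e2 : |pPow p (φ k x)| = |φ k x| ^ (p - 1) := norm_pPow hp (φ k x)
  have e3 := S.hV0 x (hKΩ hx)
  rw [abs_mul, abs_mul, abs_of_nonneg e3, e2]
  calc V x * |φ k x| ^ (p - 1) * |ζ x| ≤ (V x * |φ k x| ^ (p - 1)) * A :=
        mul_le_mul_of_nonneg_left (hA x) (mul_nonneg e3 (by positivity))
    _ ≤ (l / A * y (φ k x) + H x) * A :=
        mul_le_mul_of_nonneg_right (hHle _ (T.isTestFun k) (T.wEnergy_le k) x hx) hA0.le
    _ = _ := by field_simp

lemma integral_eq (S : Admissible p q Ω V W f)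
    (T : IsSolvingSequence p q Ω V W f M φ u v) {ζ : Euc N → ℝ} (hζ : IsTestFun Ω ζ) :
    (∫ x in Ω, ⟪pPow p (v x), gradient ζ x⟫) - (∫ x in Ω, V x * pPow p (u x) * ζ x) = f ζ := by
  have h1 := (((T.tendsto_integral_inner S hζ).2.sub
    (T.tendsto_integral_potential S hζ).2).sub_const
    (f ζ))
  have h2 := tendsto_nhds_unique h1 (T.tendsto_resid ζ hζ)
  linarith

end IsSolvingSequence

end LimitEquation

section StrongApproximation

variable {N : ℕ} {Ω : Set (Euc N)} {p q M : ℝ} {V W : Euc N → ℝ} {f : (Euc N → ℝ) → ℝ}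
  {φ : ℕ → Euc N → ℝ} {u : Euc N → ℝ} {v : Euc N → Euc N}

lemma convex_setOf_isTestFun_mem (x : Euc N) {A : Set (ℝ × Euc N)} (hA : Convex ℝ A) :
    Convex ℝ {w : Euc N → ℝ | IsTestFun Ω w ∧ (w x, gradient w x) ∈ A} := by
  rintro w ⟨hw, hwA⟩ z ⟨hz, hzA⟩ a b ha hb hab
  refine ⟨hw.lin hz a b, ?_⟩
  have e : gradient (a • w + b • z) x = a • gradient w x + b • gradient z x :=
    gradient_lin a b (hw.differentiable x) (hz.differentiable x)
  have h := hA hwA hzA ha hb hab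
  rw [e]
  exact h

lemma IsTestFun.of_mem_convexHull (hφ : ∀ k, IsTestFun Ω (φ k)) {n : ℕ} {w : Euc N → ℝ}
    (hw : w ∈ convexHull ℝ (φ '' Set.Ici n)) : IsTestFun Ω w :=
  (convexHull_min (t := {w | IsTestFun Ω w ∧ (w 0, gradient w 0) ∈ Set.univ})
    (Set.image_subset_iff.2 fun k _ => ⟨hφ k, Set.mem_univ _⟩)
    (convex_setOf_isTestFun_mem 0 convex_univ) hw).1

/-- Uniform convexity of the weighted energy. -/
lemma exists_wEnergy_sub_le (hΩ : IsOpen Ω) (hq : 1 < q) (hWc : ContinuousOn W Ω)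
    (hWpos : ∀ x ∈ Ω, 0 < W x) {ε : ℝ} (hε : 0 < ε) :
    ∃ C ≥ 0, ∀ w z, IsTestFun Ω w → IsTestFun Ω z →
      wEnergy q Ω W (fun x => w x - z x) ≤ ε * (wEnergy q Ω W w + wEnergy q Ω W z)
        + C * ((wEnergy q Ω W w + wEnergy q Ω W z) / 2
          - wEnergy q Ω W (fun x => 1 / 2 * w x + 1 / 2 * z x)) := by
  have hq0 : 0 < q := by linarith
  obtain ⟨C₁, hC₁0, hC₁⟩ := exists_norm_sub_rpow_le (H := ℝ) hq hε
  obtain ⟨C₂, hC₂0, hC₂⟩ := exists_norm_sub_rpow_le (H := Euc N) hq hε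
  refine ⟨max C₁ C₂, hC₁0.trans (le_max_left _ _), fun w z hw hz => ?_⟩
  set C := max C₁ C₂
  have hsub : IsTestFun Ω fun x => w x - z x := by
    have := hw.lin hz 1 (-1)
    simpa [sub_eq_add_neg] using this
  have hmid := hw.lin hz (1 / 2) (1 / 2)
  have iw := hw.integrableOn_energy hq0 hWc
  have iz := hz.integrableOn_energy hq0 hWc
  have im := hmid.integrableOn_energy hq0 hWc
  have is := hsub.integrableOn_energy hq0 hWc
  have i1 : IntegrableOn (fun x => (‖gradient w x‖ ^ q + |w x| ^ q) * W x
      + (‖gradient z x‖ ^ q + |z x| ^ q) * W x) Ω := iw.add iz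
  set e : Euc N → ℝ := fun x => (‖gradient w x‖ ^ q + |w x| ^ q) * W x
      + (‖gradient z x‖ ^ q + |z x| ^ q) * W x with he
  have i2 : IntegrableOn (fun x => e x / 2 -
      (‖gradient (fun y => 1 / 2 * w y + 1 / 2 * z y) x‖ ^ q
        + |1 / 2 * w x + 1 / 2 * z x| ^ q) * W x) Ω := (i1.div_const 2).sub im
  have hE : wEnergy q Ω W w + wEnergy q Ω W z = ∫ x in Ω, e x := (integral_add iw iz).symm
  rw [hE, wEnergy, wEnergy, ← integral_div, ← integral_sub (i1.div_const 2) im,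
    ← integral_const_mul, ← integral_const_mul, ← integral_add (i1.const_mul ε) (i2.const_mul C)]
  refine setIntegral_mono_on is ((i1.const_mul ε).add (i2.const_mul C)) hΩ.measurableSet
    fun x hx => ?_
  have g1 : gradient (fun y => w y - z y) x = gradient w x - gradient z x :=
    gradient_sub' (hw.differentiable x) (hz.differentiable x)
  have g2 : gradient (fun y => 1 / 2 * w y + 1 / 2 * z y) x
      = (1 / 2 : ℝ) • (gradient w x + gradient z x) := by
    rw [gradient_lin _ _ (hw.differentiable x) (hz.differentiable x), smul_add]
  have g3 : 1 / 2 * w x + 1 / 2 * z x = (1 / 2 : ℝ) • (w x + z x) := by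
    rw [smul_eq_mul]; ring
  rw [g1, g2, g3]
  have a1 := hC₁ (w x) (z x)
  have a2 := hC₂ (gradient w x) (gradient z x)
  have b1 := mul_le_mul_of_nonneg_right (le_max_left C₁ C₂ : C₁ ≤ C)
    (sub_nonneg.2 (norm_midpoint_rpow_le hq (w x) (z x)))
  have b2 := mul_le_mul_of_nonneg_right (le_max_right C₁ C₂ : C₂ ≤ C)
    (sub_nonneg.2 (norm_midpoint_rpow_le hq (gradient w x) (gradient z x)))
  simp only [Real.norm_eq_abs] at a1 b1
  simp only [he]
  have key : ‖gradient w x - gradient z x‖ ^ q + |w x - z x| ^ q ≤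
      ε * ((‖gradient w x‖ ^ q + |w x| ^ q) + (‖gradient z x‖ ^ q + |z x| ^ q))
      + C * (((‖gradient w x‖ ^ q + |w x| ^ q) + (‖gradient z x‖ ^ q + |z x| ^ q)) / 2
        - (‖(1 / 2 : ℝ) • (gradient w x + gradient z x)‖ ^ q
          + |(1 / 2 : ℝ) • (w x + z x)| ^ q)) := by
    linarith
  refine (mul_le_mul_of_nonneg_right key (hWpos x hx).le).trans (le_of_eq ?_)
  ring

/-- Convex combinations of tails of a bounded sequence can be chosen to be Cauchy. -/
lemma exists_convexHull_cauchy (hΩ : IsOpen Ω) (hq : 1 < q) (hWc : ContinuousOn W Ω)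
    (hWpos : ∀ x ∈ Ω, 0 < W x) (hφ : ∀ k, IsTestFun Ω (φ k)) (hM : ∀ k, wEnergy q Ω W (φ k) ≤ M) :
    ∃ g : ℕ → Euc N → ℝ, (∀ n, g n ∈ convexHull ℝ (φ '' Set.Ici n)) ∧
      ∀ ε > 0, ∃ n0, ∀ n ≥ n0, ∀ m ≥ n, wEnergy q Ω W (fun x => g m x - g n x) ≤ ε := by
  set A : ℕ → Set ℝ := fun n => wEnergy q Ω W '' convexHull ℝ (φ '' Set.Ici n) with hA
  have hmem : ∀ n, φ n ∈ convexHull ℝ (φ '' Set.Ici n) := fun n =>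
    subset_convexHull ℝ _ ⟨n, Set.self_mem_Ici, rfl⟩
  have hmono : ∀ {n m}, n ≤ m → convexHull ℝ (φ '' Set.Ici m) ⊆ convexHull ℝ (φ '' Set.Ici n) :=
    fun h => convexHull_mono (Set.image_mono (Set.Ici_subset_Ici.2 h))
  have hne : ∀ n, (A n).Nonempty := fun n => ⟨_, φ n, hmem n, rfl⟩
  have hbdd : ∀ n, BddBelow (A n) := fun n => ⟨0, by
    rintro _ ⟨w, -, rfl⟩
    exact wEnergy_nonneg hΩ hWpos⟩
  set d : ℕ → ℝ := fun n => sInf (A n) with hd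
  have hdM : ∀ n, d n ≤ M := fun n => (csInf_le (hbdd n) ⟨φ n, hmem n, rfl⟩).trans (hM n)
  have hdmono : Monotone d := fun n m h =>
    csInf_le_csInf (hbdd n) (hne m) (Set.image_mono (hmono h))
  have hlim := tendsto_atTop_ciSup hdmono ⟨M, by rintro _ ⟨n, rfl⟩; exact hdM n⟩
  set d' := ⨆ n, d n
  have hdd' : ∀ n, d n ≤ d' := fun n =>
    le_ciSup (f := d) ⟨M, by rintro _ ⟨n, rfl⟩; exact hdM n⟩ n
  have hex : ∀ n : ℕ, ∃ w ∈ convexHull ℝ (φ '' Set.Ici n),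
      wEnergy q Ω W w < d n + 1 / ((n : ℝ) + 1) := fun n => by
    obtain ⟨_, ⟨w, hw, rfl⟩, h⟩ := exists_lt_of_csInf_lt (hne n)
      (lt_add_of_pos_right (d n) (by positivity : 0 < 1 / ((n : ℝ) + 1)))
    exact ⟨w, hw, h⟩
  choose g hg hgd using hex
  have hgt : ∀ n, IsTestFun Ω (g n) := fun n => IsTestFun.of_mem_convexHull hφ (hg n)
  refine ⟨g, hg, fun ε hε => ?_⟩
  have hM0 : 0 ≤ M := (wEnergy_nonneg hΩ hWpos).trans (hM 0)
  obtain ⟨C, hC0, hC⟩ := exists_wEnergy_sub_le hΩ hq hWc hWpos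
    (by positivity : 0 < ε / (4 * (M + 1)))
  have ht : Tendsto (fun n : ℕ => C * ((d' - d n) + 1 / ((n : ℝ) + 1))) atTop (𝓝 0) := by
    have := ((tendsto_const_nhds (x := d')).sub hlim).add
      (tendsto_one_div_add_atTop_nhds_zero_nat (𝕜 := ℝ))
    simpa using this.const_mul C
  obtain ⟨n0, hn0⟩ := eventually_atTop.1 (ht.eventually_le_const (by linarith : 0 < ε / 2))
  refine ⟨n0, fun n hn m hm => ?_⟩
  have h1 := hC (g m) (g n) (hgt m) (hgt n)
  have h2 := hn0 n hn
  have hnm : 1 / ((m : ℝ) + 1) ≤ 1 / ((n : ℝ) + 1) :=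
    one_div_le_one_div_of_le (by positivity) (by exact_mod_cast Nat.succ_le_succ hm)
  have hn1 : 1 / ((n : ℝ) + 1) ≤ 1 := by
    rw [div_le_one (by positivity)]
    linarith [(Nat.cast_nonneg n : (0 : ℝ) ≤ n)]
  have hmid : d n ≤ wEnergy q Ω W (fun x => 1 / 2 * g m x + 1 / 2 * g n x) :=
    csInf_le (hbdd n) ⟨_, (convex_convexHull ℝ _) (hmono hm (hg m)) (hg n)
      (by norm_num : (0 : ℝ) ≤ 1 / 2) (by norm_num : (0 : ℝ) ≤ 1 / 2) (by norm_num), rfl⟩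
  have e1 := hgd n
  have e2 := hgd m
  have h3 : ε / (4 * (M + 1)) * (wEnergy q Ω W (g m) + wEnergy q Ω W (g n)) ≤ ε / 2 := by
    calc _ ≤ ε / (4 * (M + 1)) * (2 * (M + 1)) :=
          mul_le_mul_of_nonneg_left (by linarith [hdM n, hdM m]) (by positivity)
      _ = ε / 2 := by field_simp; norm_num
  have h4 := mul_le_mul_of_nonneg_left (a := C)
    (by linarith [hdd' n, hdd' m] : (wEnergy q Ω W (g m) + wEnergy q Ω W (g n)) / 2
      - wEnergy q Ω W (fun x => 1 / 2 * g m x + 1 / 2 * g n x)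
        ≤ (d' - d n) + 1 / ((n : ℝ) + 1)) hC0
  linarith

namespace IsSolvingSequence

lemma exists_tendsto_weighted (S : Admissible p q Ω V W f)
    (T : IsSolvingSequence p q Ω V W f M φ u v) :
    ∃ g : ℕ → Euc N → ℝ, (∀ n, IsTestFun Ω (g n)) ∧
      Tendsto (fun n => ∫ x in Ω, (|u x - g n x| ^ q + ‖v x - gradient (g n) x‖ ^ q) * W x)
        atTop (𝓝 0) := by
  have hq0 : 0 < q := by linarith [S.hq1]
  obtain ⟨g, hg, hgc⟩ := exists_convexHull_cauchy S.hΩ S.hq1 S.hWc S.hWpos T.isTestFun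
    T.wEnergy_le
  have hgt : ∀ n, IsTestFun Ω (g n) := fun n => IsTestFun.of_mem_convexHull T.isTestFun (hg n)
  refine ⟨g, hgt, ?_⟩
  have hlim : ∀ᵐ x ∂volume.restrict Ω,
      Tendsto (fun n => (g n x, gradient (g n) x)) atTop (𝓝 (u x, v x)) := by
    filter_upwards [T.tendsto_ae, T.tendsto_gradient_ae] with x h1 h2
    refine Metric.tendsto_atTop.2 fun ε hε => ?_
    obtain ⟨n0, hn0⟩ := Metric.tendsto_atTop.1 (h1.prodMk_nhds h2) ε hε
    refine ⟨n0, fun n hn => ?_⟩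
    exact (convexHull_min
      (t := {w | IsTestFun Ω w ∧ (w x, gradient w x) ∈ Metric.ball (u x, v x) ε})
      (Set.image_subset_iff.2 fun k hk => ⟨T.isTestFun k, hn0 k (hn.trans hk)⟩)
      (convex_setOf_isTestFun_mem x (convex_ball _ _)) (hg n)).2
  have hsub : ∀ m n, IsTestFun Ω fun x => g m x - g n x := fun m n => by
    have := (hgt m).lin (hgt n) 1 (-1)
    simpa [sub_eq_add_neg] using this
  refine Metric.tendsto_atTop.2 fun ε hε => ?_
  obtain ⟨n0, hn0⟩ := hgc (ε / 2) (by linarith)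
  refine ⟨n0, fun n hn => ?_⟩
  have h := (integrable_and_integral_le_of_tendsto_ae (μ := volume.restrict Ω)
    (g := fun m x => (‖gradient (fun y => g m y - g n y) x‖ ^ q + |g m x - g n x| ^ q) * W x)
    (g' := fun x => (|u x - g n x| ^ q + ‖v x - gradient (g n) x‖ ^ q) * W x) (B := ε / 2)
    (fun m => (hsub m n).integrableOn_energy hq0 S.hWc) (fun m => ?_)
    (eventually_atTop.2 ⟨n, fun m hm => hn0 n hn m hm⟩) ?_).2
  · rw [dist_zero_right, Real.norm_eq_abs, abs_of_nonneg (setIntegral_nonneg S.hΩ.measurableSet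
      fun x hx => mul_nonneg (by positivity) (S.hWpos x hx).le)]
    linarith
  · filter_upwards [ae_restrict_mem S.hΩ.measurableSet] with x hx
    exact mul_nonneg (by positivity) (S.hWpos x hx).le
  · filter_upwards [hlim] with x hx
    have h1 : Tendsto (fun m => g m x) atTop (𝓝 (u x)) := (continuous_fst.tendsto _).comp hx
    have h2 : Tendsto (fun m => gradient (g m) x) atTop (𝓝 (v x)) :=
      (continuous_snd.tendsto _).comp hx
    simp only [gradient_sub' ((hgt _).differentiable x) ((hgt n).differentiable x)]
    rw [add_comm (|u x - g n x| ^ q)]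
    exact (((h2.sub_const _).norm.rpow_const (Or.inr hq0.le)).add
      ((h1.sub_const _).abs.rpow_const (Or.inr hq0.le))).mul_const _

end IsSolvingSequence

end StrongApproximation

section Homogeneity

variable {N : ℕ} {Ω : Set (Euc N)} {p : ℝ} {V : Euc N → ℝ} {f : (Euc N → ℝ) → ℝ}

lemma QV_smul {u : Euc N → ℝ} (hu : IsTestFun Ω u) (c : ℝ) :
    QV p Ω V (fun x => c * u x + 0 * u x) = |c| ^ p * QV p Ω V u := by
  simp only [QV]
  rw [mul_sub, ← integral_const_mul, ← integral_const_mul]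
  congr 2
  · ext x
    rw [gradient_lin _ _ (hu.differentiable x) (hu.differentiable x), zero_smul, add_zero,
      norm_smul, Real.norm_eq_abs, mul_rpow (abs_nonneg _) (norm_nonneg _)]
  · ext x
    rw [zero_mul, add_zero, abs_mul, mul_rpow (abs_nonneg _) (abs_nonneg _)]
    ring

/-- A linear functional bounded above on the unit sphere of `Q_V` is bounded by a multiple of
`Q_V ^ (1 / p)`. -/
lemma exists_abs_le_mul_QV_rpow (hp : 0 < p)
    (hQpos : ∀ u : Euc N → ℝ, IsTestFun Ω u → u ≠ 0 → 0 < QV p Ω V u)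
    (hflin : ∀ (a b : ℝ) (ζ η : Euc N → ℝ), IsTestFun Ω ζ → IsTestFun Ω η →
      f (fun x => a * ζ x + b * η x) = a * f ζ + b * f η)
    (hfin : ∃ C : ℝ, ∀ u : Euc N → ℝ, IsTestFun Ω u → QV p Ω V u = 1 → f u ≤ C) :
    ∃ C : ℝ, 0 ≤ C ∧ ∀ u, IsTestFun Ω u → |f u| ≤ C * QV p Ω V u ^ (1 / p) := by
  obtain ⟨C, hC⟩ := hfin
  refine ⟨max C 0, le_max_right _ _, fun u hu => ?_⟩
  by_cases h0 : u = 0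
  · have hf0 : f u = 0 := by
      have h := hflin 0 0 u u hu hu
      simp only [zero_mul, add_zero] at h
      rw [h0]
      exact h
    have hQ0 : QV p Ω V u = 0 := by
      have h := QV_smul (p := p) (V := V) hu 0
      rw [abs_zero, zero_rpow hp.ne', zero_mul] at h
      rw [← h]
      congr 1
      ext x
      simp [h0]
    rw [hf0, hQ0, zero_rpow (by positivity)]
    simp
  · have hQ := hQpos u hu h0
    have hR : 0 < QV p Ω V u ^ (1 / p) := rpow_pos_of_pos hQ _
    have hRp : (QV p Ω V u ^ (1 / p)) ^ p = QV p Ω V u := by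
      rw [← rpow_mul hQ.le, one_div_mul_cancel hp.ne', rpow_one]
    have key : ∀ c : ℝ, |c| = (QV p Ω V u ^ (1 / p))⁻¹ → c * f u ≤ max C 0 := fun c hc => by
      have h := hC _ (hu.lin hu c 0) (by
        rw [QV_smul hu, hc, inv_rpow hR.le, hRp, inv_mul_cancel₀ hQ.ne'])
      rw [hflin _ _ _ _ hu hu, zero_mul, add_zero] at h
      exact h.trans (le_max_left _ _)
    have h1 := key _ (abs_of_pos (inv_pos.2 hR))
    have h2 := key (-(QV p Ω V u ^ (1 / p))⁻¹) (by rw [abs_neg, abs_of_pos (inv_pos.2 hR)])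
    rw [neg_mul_comm] at h2
    rw [inv_mul_le_iff₀ hR] at h1 h2
    rw [mul_comm]
    exact abs_le'.2 ⟨h1, h2⟩

end Homogeneity

/-- Theorem 4.5, main result: under condition (A), for every linear
functional `f` on `D(Ω)` with `sup{f(u) : Q_V(u) = 1} < ∞` there is a distributional
solution `u ∈ W^{1,q}_0(Ω, W dx)` of `-Δ_p u - V |u|^{p-2} u = f`. -/
theorem stmt7 (N : ℕ) (p q r : ℝ) (hp : 1 < p)
    (Ω : Set (Euc N)) (hΩo : IsOpen Ω) (hΩc : IsConnected Ω)
    (V : Euc N → ℝ) (hV0 : ∀ x ∈ Ω, 0 ≤ V x)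
    (hVr : ∀ K : Set (Euc N), IsCompact K → K ⊆ Ω → IntegrableOn (fun x => V x ^ r) K)
    (hQpos : ∀ u : Euc N → ℝ, IsTestFun Ω u → u ≠ 0 → 0 < QV p Ω V u)
    (hq1 : 1 < q) (hqp : q ≤ p) (hpq : p - 1 < q)
    (hrlt : (N : ℝ) < q → r = 1) (hreq : (N : ℝ) = q → 1 < r)
    (hrgt : q < (N : ℝ) → 1 / r + (p - 1) / ((N * q) / (N - q)) = 1)
    (W : Euc N → ℝ) (hWc : ContinuousOn W Ω) (hWpos : ∀ x ∈ Ω, 0 < W x)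
    (hA : ∀ u : Euc N → ℝ, IsTestFun Ω u →
      (∫ x in Ω, (‖gradient u x‖ ^ q + |u x| ^ q) * W x) ^ (p / q) ≤ QV p Ω V u)
    (f : (Euc N → ℝ) → ℝ)
    (hflin : ∀ (a b : ℝ) (ζ η : Euc N → ℝ), IsTestFun Ω ζ → IsTestFun Ω η →
      f (fun x => a * ζ x + b * η x) = a * f ζ + b * f η)
    (hfin : ∃ C : ℝ, ∀ u : Euc N → ℝ, IsTestFun Ω u → QV p Ω V u = 1 → f u ≤ C) :
    ∃ (u : Euc N → ℝ) (v : Euc N → Euc N),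
      LocallyIntegrableOn u Ω ∧ HasWeakGradOn Ω u v ∧
      IntegrableOn (fun x => (|u x| ^ q + ‖v x‖ ^ q) * W x) Ω ∧
      (∃ φ : ℕ → Euc N → ℝ, (∀ j, IsTestFun Ω (φ j)) ∧
        Tendsto (fun j => ∫ x in Ω,
            (|u x - φ j x| ^ q + ‖v x - gradient (φ j) x‖ ^ q) * W x) atTop (𝓝 0)) ∧
      (∀ ζ : Euc N → ℝ, IsTestFun Ω ζ →
        IntegrableOn (fun x => ⟪pvec p (v x), gradient ζ x⟫) Ω ∧
        IntegrableOn (fun x => V x * psc p (u x) * ζ x) Ω ∧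
        (∫ x in Ω, ⟪pvec p (v x), gradient ζ x⟫)
          - (∫ x in Ω, V x * psc p (u x) * ζ x) = f ζ) := by
  have hr := one_le_of_integrability hp hq1 hpq hrlt hreq hrgt
  have S : Admissible p q Ω V W f :=
    { hp := hp, hΩ := hΩo, hV0 := hV0, hq1 := hq1, hpq := hpq
      hWc := hWc, hWpos := hWpos, hA := hA, hlin := hflin
      hVi := fun K hK hKΩ => by
        simpa only [rpow_one] using integrableOn_rpow_of_le hK (fun x hx => hV0 x (hKΩ hx)) hr
          zero_le_one hr (hVr K hK hKΩ)
      hf := exists_abs_le_mul_QV_rpow (by linarith) hQpos hflin hfin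
      hVB := potentialBound hp hΩo hV0 hVr hq1 hpq hrlt hreq hrgt hWc hWpos }
  obtain ⟨M, φ, u, v, T⟩ := S.exists_isSolvingSequence
  refine ⟨u, v, (locallyIntegrableOn_iff hΩo.isLocallyClosed).2 fun K hKΩ hK =>
    T.integrableOn_compact S hK hKΩ, T.hasWeakGradOn S, ?_, T.exists_tendsto_weighted S,
    fun ζ hζ => ⟨(T.tendsto_integral_inner S hζ).1, (T.tendsto_integral_potential S hζ).1,
      T.integral_eq S hζ⟩⟩
  simpa only [add_comm] using T.integrableOn_weighted S

end
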